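/- arXiv:1501.01572 — 2 statements merged into one kernel-verified Lean document; each statement's English description precedes it below -/
import Mathlib

section
/- Let μ be a finite Borel measure on ℝ^d such that the upper n-dimensional density Θ^{n,*}(x,μ) = limsup_{r→0} μ(B(x,r))/(2r)^n satisfies 0 < Θ^{n,*}(x,μ) < ∞ for μ-a.e. x, and suppose ∫₀¹ β_{μ,2}(x,r)² dr/r < ∞ for μ-a.e. x. Then μ is n-rectifiable, i.e., there exist Lipschitz maps f_i : ℝ^n → ℝ^d with μ(ℝ^d \ ⋃_i f_i(ℝ^n)) = 0 and μ is absolutely continuous with respect to n-dimensional Hausdorff measure. -/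
open MeasureTheory Metric Set Filter
open scoped ENNReal NNReal

/-- The squared `L²` Jones beta number `β_{μ,2}(x,r)²`, where the infimum runs
over all affine `n`-planes `L ⊂ ℝ^d`. -/
noncomputable def beta2sq (n d : ℕ) (μ : Measure (EuclideanSpace ℝ (Fin d)))
    (x : EuclideanSpace ℝ (Fin d)) (r : ℝ) : ℝ≥0∞ :=
  ⨅ L : {L : AffineSubspace ℝ (EuclideanSpace ℝ (Fin d)) //
      Module.finrank ℝ L.direction = n},
    (∫⁻ y in closedBall x r,
        ENNReal.ofReal ((infDist y (L.1 : Set (EuclideanSpace ℝ (Fin d))) / r) ^ 2) ∂μ) /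
      ENNReal.ofReal (r ^ n)

/-- The upper `n`-dimensional density `Θ^{n,*}(x,μ) = limsup_{r→0} μ(B(x,r))/(2r)^n`. -/
noncomputable def upperDensity (n d : ℕ) (μ : Measure (EuclideanSpace ℝ (Fin d)))
    (x : EuclideanSpace ℝ (Fin d)) : ℝ≥0∞ :=
  Filter.limsup (fun r : ℝ => μ (closedBall x r) / ENNReal.ofReal ((2 * r) ^ n))
    (nhdsWithin 0 (Set.Ioi 0))

set_option linter.unusedSectionVars false

namespace AT

/-- Cardinality of separated families in a ball. -/
theorem card_separated {F : Type*} [NormedAddCommGroup F] [NormedSpace ℝ F]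
    [FiniteDimensional ℝ F] {ι : Type*} (s : Finset ι) (g : ι → F) (x : F) (R t : ℝ) (hR : 0 ≤ R)
    (ht : 0 < t) (hs : ∀ i ∈ s, ‖g i - x‖ ≤ R)
    (h : ∀ i ∈ s, ∀ j ∈ s, i ≠ j → t ≤ ‖g i - g j‖) :
    (s.card : ℝ) ≤ (1 + 2 * R / t) ^ Module.finrank ℝ F := by
  borelize F
  let μ : Measure F := Measure.addHaar
  set ρ : ℝ := R + t / 2 with hρ
  have ρpos : 0 < ρ := by positivity
  have δpos : 0 < t / 2 := by positivity
  set A := ⋃ c ∈ s, ball (g c : F) (t / 2) with hA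
  have D : Set.Pairwise (s : Set ι) (Function.onFun Disjoint fun c => ball (g c : F) (t / 2)) := by
    rintro c hc d hd hcd
    apply ball_disjoint_ball
    rw [dist_eq_norm]
    have := h c hc d hd hcd
    linarith
  have A_subset : A ⊆ ball (x : F) ρ := by
    refine iUnion₂_subset fun c hc => ?_
    apply ball_subset_ball'
    rw [dist_eq_norm]
    have := hs c hc
    linarith
  have I :
    (s.card : ℝ≥0∞) * ENNReal.ofReal ((t / 2) ^ Module.finrank ℝ F) * μ (ball 0 1) ≤
      ENNReal.ofReal (ρ ^ Module.finrank ℝ F) * μ (ball 0 1) :=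
    calc
      (s.card : ℝ≥0∞) * ENNReal.ofReal ((t / 2) ^ Module.finrank ℝ F) * μ (ball 0 1) = μ A := by
        rw [hA, measure_biUnion_finset D fun c _ => measurableSet_ball]
        simp only [μ.addHaar_ball_of_pos _ δpos]
        simp only [Finset.sum_const, nsmul_eq_mul, mul_assoc]
      _ ≤ μ (ball (x : F) ρ) := measure_mono A_subset
      _ = ENNReal.ofReal (ρ ^ Module.finrank ℝ F) * μ (ball 0 1) := by
        simp only [μ.addHaar_ball_of_pos _ ρpos]
  have J : (s.card : ℝ≥0∞) * ENNReal.ofReal ((t / 2) ^ Module.finrank ℝ F) ≤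
      ENNReal.ofReal (ρ ^ Module.finrank ℝ F) :=
    (ENNReal.mul_le_mul_iff_left (measure_ball_pos _ _ zero_lt_one).ne' measure_ball_lt_top.ne).1 I
  have K := ENNReal.toReal_le_of_le_ofReal (pow_nonneg ρpos.le _) J
  rw [ENNReal.toReal_mul, ENNReal.toReal_natCast, ENNReal.toReal_ofReal (by positivity)] at K
  have e : (1 + 2 * R / t) = ρ / (t / 2) := by rw [hρ]; field_simp; ring
  rw [e, div_pow, le_div_iff₀ (by positivity)]
  exact K

/-- Existence of finite separated nets. -/
theorem exists_net {H : Type*} [NormedAddCommGroup H] [NormedSpace ℝ H] [FiniteDimensional ℝ H]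
    {F : Type*} [NormedAddCommGroup F] [NormedSpace ℝ F] [FiniteDimensional ℝ F]
    (g : H → F) (A : Set H) (x : F) (R t : ℝ) (ht : 0 < t) (hA : ∀ y ∈ A, ‖g y - x‖ ≤ R) :
    ∃ J : Finset H, (J : Set H) ⊆ A ∧ (∀ i ∈ J, ∀ j ∈ J, i ≠ j → t ≤ ‖g i - g j‖) ∧
      ∀ y ∈ A, ∃ j ∈ J, ‖g y - g j‖ < t := by
  classical
  rcases A.eq_empty_or_nonempty with rfl | ⟨y0, hy0⟩
  · exact ⟨∅, by simp, by simp, by simp⟩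
  have hR : 0 ≤ R := (norm_nonneg _).trans (hA y0 hy0)
  let S : Set ℕ := {m | ∃ J : Finset H, (J : Set H) ⊆ A ∧
    (∀ i ∈ J, ∀ j ∈ J, i ≠ j → t ≤ ‖g i - g j‖) ∧ J.card = m}
  have hbdd : ∀ m ∈ S, m ≤ ⌊(1 + 2 * R / t) ^ Module.finrank ℝ F⌋₊ := by
    rintro m ⟨J, hJ, hs, rfl⟩
    exact Nat.le_floor (card_separated J g x R t hR ht (fun i hi => hA i (hJ hi)) hs)
  have hne : S.Nonempty := ⟨0, ∅, by simp, by simp, rfl⟩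
  have hmax := Nat.sSup_mem hne ⟨_, hbdd⟩
  obtain ⟨J, hJ, hs, hc⟩ := hmax
  refine ⟨J, hJ, hs, fun y hy => ?_⟩
  by_contra hcon
  push Not at hcon
  have hyJ : y ∉ J := fun h => by
    have := hcon y h
    simp at this
    linarith
  have : J.card + 1 ∈ S := by
    refine ⟨insert y J, ?_, ?_, Finset.card_insert_of_notMem hyJ⟩
    · intro z hz
      rcases Finset.mem_insert.1 (by exact_mod_cast hz) with rfl | h
      · exact hy
      · exact hJ h
    · intro i hi j hj hij
      rcases Finset.mem_insert.1 hi with rfl | hi' <;> rcases Finset.mem_insert.1 hj with rfl | hj'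
      · exact absurd rfl hij
      · exact hcon j hj'
      · rw [norm_sub_rev]; exact hcon i hi'
      · exact hs i hi' j hj' hij
  have := le_csSup ⟨_, hbdd⟩ this
  omega

section geom
variable {H : Type*} [NormedAddCommGroup H] [InnerProductSpace ℝ H] [FiniteDimensional ℝ H]

/-- Orthogonal projection onto the affine plane `c + V`. -/
noncomputable def pr (c : H) (V : Submodule ℝ H) (y : H) : H := c + V.starProjection (y - c)

theorem pr_sub (c : H) (V : Submodule ℝ H) (y z : H) :
    pr c V y - pr c V z = V.starProjection (y - z) := by
  simp only [pr, add_sub_add_left_eq_sub, ← map_sub]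
  congr 1; abel

theorem pr_pr (c : H) (V : Submodule ℝ H) (y : H) : pr c V (pr c V y) = pr c V y := by
  simp only [pr, add_sub_cancel_left]
  rw [Submodule.starProjection_eq_self_iff.2 (Submodule.starProjection_apply_mem _ _)]

theorem proj_proj (V : Submodule ℝ H) (v : H) :
    V.starProjection (V.starProjection v) = V.starProjection v :=
  Submodule.starProjection_eq_self_iff.2 (Submodule.starProjection_apply_mem _ _)

theorem norm_proj_le (V : Submodule ℝ H) (v : H) : ‖V.starProjection v‖ ≤ ‖v‖ :=
  Submodule.norm_starProjection_apply_le V v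

theorem inner_perp (V : Submodule ℝ H) (v w : H) :
    inner ℝ (v - V.starProjection v) (V.starProjection w) = 0 :=
  Submodule.starProjection_inner_eq_zero _ _ (Submodule.starProjection_apply_mem _ _)

theorem norm_perp_le (V : Submodule ℝ H) (v : H) : ‖v - V.starProjection v‖ ≤ ‖v‖ := by
  have h := norm_add_sq_real (v - V.starProjection v) (V.starProjection v)
  rw [inner_perp, sub_add_cancel] at h
  nlinarith [norm_nonneg v, norm_nonneg (v - V.starProjection v), sq_nonneg ‖V.starProjection v‖]

theorem inner_perp_self (V : Submodule ℝ H) (v w : H) :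
    inner ℝ v (w - V.starProjection w) = inner ℝ (v - V.starProjection v) (w - V.starProjection w) := by
  have h := inner_perp V w v
  rw [inner_sub_left v (V.starProjection v), real_inner_comm (w - V.starProjection w) (V.starProjection v), h]
  simp

/-- Abstract one-step estimate. -/
theorem step_abs {ι : Type*} (J : Finset ι) (θp θq : ι → ℝ) (c : ι → H) (V : ι → Submodule ℝ H)
    (p q : H) (r A B Λ : ℝ) (hr : 0 < r) (hA : 0 ≤ A) (hB : 0 ≤ B) 
    (hθ0 : ∀ j ∈ J, 0 ≤ θp j) (hθ1 : ∑ j ∈ J, θp j ≤ 1)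
    (hθ : ∑ j ∈ J, |θp j - θq j| ≤ Λ * (‖p - q‖ / r))
    (h1 : ∀ j ∈ J, ‖(p - q) - (V j).starProjection (p - q)‖ ≤ A * ‖p - q‖)
    (h2 : ∀ j ∈ J, ‖pr (c j) (V j) q - q‖ ≤ B * r) :
    let v' := (p + ∑ j ∈ J, θp j • (pr (c j) (V j) p - p))
      - (q + ∑ j ∈ J, θq j • (pr (c j) (V j) q - q))
    ‖v' - (p - q)‖ ≤ (A + Λ * B) * ‖p - q‖ ∧
    ‖v'‖ ^ 2 ≤ (1 + 2 * Λ * A * B + (A + Λ * B) ^ 2) * ‖p - q‖ ^ 2 := by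
  intro v'
  set v := p - q with hv
  set g : ι → H := fun j => pr (c j) (V j) q - q with hg
  set X1 : H := ∑ j ∈ J, θp j • (v - (V j).starProjection v) with hX1
  set X2 : H := ∑ j ∈ J, (θp j - θq j) • g j with hX2
  have hv' : v' = v - X1 + X2 := by
    simp only [v', hX1, hX2, sub_smul, Finset.sum_sub_distrib]
    have : ∀ j, θp j • (pr (c j) (V j) p - p) = θp j • g j - θp j • (v - (V j).starProjection v) := by
      intro j
      rw [← smul_sub, ← pr_sub (c j)]
      simp only [hg, hv]
      congr 1; abel
    simp only [this, Finset.sum_sub_distrib, hg, hv]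
    abel
  have hX1n : ‖X1‖ ≤ A * ‖v‖ := by
    calc ‖X1‖ ≤ ∑ j ∈ J, ‖θp j • (v - (V j).starProjection v)‖ := norm_sum_le _ _
      _ ≤ ∑ j ∈ J, θp j * (A * ‖v‖) := by
        apply Finset.sum_le_sum; intro j hj
        rw [norm_smul, Real.norm_eq_abs, abs_of_nonneg (hθ0 j hj)]
        exact mul_le_mul_of_nonneg_left (h1 j hj) (hθ0 j hj)
      _ = (∑ j ∈ J, θp j) * (A * ‖v‖) := by rw [Finset.sum_mul]
      _ ≤ 1 * (A * ‖v‖) := by gcongr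
      _ = _ := one_mul _
  have hX2n : ‖X2‖ ≤ Λ * B * ‖v‖ := by
    calc ‖X2‖ ≤ ∑ j ∈ J, ‖(θp j - θq j) • g j‖ := norm_sum_le _ _
      _ ≤ ∑ j ∈ J, |θp j - θq j| * (B * r) := by
        apply Finset.sum_le_sum; intro j hj
        rw [norm_smul, Real.norm_eq_abs]
        exact mul_le_mul_of_nonneg_left (h2 j hj) (abs_nonneg _)
      _ = (∑ j ∈ J, |θp j - θq j|) * (B * r) := by rw [Finset.sum_mul]
      _ ≤ Λ * (‖v‖ / r) * (B * r) := by gcongr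
      _ = _ := by field_simp
  have hin1 : 0 ≤ inner ℝ v X1 := by
    rw [hX1, inner_sum]
    apply Finset.sum_nonneg; intro j hj
    rw [inner_smul_right, inner_perp_self]
    exact mul_nonneg (hθ0 j hj) real_inner_self_nonneg
  have hgp : ∀ j, g j = -((q - c j) - (V j).starProjection (q - c j)) := by
    intro j; simp only [hg, pr]; abel
  have hin2 : inner ℝ v X2 ≤ Λ * A * B * ‖v‖ ^ 2 := by
    rw [hX2, inner_sum]
    calc ∑ j ∈ J, inner ℝ v ((θp j - θq j) • g j) 
        ≤ ∑ j ∈ J, |θp j - θq j| * (A * ‖v‖ * (B * r)) := by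
          apply Finset.sum_le_sum; intro j hj
          rw [inner_smul_right]
          refine (le_abs_self _).trans ?_
          rw [abs_mul]
          apply mul_le_mul_of_nonneg_left _ (abs_nonneg _)
          rw [hgp, inner_neg_right, inner_perp_self, ← inner_neg_right, ← hgp]
          refine (abs_real_inner_le_norm _ _).trans ?_
          exact mul_le_mul (h1 j hj) (h2 j hj) (norm_nonneg _) (by positivity)
      _ = (∑ j ∈ J, |θp j - θq j|) * (A * ‖v‖ * (B * r)) := by rw [Finset.sum_mul]
      _ ≤ Λ * (‖v‖ / r) * (A * ‖v‖ * (B * r)) := by gcongr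
      _ = _ := by field_simp
  have hX : ‖X2 - X1‖ ≤ (A + Λ * B) * ‖v‖ := by
    calc ‖X2 - X1‖ ≤ ‖X2‖ + ‖X1‖ := norm_sub_le _ _
      _ ≤ _ := by linarith
  have e : v' - v = X2 - X1 := by rw [hv']; abel
  refine ⟨by rw [e]; exact hX, ?_⟩
  have e2 : v' = v + (X2 - X1) := by rw [← e]; abel
  rw [e2, norm_add_sq_real, inner_sub_right]
  have : ‖X2 - X1‖ ^ 2 ≤ ((A + Λ * B) * ‖v‖) ^ 2 := by gcongr
  nlinarith
end geom
end AT

namespace AT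

section weights
variable {H : Type*} [NormedAddCommGroup H] [InnerProductSpace ℝ H] [FiniteDimensional ℝ H]

/-- Cut-off weight. -/
noncomputable def wt (r : ℝ) (j y : H) : ℝ := max 0 (min 1 (11 - ‖y - j‖ / r))

theorem wt_nonneg (r : ℝ) (j y : H) : 0 ≤ wt r j y := le_max_left _ _

theorem wt_eq_zero {r : ℝ} (hr : 0 < r) {j y : H} (h : 11 * r ≤ ‖y - j‖) : wt r j y = 0 := by
  unfold wt
  apply max_eq_left
  apply (min_le_right _ _).trans
  have : 11 ≤ ‖y - j‖ / r := by rw [le_div_iff₀ hr]; exact h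
  linarith

theorem wt_eq_one {r : ℝ} (hr : 0 < r) {j y : H} (h : ‖y - j‖ ≤ 10 * r) : wt r j y = 1 := by
  unfold wt
  have : ‖y - j‖ / r ≤ 10 := by rw [div_le_iff₀ hr]; exact h
  rw [min_eq_left (by linarith)]
  simp

theorem wt_lip {r : ℝ} (hr : 0 < r) (j p q : H) : |wt r j p - wt r j q| ≤ ‖p - q‖ / r := by
  unfold wt
  have h1 : |max 0 (min 1 (11 - ‖p - j‖ / r)) - max 0 (min 1 (11 - ‖q - j‖ / r))|
      ≤ |(11 - ‖p - j‖ / r) - (11 - ‖q - j‖ / r)| := by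
    refine (abs_max_sub_max_le_max _ _ _ _).trans ?_
    rw [sub_self, abs_zero, max_eq_right (abs_nonneg _)]
    refine (abs_min_sub_min_le_max _ _ _ _).trans ?_
    rw [sub_self, abs_zero, max_eq_right (abs_nonneg _)]
  refine h1.trans ?_
  have : (11 - ‖p - j‖ / r) - (11 - ‖q - j‖ / r) = (‖q - j‖ - ‖p - j‖) / r := by ring
  rw [this, abs_div, abs_of_pos hr]
  gcongr
  refine (abs_norm_sub_norm_le _ _).trans ?_
  rw [sub_sub_sub_cancel_right, norm_sub_rev]

theorem wt_cont {r : ℝ} (j : H) : Continuous (wt r j) := by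
  unfold wt; fun_prop

/-- separated finset -/
def Sep (r : ℝ) (J : Finset H) : Prop := ∀ i ∈ J, ∀ j ∈ J, i ≠ j → r ≤ ‖i - j‖

theorem sum_wt_lip {r : ℝ} (hr : 0 < r) {J : Finset H} (hJ : Sep r J) (p q : H) :
    ∑ j ∈ J, |wt r j p - wt r j q| ≤ 2 * 23 ^ Module.finrank ℝ H * (‖p - q‖ / r) := by
  classical
  have key : ∀ y : H, ((J.filter (fun j => ‖j - y‖ ≤ 11 * r)).card : ℝ) ≤ 23 ^ Module.finrank ℝ H := by
    intro y
    have := card_separated (J.filter (fun j => ‖j - y‖ ≤ 11 * r)) (fun j => j) y (11 * r) r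
      (by positivity) hr (fun i hi => (Finset.mem_filter.1 hi).2)
      (fun i hi j hj => hJ i (Finset.mem_filter.1 hi).1 j (Finset.mem_filter.1 hj).1)
    have e : 1 + 2 * (11 * r) / r = 23 := by field_simp; norm_num
    rwa [e] at this
  set D := ‖p - q‖ / r with hD
  have hD0 : 0 ≤ D := by positivity
  calc ∑ j ∈ J, |wt r j p - wt r j q|
      ≤ ∑ j ∈ J, ((if ‖j - p‖ ≤ 11 * r then D else 0) + (if ‖j - q‖ ≤ 11 * r then D else 0)) := by
        apply Finset.sum_le_sum
        intro j hj
        have := wt_lip hr j p q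
        by_cases h1 : ‖j - p‖ ≤ 11 * r
        · rw [if_pos h1]; split_ifs <;> linarith
        · by_cases h2 : ‖j - q‖ ≤ 11 * r
          · rw [if_pos h2]; split_ifs; linarith
          · rw [if_neg h1, if_neg h2, wt_eq_zero hr, wt_eq_zero hr]
            · simp
            · rw [norm_sub_rev]; linarith
            · rw [norm_sub_rev]; linarith
    _ ≤ _ := by
        rw [Finset.sum_add_distrib, ← Finset.sum_filter, ← Finset.sum_filter, Finset.sum_const,
          Finset.sum_const, nsmul_eq_mul, nsmul_eq_mul]
        have h1 := mul_le_mul_of_nonneg_right (key p) hD0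
        have h2 := mul_le_mul_of_nonneg_right (key q) hD0
        linarith

/-- normalized weights -/
noncomputable def th (r : ℝ) (J : Finset H) (j y : H) : ℝ := wt r j y / max 1 (∑ i ∈ J, wt r i y)

theorem th_nonneg (r : ℝ) (J : Finset H) (j y : H) : 0 ≤ th r J j y :=
  div_nonneg (wt_nonneg _ _ _) (le_max_of_le_left zero_le_one)

theorem sum_th_le (r : ℝ) (J : Finset H) (y : H) : ∑ j ∈ J, th r J j y ≤ 1 := by
  unfold th
  rw [← Finset.sum_div, div_le_one (lt_max_of_lt_left one_pos)]
  exact le_max_right _ _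

theorem sum_th_eq {r : ℝ} (hr : 0 < r) {J : Finset H} {j y : H} (hj : j ∈ J) (h : ‖y - j‖ ≤ 10 * r) :
    ∑ j ∈ J, th r J j y = 1 := by
  unfold th
  have h1 : 1 ≤ ∑ i ∈ J, wt r i y := by
    rw [← wt_eq_one hr h]
    exact Finset.single_le_sum (f := fun i => wt r i y) (fun i _ => wt_nonneg _ _ _) hj
  rw [← Finset.sum_div, max_eq_right h1, div_self (by linarith)]

theorem th_eq_zero {r : ℝ} (hr : 0 < r) {J : Finset H} {j y : H} (h : 11 * r ≤ ‖y - j‖) :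
    th r J j y = 0 := by
  unfold th; rw [wt_eq_zero hr h, zero_div]

theorem th_ne_zero {r : ℝ} (hr : 0 < r) {J : Finset H} {j y : H} (h : th r J j y ≠ 0) :
    ‖y - j‖ < 11 * r := by
  by_contra hc
  exact h (th_eq_zero hr (not_lt.1 hc))

theorem th_cont {r : ℝ} (J : Finset H) (j : H) : Continuous (th r J j) := by
  unfold th
  apply Continuous.div (wt_cont j)
  · exact continuous_const.max (continuous_finsetSum _ (fun i _ => wt_cont i))
  · intro y; exact (lt_max_of_lt_left one_pos).ne'

theorem sum_th_lip {r : ℝ} (hr : 0 < r) {J : Finset H} (hJ : Sep r J) (p q : H) :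
    ∑ j ∈ J, |th r J j p - th r J j q| ≤ 4 * 23 ^ Module.finrank ℝ H * (‖p - q‖ / r) := by
  set mp := max 1 (∑ i ∈ J, wt r i p) with hmp
  set mq := max 1 (∑ i ∈ J, wt r i q) with hmq
  have p1 : 1 ≤ mp := le_max_left _ _
  have q1 : 1 ≤ mq := le_max_left _ _
  set S := ∑ j ∈ J, |wt r j p - wt r j q| with hS
  have hm : |mq - mp| ≤ S := by
    refine (abs_max_sub_max_le_max _ _ _ _).trans ?_
    rw [sub_self, abs_zero, max_eq_right (abs_nonneg _), ← Finset.sum_sub_distrib]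
    refine (Finset.abs_sum_le_sum_abs _ _).trans (le_of_eq ?_)
    exact Finset.sum_congr rfl (fun i _ => abs_sub_comm _ _)
  have h1 : ∀ j, |th r J j p - th r J j q| ≤ |wt r j p - wt r j q| + th r J j q * |mq - mp| := by
    intro j
    have e : th r J j p - th r J j q = ((wt r j p - wt r j q) + th r J j q * (mq - mp)) / mp := by
      unfold th
      rw [← hmp, ← hmq]
      field_simp
      ring
    rw [e, abs_div, abs_of_pos (by linarith : 0 < mp)]
    refine (div_le_self (abs_nonneg _) p1).trans ?_
    refine (abs_add_le _ _).trans ?_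
    rw [abs_mul, abs_of_nonneg (th_nonneg _ _ _ _)]
  calc _ ≤ ∑ j ∈ J, (|wt r j p - wt r j q| + th r J j q * |mq - mp|) :=
        Finset.sum_le_sum (fun j _ => h1 j)
    _ = S + (∑ j ∈ J, th r J j q) * |mq - mp| := by
        rw [Finset.sum_add_distrib, ← Finset.sum_mul]
    _ ≤ S + 1 * S := by
        have := sum_th_le r J q
        gcongr
    _ ≤ _ := by
        have := sum_wt_lip hr hJ p q
        linarith

/-- The map σ. -/
noncomputable def sg (r : ℝ) (J : Finset H) (c : H → H) (V : H → Submodule ℝ H) (y : H) : H :=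
  y + ∑ j ∈ J, th r J j y • (pr (c j) (V j) y - y)

theorem pr_cont (c : H) (V : Submodule ℝ H) : Continuous (pr c V) := by
  unfold pr; fun_prop

theorem sg_cont {r : ℝ} (J : Finset H) (c : H → H) (V : H → Submodule ℝ H) :
    Continuous (sg r J c V) := by
  unfold sg
  apply continuous_id.add
  apply continuous_finsetSum
  intro j _
  exact (th_cont J j).smul ((pr_cont _ _).sub continuous_id)

theorem sg_eq_self {r : ℝ} (hr : 0 < r) {J : Finset H} {c : H → H} {V : H → Submodule ℝ H} {y : H}
    (h : ∀ j ∈ J, 11 * r ≤ ‖y - j‖) : sg r J c V y = y := by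
  unfold sg
  rw [Finset.sum_eq_zero, add_zero]
  intro j hj
  rw [th_eq_zero hr (h j hj), zero_smul]

/-- displacement -/
theorem sg_disp {r : ℝ} {J : Finset H} {c : H → H} {V : H → Submodule ℝ H} {y : H} {D : ℝ} 
    (hD : 0 ≤ D)
    (h : ∀ j ∈ J, th r J j y ≠ 0 → ‖pr (c j) (V j) y - y‖ ≤ D) : ‖sg r J c V y - y‖ ≤ D := by
  unfold sg
  rw [add_sub_cancel_left]
  calc _ ≤ ∑ j ∈ J, ‖th r J j y • (pr (c j) (V j) y - y)‖ := norm_sum_le _ _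
    _ ≤ ∑ j ∈ J, th r J j y * D := by
      apply Finset.sum_le_sum; intro j hj
      rw [norm_smul, Real.norm_eq_abs, abs_of_nonneg (th_nonneg _ _ _ _)]
      by_cases h0 : th r J j y = 0
      · rw [h0]; simp
      · exact mul_le_mul_of_nonneg_left (h j hj h0) (th_nonneg _ _ _ _)
    _ = (∑ j ∈ J, th r J j y) * D := by rw [Finset.sum_mul]
    _ ≤ 1 * D := by gcongr; exact sum_th_le _ _ _
    _ = D := one_mul _

theorem sg_step {r : ℝ} (hr : 0 < r) {J : Finset H} (hJ : Sep r J) {c : H → H} 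
    {V : H → Submodule ℝ H} {p q : H} {A B : ℝ} (hA : 0 ≤ A) (hB : 0 ≤ B)
    (h1 : ∀ j ∈ J, (‖p - j‖ < 11 * r ∨ ‖q - j‖ < 11 * r) → 
      ‖(p - q) - (V j).starProjection (p - q)‖ ≤ A * ‖p - q‖)
    (h2 : ∀ j ∈ J, (‖p - j‖ < 11 * r ∨ ‖q - j‖ < 11 * r) → ‖pr (c j) (V j) q - q‖ ≤ B * r) :
    ‖(sg r J c V p - sg r J c V q) - (p - q)‖ ≤ (A + (4 * 23 ^ Module.finrank ℝ H) * B) * ‖p - q‖ ∧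
    ‖sg r J c V p - sg r J c V q‖ ^ 2 ≤ (1 + 2 * (4 * 23 ^ Module.finrank ℝ H) * A * B 
      + (A + (4 * 23 ^ Module.finrank ℝ H) * B) ^ 2) * ‖p - q‖ ^ 2 := by
  classical
  let J' := J.filter (fun j => ‖p - j‖ < 11 * r ∨ ‖q - j‖ < 11 * r)
  have hsub : J' ⊆ J := Finset.filter_subset _ _
  have e1 : sg r J c V p = p + ∑ j ∈ J', th r J j p • (pr (c j) (V j) p - p) := by
    unfold sg
    congr 1
    symm
    apply Finset.sum_subset hsub
    intro j hj hj'
    simp only [J', Finset.mem_filter, not_and, not_or, not_lt] at hj'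
    rw [th_eq_zero hr (hj' hj).1, zero_smul]
  have e2 : sg r J c V q = q + ∑ j ∈ J', th r J j q • (pr (c j) (V j) q - q) := by
    unfold sg
    congr 1
    symm
    apply Finset.sum_subset hsub
    intro j hj hj'
    simp only [J', Finset.mem_filter, not_and, not_or, not_lt] at hj'
    rw [th_eq_zero hr (hj' hj).2, zero_smul]
  rw [e1, e2]
  have := step_abs J' (fun j => th r J j p) (fun j => th r J j q) c V p q r A B
    (4 * 23 ^ Module.finrank ℝ H) hr hA hB (fun j _ => th_nonneg _ _ _ _)
    ((Finset.sum_le_sum_of_subset_of_nonneg hsub (fun j _ _ => th_nonneg _ _ _ _)).trans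
      (sum_th_le r J p))
    ((Finset.sum_le_sum_of_subset_of_nonneg hsub (fun j _ _ => abs_nonneg _)).trans
      (sum_th_lip hr hJ p q))
    (fun j hj => h1 j (Finset.mem_filter.1 hj).1 (Finset.mem_filter.1 hj).2)
    (fun j hj => h2 j (Finset.mem_filter.1 hj).1 (Finset.mem_filter.1 hj).2)
  exact this

end weights

/-- locally eventually Lipschitz implies Lipschitz -/
theorem lip_of_local {F G : Type*} [NormedAddCommGroup F] [NormedSpace ℝ F] [NormedAddCommGroup G]
    [NormedSpace ℝ G] {f : F → G} (hc : Continuous f) (C : ℝ) 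
    (h : ∀ u, ∀ᶠ u' in nhds u, ‖f u' - f u‖ ≤ C * ‖u' - u‖) (u u' : F) :
    ‖f u' - f u‖ ≤ C * ‖u' - u‖ := by
  let γ : ℝ → F := fun t => u + t • (u' - u)
  have hγ : Continuous γ := by fun_prop
  let S : Set ℝ := {t | ‖f (γ t) - f u‖ ≤ C * (t * ‖u' - u‖)}
  have hS : IsClosed S := isClosed_le (by fun_prop) (by fun_prop)
  have key : Icc (0 : ℝ) 1 ⊆ S := by
    apply IsClosed.Icc_subset_of_forall_exists_gt (hS.inter isClosed_Icc)
    · simp [S, γ]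
    · intro t ht y hy
      have h1 : ∀ᶠ s in nhds t, ‖f (γ s) - f (γ t)‖ ≤ C * ‖γ s - γ t‖ :=
        (hγ.tendsto t).eventually (h (γ t))
      have h2 : ∀ᶠ s in nhdsWithin t (Ioi t), s ∈ Ioc t y := Ioc_mem_nhdsGT hy
      obtain ⟨s, hs1, hs2⟩ := ((h1.filter_mono nhdsWithin_le_nhds).and h2).exists
      refine ⟨s, ?_, hs2⟩
      have h3 : ‖f (γ t) - f u‖ ≤ C * (t * ‖u' - u‖) := ht.1
      have e : γ s - γ t = (s - t) • (u' - u) := by simp only [γ, sub_smul]; abel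
      rw [e, norm_smul, Real.norm_eq_abs, abs_of_pos (sub_pos.2 hs2.1)] at hs1
      show ‖f (γ s) - f u‖ ≤ C * (s * ‖u' - u‖)
      calc _ ≤ ‖f (γ s) - f (γ t)‖ + ‖f (γ t) - f u‖ := norm_sub_le_norm_sub_add_norm_sub _ _ _
        _ ≤ _ := by linarith
  have := key (right_mem_Icc.2 zero_le_one)
  simpa [S, γ] using this

end AT

namespace AT

section geo
variable {H : Type*} [NormedAddCommGroup H] [InnerProductSpace ℝ H] [FiniteDimensional ℝ H]

theorem tri0 (a b c : H) : ‖a - c‖ ≤ ‖a - b‖ + ‖b - c‖ := norm_sub_le_norm_sub_add_norm_sub a b c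
theorem tri1 (a b c : H) : ‖a - c‖ ≤ ‖b - a‖ + ‖b - c‖ := by
  rw [norm_sub_rev b a]; exact tri0 a b c
theorem tri2 (a b c : H) : ‖a - c‖ ≤ ‖b - a‖ + ‖c - b‖ := by
  rw [norm_sub_rev c b]; exact tri1 a b c
theorem tri3 (a b c : H) : ‖a - c‖ ≤ ‖a - b‖ + ‖c - b‖ := by
  rw [norm_sub_rev c b]; exact tri0 a b c

theorem pr_diff (c c' : H) (V V' : Submodule ℝ H) (x y : H) :
    ‖pr c V y - pr c' V' y‖ ≤ ‖pr c V x - pr c' V' x‖ + ‖V.starProjection (y - x) - V'.starProjection (y - x)‖ := by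
  have e : pr c V y - pr c' V' y = (pr c V x - pr c' V' x) + (V.starProjection (y - x) - V'.starProjection (y - x)) := by
    rw [← pr_sub c, ← pr_sub c']; abel
  rw [e]; exact norm_add_le _ _

/-- the projection is nearest -/
theorem pr_min (c : H) (V : Submodule ℝ H) (y z : H) : ‖y - pr c V y‖ ≤ ‖y - pr c V z‖ := by
  have e : y - pr c V y = (y - pr c V z) - V.starProjection (y - pr c V z) := by
    rw [← pr_sub c, pr_pr]; abel
  rw [e]
  exact norm_perp_le _ _

variable (H) in
/-- constant -/
noncomputable def Lam : ℝ := 4 * 23 ^ Module.finrank ℝ H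
variable (H) in
/-- constant -/
noncomputable def Cone : ℝ := 3 + 26 * Lam H
variable (H) in
/-- constant -/
noncomputable def Kay : ℝ := (1 + Lam H) * (Cone H + 13)

variable (H) in
theorem Lam_ge : 4 ≤ Lam H := by
  unfold Lam
  have : (1 : ℝ) ≤ 23 ^ Module.finrank ℝ H := one_le_pow₀ (by norm_num)
  linarith

variable (H) in
theorem Cone_ge : 107 ≤ Cone H := by
  unfold Cone; linarith [Lam_ge H]

variable (H) in
theorem Kay_ge : 5 * (Cone H + 13) ≤ Kay H := by
  unfold Kay; nlinarith [Lam_ge H, Cone_ge H]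

variable (H) in
/-- Data for the geometric theorem. -/
structure Geo where
  r0 : ℝ
  r0_pos : 0 < r0
  E : ℕ → Set H
  c : ℕ → H → H
  V : ℕ → H → Submodule ℝ H
  b : ℕ → H → ℝ
  c0 : H
  V0 : Submodule ℝ H
  xs : H
  ε : ℝ
  ε_nonneg : 0 ≤ ε
  hε : Kay H * ε ≤ 1 / 8
  anti : ∀ k, E (k + 1) ⊆ E k
  bdd : ∀ x ∈ E 0, ‖x - xs‖ ≤ r0
  b_nonneg : ∀ k x, 0 ≤ b k x
  b_sum : ∀ k, ∀ x ∈ E k, ∑ l ∈ Finset.range (k + 1), b l x ^ 2 ≤ ε ^ 2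
  h0c : ∀ x ∈ E 0, c 0 x = c0
  h0V : ∀ x ∈ E 0, V 0 x = V0
  h1 : ∀ k, ∀ x ∈ E k, ‖x - pr (c k x) (V k x) x‖ ≤ r0 / 2 ^ k
  h2 : ∀ k, ∀ x ∈ E k, ∀ x' ∈ E k, ‖x - x'‖ ≤ 30 * (r0 / 2 ^ k) →
    (∀ v, ‖(V k x).starProjection v - (V k x').starProjection v‖ ≤ b k x * ‖v‖) ∧
    ‖pr (c k x) (V k x) x - pr (c k x') (V k x') x‖ ≤ b k x * (r0 / 2 ^ k)
  h2' : ∀ k, ∀ x ∈ E (k + 1), ∀ x' ∈ E k, ‖x - x'‖ ≤ 30 * (r0 / 2 ^ k) →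
    (∀ v, ‖(V k x).starProjection v - (V k x').starProjection v‖ ≤ b (k + 1) x * ‖v‖) ∧
    ‖pr (c k x) (V k x) x - pr (c k x') (V k x') x‖ ≤ b (k + 1) x * (r0 / 2 ^ k)
  h3 : ∀ k, ∀ x ∈ E (k + 1),
    (∀ v, ‖(V k x).starProjection v - (V (k + 1) x).starProjection v‖ ≤ b (k + 1) x * ‖v‖) ∧
    ‖pr (c k x) (V k x) x - pr (c (k + 1) x) (V (k + 1) x) x‖ ≤ b (k + 1) x * (r0 / 2 ^ k)

namespace Geo
variable (G : Geo H)

/-- scale -/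
noncomputable def r (k : ℕ) : ℝ := G.r0 / 2 ^ k
/-- plane projection -/
noncomputable def P (k : ℕ) (x y : H) : H := pr (G.c k x) (G.V k x) y
/-- linear projection -/
noncomputable def Q (k : ℕ) (x v : H) : H := (G.V k x).starProjection v

theorem r_pos (k : ℕ) : 0 < G.r k := div_pos G.r0_pos (by positivity)
theorem r_succ (k : ℕ) : G.r k = 2 * G.r (k + 1) := by
  unfold r; rw [pow_succ]; field_simp

theorem E_mono (k : ℕ) : G.E k ⊆ G.E 0 := by
  induction k with
  | zero => exact subset_rfl
  | succ k ih => exact (G.anti k).trans ih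

theorem exists_J (k : ℕ) : ∃ J : Finset H, (J : Set H) ⊆ G.E k ∧ Sep (G.r k) J ∧
    ∀ y ∈ G.E k, ∃ j ∈ J, ‖y - j‖ < G.r k :=
  exists_net (fun y => y) (G.E k) G.xs G.r0 (G.r k) (G.r_pos k) (fun y hy => G.bdd y (G.E_mono k hy))

/-- nets -/
noncomputable def J (k : ℕ) : Finset H := (G.exists_J k).choose
theorem J_sub (k : ℕ) {j : H} (hj : j ∈ G.J k) : j ∈ G.E k := (G.exists_J k).choose_spec.1 hj
theorem J_sep (k : ℕ) : Sep (G.r k) (G.J k) := (G.exists_J k).choose_spec.2.1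
theorem J_net (k : ℕ) {y : H} (hy : y ∈ G.E k) : ∃ j ∈ G.J k, ‖y - j‖ < G.r k :=
  (G.exists_J k).choose_spec.2.2 y hy

/-- the approximating maps -/
noncomputable def f : ℕ → G.V0 → H
  | 0 => fun u => G.c0 + (u : H)
  | k + 1 => fun u => sg (G.r k) (G.J k) (G.c k) (G.V k) (f k u)

theorem f_cont (k : ℕ) : Continuous (G.f k) := by
  induction k with
  | zero => unfold f; fun_prop
  | succ k ih => unfold f; exact (sg_cont _ _ _).comp ih

theorem b_le {k : ℕ} {x : H} (hx : x ∈ G.E k) : Kay H * G.b k x ≤ 1 / 8 := by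
  have h1 : G.b k x ^ 2 ≤ G.ε ^ 2 :=
    (Finset.single_le_sum (f := fun l => G.b l x ^ 2) (fun i _ => sq_nonneg _)
      (Finset.self_mem_range_succ k)).trans (G.b_sum k x hx)
  have h2 : G.b k x ≤ G.ε := (sq_le_sq₀ (G.b_nonneg _ _) G.ε_nonneg).1 h1
  have := Kay_ge H
  have := Cone_ge H
  exact (mul_le_mul_of_nonneg_left h2 (by linarith)).trans G.hε

theorem b_le' {k : ℕ} {x : H} (hx : x ∈ G.E k) : (Cone H + 13) * G.b k x ≤ 1 / 40 := by
  have := G.b_le hx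
  have := mul_le_mul_of_nonneg_right (Kay_ge H) (G.b_nonneg k x)
  linarith

/-- induction hypothesis -/
def IH (k : ℕ) : Prop := ∀ x ∈ G.E k, ∀ u u', ‖G.f k u - x‖ ≤ 12 * G.r k → ‖G.f k u' - x‖ ≤ 12 * G.r k →
  ‖G.f k u - G.P k x (G.f k u)‖ ≤ Cone H * G.b k x * G.r k ∧
  ‖(G.f k u - G.f k u') - G.Q k x (G.f k u - G.f k u')‖ ≤ Cone H * G.b k x * ‖G.f k u - G.f k u'‖

theorem IH_zero : G.IH 0 := by
  intro x hx u u' _ _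
  have hC := Cone_ge H
  have hb := G.b_nonneg 0 x
  have e1 : G.P 0 x (G.f 0 u) = G.f 0 u := by
    unfold P pr f
    rw [G.h0c x hx, G.h0V x hx, add_sub_cancel_left,
      Submodule.starProjection_eq_self_iff.2 u.2]
  have e2 : G.Q 0 x (G.f 0 u - G.f 0 u') = G.f 0 u - G.f 0 u' := by
    unfold Q f
    refine Submodule.starProjection_eq_self_iff.2 ?_
    rw [G.h0V x hx, add_sub_add_left_eq_sub]
    exact G.V0.sub_mem u.2 u'.2
  rw [e1, e2, sub_self, sub_self, norm_zero]
  have := G.r_pos 0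
  constructor <;> positivity

section
variable {G} {k : ℕ}

theorem near_pr (ih : G.IH k) {x x' : H} (hx : x ∈ G.E k) (hx' : x' ∈ G.E k) (h : ‖x - x'‖ ≤ 30 * G.r k) {u : G.V0}
    (hu : ‖G.f k u - x‖ ≤ 12 * G.r k) :
    ‖pr (G.c k x') (G.V k x') (G.f k u) - G.f k u‖ ≤ (Cone H + 13) * G.b k x * G.r k := by
  obtain ⟨h1, h2⟩ := G.h2 k x hx x' hx' h
  have h3 := pr_diff (G.c k x) (G.c k x') (G.V k x) (G.V k x') x (G.f k u)
  have h4 := h1 (G.f k u - x)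
  have h5 := (ih x hx u u hu hu).1
  have hb := G.b_nonneg k x
  have h6 : G.b k x * ‖G.f k u - x‖ ≤ G.b k x * (12 * G.r k) := by gcongr
  have h2' : ‖pr (G.c k x) (G.V k x) x - pr (G.c k x') (G.V k x') x‖ ≤ G.b k x * G.r k := h2
  have h7 := tri2 (pr (G.c k x') (G.V k x') (G.f k u)) (G.P k x (G.f k u)) (G.f k u)
  unfold P at *
  nlinarith

theorem near_Q (ih : G.IH k) {x x' : H} (hx : x ∈ G.E k) (hx' : x' ∈ G.E k) (h : ‖x - x'‖ ≤ 30 * G.r k) {u u' : G.V0}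
    (hu : ‖G.f k u - x‖ ≤ 12 * G.r k) (hu' : ‖G.f k u' - x‖ ≤ 12 * G.r k) :
    ‖(G.f k u - G.f k u') - (G.V k x').starProjection (G.f k u - G.f k u')‖
      ≤ (Cone H + 13) * G.b k x * ‖G.f k u - G.f k u'‖ := by
  obtain ⟨h1, h2⟩ := G.h2 k x hx x' hx' h
  have h4 := h1 (G.f k u - G.f k u')
  have h5 := (ih x hx u u' hu hu').2
  set v := G.f k u - G.f k u'
  have hb := mul_nonneg (G.b_nonneg k x) (norm_nonneg v)
  have h7 := norm_sub_le_norm_sub_add_norm_sub v (G.Q k x v) ((G.V k x').starProjection v)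
  unfold Q at *
  nlinarith

theorem rel_dist (ih : G.IH k) {x j : H} {u : G.V0} (hu : ‖G.f k u - x‖ ≤ 12 * G.r k) (h : ‖G.f k u - j‖ < 11 * G.r k) :
    ‖x - j‖ ≤ 30 * G.r k := by
  have h7 := tri1 x (G.f k u) j
  have := G.r_pos k
  linarith

theorem step (ih : G.IH k) {x : H} (hx : x ∈ G.E k) {u u' : G.V0}
    (hu : ‖G.f k u - x‖ ≤ 12 * G.r k) (hu' : ‖G.f k u' - x‖ ≤ 12 * G.r k) :
    ‖(G.f (k+1) u - G.f (k+1) u') - (G.f k u - G.f k u')‖ ≤ Kay H * G.b k x * ‖G.f k u - G.f k u'‖ ∧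
    ‖G.f (k+1) u - G.f (k+1) u'‖ ^ 2 ≤ (1 + 3 * Kay H ^ 2 * G.b k x ^ 2) * ‖G.f k u - G.f k u'‖ ^ 2 := by
  have hr := G.r_pos k
  have hb := G.b_nonneg k x
  have hC := Cone_ge H
  have hL := Lam_ge H
  have rel : ∀ j, (‖G.f k u - j‖ < 11 * G.r k ∨ ‖G.f k u' - j‖ < 11 * G.r k) → ‖x - j‖ ≤ 30 * G.r k := by
    rintro j (h | h)
    · exact rel_dist ih hu h
    · exact rel_dist ih hu' h
  have := sg_step hr (G.J_sep k) (c := G.c k) (V := G.V k) (p := G.f k u) (q := G.f k u')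
    (A := (Cone H + 13) * G.b k x) (B := (Cone H + 13) * G.b k x) (by positivity) (by positivity)
    (fun j hj h => near_Q ih hx (G.J_sub k hj) (rel j h) hu hu')
    (fun j hj h => near_pr ih hx (G.J_sub k hj) (rel j h) hu')
  rw [show 4 * 23 ^ Module.finrank ℝ H = Lam H from rfl] at this
  have e : (Cone H + 13) * G.b k x + Lam H * ((Cone H + 13) * G.b k x) = Kay H * G.b k x := by
    unfold Kay; ring
  rw [e] at this
  refine ⟨this.1, this.2.trans ?_⟩
  gcongr ?_ * _
  have h1 : (0:ℝ) ≤ ((Cone H + 13) * G.b k x) ^ 2 := sq_nonneg _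
  have h2 : (Kay H * G.b k x) ^ 2 = (1 + Lam H) ^ 2 * ((Cone H + 13) * G.b k x) ^ 2 := by
    unfold Kay; ring
  have h3 : Lam H ≤ (1 + Lam H) ^ 2 := by nlinarith
  have h4 := mul_le_mul_of_nonneg_right h3 h1
  nlinarith

theorem disp (ih : G.IH k) (u : G.V0) : ‖G.f (k+1) u - G.f k u‖ ≤ G.r k / 8 := by
  have hr := G.r_pos k
  show ‖sg (G.r k) (G.J k) (G.c k) (G.V k) (G.f k u) - G.f k u‖ ≤ _
  by_cases h : ∀ j ∈ G.J k, 11 * G.r k ≤ ‖G.f k u - j‖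
  · rw [sg_eq_self hr h, sub_self, norm_zero]; positivity
  · push Not at h
    obtain ⟨x, hxJ, hx⟩ := h
    have hxE := G.J_sub k hxJ
    have hux : ‖G.f k u - x‖ ≤ 12 * G.r k := by linarith
    apply sg_disp (by positivity)
    intro j hj hth
    have := near_pr ih hxE (G.J_sub k hj) (rel_dist ih hux (th_ne_zero hr hth)) hux
    refine this.trans ?_
    have := mul_le_mul_of_nonneg_right (G.b_le' hxE) hr.le
    linarith

theorem IH_succ (ih : G.IH k) : G.IH (k + 1) := by
  intro x hx u u' hu hu'
  have hxk := G.anti k hx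
  have hr := G.r_pos k
  have hr2 := G.r_succ k
  have hb := G.b_nonneg (k + 1) x
  have hC := Cone_ge H
  have hL := Lam_ge H
  have hd := disp ih u
  have hd' := disp ih u'
  have hu7 : ‖G.f k u - x‖ ≤ 7 * G.r k := by
    have := tri1 (G.f k u) (G.f (k+1) u) x
    linarith
  have hu7' : ‖G.f k u' - x‖ ≤ 7 * G.r k := by
    have := tri1 (G.f k u') (G.f (k+1) u') x
    linarith
  obtain ⟨j0, hj0, hj0x⟩ := G.J_net k hxk
  set b' := G.b (k+1) x with hb'
  have full : ∀ y, ‖y - x‖ ≤ 7 * G.r k → ∑ j ∈ G.J k, th (G.r k) (G.J k) j y = 1 := by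
    intro y hy
    apply sum_th_eq hr hj0
    have := norm_sub_le_norm_sub_add_norm_sub y x j0
    linarith
  have sgfull : ∀ y, ‖y - x‖ ≤ 7 * G.r k → sg (G.r k) (G.J k) (G.c k) (G.V k) y =
      ∑ j ∈ G.J k, th (G.r k) (G.J k) j y • pr (G.c k j) (G.V k j) y := by
    intro y hy
    unfold sg
    simp only [smul_sub, Finset.sum_sub_distrib]
    rw [← Finset.sum_smul, full y hy, one_smul]; abel
  have rel : ∀ j ∈ G.J k, ∀ y, ‖y - x‖ ≤ 7 * G.r k → ‖y - j‖ < 11 * G.r k → ‖x - j‖ ≤ 30 * G.r k := by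
    intro j _ y hy h
    have h7 := tri1 x y j
    linarith
  have npr : ∀ j ∈ G.J k, ‖x - j‖ ≤ 30 * G.r k → ∀ y, ‖y - x‖ ≤ 7 * G.r k →
      ‖pr (G.c k j) (G.V k j) y - G.P k x y‖ ≤ 13 * b' * G.r k := by
    intro j hj hxj y hy
    obtain ⟨h1, h2⟩ := G.h2' k x hx j (G.J_sub k hj) hxj
    have h3 := pr_diff (G.c k x) (G.c k j) (G.V k x) (G.V k j) x y
    have h4 := h1 (y - x)
    have h6 : b' * ‖y - x‖ ≤ b' * (7 * G.r k) := by gcongr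
    have h2' : ‖pr (G.c k x) (G.V k x) x - pr (G.c k j) (G.V k j) x‖ ≤ b' * G.r k := h2
    rw [norm_sub_rev]
    unfold P
    have := mul_nonneg hb hr.le
    linarith
  set p := G.f k u with hp
  set q := G.f k u' with hq
  have efp : G.f (k+1) u = sg (G.r k) (G.J k) (G.c k) (G.V k) p := rfl
  have efq : G.f (k+1) u' = sg (G.r k) (G.J k) (G.c k) (G.V k) q := rfl
  obtain ⟨h3a, h3b⟩ := G.h3 k x hx
  constructor
  · -- distance to plane
    have d1 : ‖G.f (k+1) u - G.P k x p‖ ≤ 13 * b' * G.r k := by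
      rw [efp, sgfull p hu7]
      have : G.P k x p = ∑ j ∈ G.J k, th (G.r k) (G.J k) j p • G.P k x p := by
        rw [← Finset.sum_smul, full p hu7, one_smul]
      rw [this, ← Finset.sum_sub_distrib]
      calc _ ≤ ∑ j ∈ G.J k, th (G.r k) (G.J k) j p * (13 * b' * G.r k) := by
            apply norm_sum_le_of_le
            intro j hj
            rw [← smul_sub, norm_smul, Real.norm_eq_abs, abs_of_nonneg (th_nonneg _ _ _ _)]
            by_cases h0 : th (G.r k) (G.J k) j p = 0
            · rw [h0]; simp
            · exact mul_le_mul_of_nonneg_left 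
                (npr j hj (rel j hj p hu7 (th_ne_zero hr h0)) p hu7) (th_nonneg _ _ _ _)
        _ = _ := by rw [← Finset.sum_mul, full p hu7, one_mul]
    have d2 : ‖G.f (k+1) u - G.P k x (G.f (k+1) u)‖ ≤ 13 * b' * G.r k :=
      (pr_min _ _ _ p).trans d1
    have d3 := pr_diff (G.c k x) (G.c (k+1) x) (G.V k x) (G.V (k+1) x) x (G.f (k+1) u)
    have d4 := h3a (G.f (k+1) u - x)
    have d5 : b' * ‖G.f (k+1) u - x‖ ≤ b' * (6 * G.r k) := by
      apply mul_le_mul_of_nonneg_left _ hb; linarith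
    have h3b' : ‖pr (G.c k x) (G.V k x) x - pr (G.c (k + 1) x) (G.V (k + 1) x) x‖ ≤ b' * G.r k := h3b
    have d6 := norm_sub_le_norm_sub_add_norm_sub (G.f (k+1) u) (G.P k x (G.f (k+1) u)) (G.P (k+1) x (G.f (k+1) u))
    have d7 : ‖G.f (k+1) u - G.P (k+1) x (G.f (k+1) u)‖ ≤ 20 * b' * G.r k := by
      unfold P at *
      linarith
    refine d7.trans ?_
    rw [hr2]
    have := mul_nonneg hb (G.r_pos (k+1)).le
    nlinarith
  · set v := p - q with hv
    set v' := G.f (k+1) u - G.f (k+1) u' with hv'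
    have hst := (step ih hxk (u := u) (u' := u') (by linarith) (by linarith)).1
    have hvv : ‖v‖ ≤ 2 * ‖v'‖ := by
      have h1 : ‖v' - v‖ ≤ 1 / 8 * ‖v‖ :=
        hst.trans (mul_le_mul_of_nonneg_right (G.b_le hxk) (norm_nonneg _))
      have h2 := norm_sub_norm_le v v'
      rw [norm_sub_rev v v'] at h2
      linarith [norm_nonneg v]
    set R : H → H := fun w => w - G.Q k x w with hR
    have Radd : ∀ w z, R (w + z) = R w + R z := by
      intro w z; simp only [hR, Q, map_add]; abel
    have dec : v' = ∑ j ∈ G.J k, th (G.r k) (G.J k) j p • (G.V k j).starProjection v 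
        + ∑ j ∈ G.J k, (th (G.r k) (G.J k) j p - th (G.r k) (G.J k) j q) • 
          (pr (G.c k j) (G.V k j) q - G.P k x q) := by
      have z : ∑ j ∈ G.J k, (th (G.r k) (G.J k) j p - th (G.r k) (G.J k) j q) • G.P k x q = 0 := by
        rw [← Finset.sum_smul, Finset.sum_sub_distrib, full p hu7, full q hu7', sub_self, zero_smul]
      have z2 : ∀ j, (G.V k j).starProjection v = pr (G.c k j) (G.V k j) p - pr (G.c k j) (G.V k j) q :=
        fun j => (pr_sub _ _ _ _).symm
      rw [hv', efp, efq, sgfull p hu7, sgfull q hu7']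
      simp only [smul_sub, Finset.sum_sub_distrib, z2] at z ⊢
      rw [z]
      simp only [sub_smul, Finset.sum_sub_distrib]
      abel
    have RN : ∀ w, ‖R w‖ ≤ ‖w‖ := fun w => norm_perp_le _ _
    have Rs : R (∑ j ∈ G.J k, th (G.r k) (G.J k) j p • (G.V k j).starProjection v)
        = ∑ j ∈ G.J k, th (G.r k) (G.J k) j p • R ((G.V k j).starProjection v) := by
      simp only [hR, Q, map_sum, map_smul, smul_sub, Finset.sum_sub_distrib]
    have t1 : ‖R (∑ j ∈ G.J k, th (G.r k) (G.J k) j p • (G.V k j).starProjection v)‖ ≤ b' * ‖v‖ := by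
      rw [Rs]
      calc _ ≤ ∑ j ∈ G.J k, th (G.r k) (G.J k) j p * (b' * ‖v‖) := by
            apply norm_sum_le_of_le
            intro j hj
            rw [norm_smul, Real.norm_eq_abs, abs_of_nonneg (th_nonneg _ _ _ _)]
            by_cases h0 : th (G.r k) (G.J k) j p = 0
            · rw [h0]; simp
            · apply mul_le_mul_of_nonneg_left _ (th_nonneg _ _ _ _)
              obtain ⟨h1, h2⟩ := G.h2' k x hx j (G.J_sub k hj) (rel j hj p hu7 (th_ne_zero hr h0))
              have := h1 ((G.V k j).starProjection v)
              rw [proj_proj, norm_sub_rev] at this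
              refine this.trans ?_
              exact mul_le_mul_of_nonneg_left (norm_proj_le _ _) hb
        _ = _ := by rw [← Finset.sum_mul, full p hu7, one_mul]
    have t2 : ‖∑ j ∈ G.J k, (th (G.r k) (G.J k) j p - th (G.r k) (G.J k) j q) • 
          (pr (G.c k j) (G.V k j) q - G.P k x q)‖ ≤ 13 * Lam H * b' * ‖v‖ := by
      calc _ ≤ ∑ j ∈ G.J k, |th (G.r k) (G.J k) j p - th (G.r k) (G.J k) j q| * (13 * b' * G.r k) := by
            apply norm_sum_le_of_le
            intro j hj
            rw [norm_smul, Real.norm_eq_abs]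
            by_cases h0 : th (G.r k) (G.J k) j p = 0
            · by_cases h1 : th (G.r k) (G.J k) j q = 0
              · rw [h0, h1]; simp
              · exact mul_le_mul_of_nonneg_left 
                  (npr j hj (rel j hj q hu7' (th_ne_zero hr h1)) q hu7') (abs_nonneg _)
            · exact mul_le_mul_of_nonneg_left 
                (npr j hj (rel j hj p hu7 (th_ne_zero hr h0)) q hu7') (abs_nonneg _)
        _ ≤ Lam H * (‖v‖ / G.r k) * (13 * b' * G.r k) := by
            rw [← Finset.sum_mul]
            exact mul_le_mul_of_nonneg_right (sum_th_lip hr (G.J_sep k) p q) (by positivity)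
        _ = _ := by field_simp
    have t3 : ‖R v'‖ ≤ (1 + 13 * Lam H) * b' * ‖v‖ := by
      rw [dec, Radd]
      refine (norm_add_le _ _).trans ?_
      have := (RN _).trans t2
      linarith
    have t4 := h3a v'
    have t5 := norm_sub_le_norm_sub_add_norm_sub v' (G.Q k x v') (G.Q (k+1) x v')
    have t6 : (1 + 13 * Lam H) * b' * ‖v‖ ≤ (1 + 13 * Lam H) * b' * (2 * ‖v'‖) := by gcongr
    have t7 : Cone H * b' * ‖v'‖ = (1 + 13 * Lam H) * b' * (2 * ‖v'‖) + b' * ‖v'‖ := by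
      unfold Cone; ring
    rw [t7]
    simp only [hR] at t3
    unfold Q at *
    linarith

end

theorem IH_all (k : ℕ) : G.IH k := by
  induction k with
  | zero => exact G.IH_zero
  | succ k ih => exact IH_succ ih

end Geo
end geo
end AT

namespace AT

section geo2
variable {H : Type*} [NormedAddCommGroup H] [InnerProductSpace ℝ H] [FiniteDimensional ℝ H]
namespace Geo
variable (G : Geo H)

/-- covering property -/
def Cov (k : ℕ) : Prop := ∀ x ∈ G.E k, ∀ z, G.P k x z = z → ‖z - x‖ ≤ 10 * G.r k →
  ∃ u, G.P k x (G.f k u) = z ∧ ‖G.f k u - z‖ ≤ 2 * G.r k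

theorem Cov_zero : G.Cov 0 := by
  intro x hx z hz _
  have h1 : z - G.c0 ∈ G.V0 := by
    unfold P pr at hz
    rw [G.h0c x hx] at hz
    have h2 : z - G.c0 = (G.V 0 x).starProjection (z - G.c0) := by
      conv_lhs => rw [← hz]
      abel
    rw [h2, ← G.h0V x hx]
    exact Submodule.starProjection_apply_mem _ _
  refine ⟨⟨z - G.c0, h1⟩, ?_⟩
  have : G.f 0 ⟨z - G.c0, h1⟩ = z := by unfold f; simp
  rw [this]
  exact ⟨hz, by simp [(G.r_pos 0).le]⟩

theorem fixed_point {z : H} {r : ℝ} (hr : 0 ≤ r) (g : H → H) (hg : ∀ y ∈ closedBall z r, g y ∈ closedBall z r)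
    (hl : ∀ y ∈ closedBall z r, ∀ y' ∈ closedBall z r, ‖g y - g y'‖ ≤ 1 / 2 * ‖y - y'‖) :
    ∃ y ∈ closedBall z r, g y = y := by
  have hs : IsComplete (closedBall z r) := isClosed_closedBall.isComplete
  have hm : MapsTo g (closedBall z r) (closedBall z r) := hg
  have hc : ContractingWith (1 / 2) (hm.restrict g _ _) := by
    refine ⟨by norm_num, ?_⟩
    apply LipschitzWith.of_dist_le_mul
    intro y y'
    rw [Subtype.dist_eq, Subtype.dist_eq, dist_eq_norm, dist_eq_norm]
    simpa using hl y y.2 y' y'.2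
  obtain ⟨y, hy, hf, _⟩ := ContractingWith.exists_fixedPoint' hs hm hc (mem_closedBall_self hr)
    (edist_ne_top _ _)
  exact ⟨y, hy, hf⟩

theorem Cov_succ {k : ℕ} (cov : G.Cov k) : G.Cov (k + 1) := by
  classical
  have ih := G.IH_all k
  intro x hx z hz hzx
  have hxk := G.anti k hx
  have hr := G.r_pos k
  have hr2 := G.r_succ k
  have hC := Cone_ge H
  have hL := Kay_ge H
  have hb' := G.b_nonneg (k + 1) x
  have hb := G.b_nonneg k x
  have hbl := G.b_le hxk
  have hbl2 := G.b_le' hxk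
  have hbl3 := G.b_le' hx
  obtain ⟨h3a, h3b⟩ := G.h3 k x hx
  have hzx5 : ‖z - x‖ ≤ 5 * G.r k := by linarith
  have hPx : ‖x - G.P k x x‖ ≤ G.r k := G.h1 k x hxk
  have hch : ∀ w : H, ∃ u : G.V0, (G.P k x w = w → ‖w - x‖ ≤ 10 * G.r k → G.P k x (G.f k u) = w ∧ ‖G.f k u - w‖ ≤ 2 * G.r k) := by
    intro w
    by_cases h : G.P k x w = w ∧ ‖w - x‖ ≤ 10 * G.r k
    · obtain ⟨u, hu⟩ := cov x hxk w h.1 h.2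
      exact ⟨u, fun _ _ => hu⟩
    · exact ⟨0, fun h1 h2 => absurd ⟨h1, h2⟩ h⟩
  choose h0 hh0 using hch
  set h : H → G.V0 := fun y => h0 (G.P k x y) with hh
  have hQ : ∀ y y', G.P k x y - G.P k x y' = G.Q k x (y - y') := fun y y' => pr_sub _ _ _ _
  have hyx : ∀ y ∈ closedBall z (G.r k), ‖y - x‖ ≤ 6 * G.r k := by
    intro y hy
    rw [mem_closedBall, dist_eq_norm] at hy
    have := tri0 y z x
    linarith
  have hPy : ∀ y ∈ closedBall z (G.r k), ‖G.P k x y - x‖ ≤ 7 * G.r k := by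
    intro y hy
    have h1 := tri3 (G.P k x y) (G.P k x x) x
    rw [hQ] at h1
    have h2 : ‖G.Q k x (y - x)‖ ≤ ‖y - x‖ := norm_proj_le _ _
    have := hyx y hy
    linarith
  have hPh : ∀ y ∈ closedBall z (G.r k), G.P k x (G.f k (h y)) = G.P k x y ∧ ‖G.f k (h y) - x‖ ≤ 12 * G.r k := by
    intro y hy
    have h1 := hPy y hy
    obtain ⟨h2, h3⟩ := hh0 (G.P k x y) (pr_pr _ _ _) (by linarith)
    refine ⟨h2, ?_⟩
    have := tri0 (G.f k (h y)) (G.P k x y) x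
    linarith
  have hfh : ∀ y ∈ closedBall z (G.r k), ‖G.f k (h y) - G.P k x y‖ ≤ G.r k / 8 := by
    intro y hy
    obtain ⟨h1, h2⟩ := hPh y hy
    have h3 := (ih x hxk (h y) (h y) h2 h2).1
    rw [h1] at h3
    refine h3.trans ?_
    have : Cone H * G.b k x ≤ 1 / 8 := by nlinarith
    have := mul_le_mul_of_nonneg_right this hr.le
    linarith
  have hdisp : ∀ y, ‖G.f (k+1) (h y) - G.f k (h y)‖ ≤ G.r k / 8 := fun y => disp ih _
  have hperp : ∀ w, G.Q k x w = 0 → ‖G.Q (k+1) x w‖ ≤ 1 / 40 * (‖w‖ / 120) := by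
    intro w hw
    have h1 := h3a w
    rw [show (G.V k x).starProjection w = 0 from hw, zero_sub, norm_neg] at h1
    refine h1.trans ?_
    have : 120 * G.b (k+1) x ≤ 1 / 40 := by nlinarith
    have := mul_le_mul_of_nonneg_right this (norm_nonneg w)
    linarith
  have hQN : ∀ w, ‖G.Q (k+1) x w‖ ≤ ‖w‖ := fun w => norm_proj_le _ _
  have hQk : ∀ w, G.Q k x (G.Q k x w - w) = 0 := by
    intro w
    unfold Q
    rw [map_sub, proj_proj, sub_self]
  set g : H → H := fun y => z - G.Q (k+1) x (G.f (k+1) (h y) - y) with hg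
  have Qadd : ∀ w w', G.Q (k+1) x (w + w') = G.Q (k+1) x w + G.Q (k+1) x w' := fun w w' => map_add _ _ _
  have hgball : ∀ y ∈ closedBall z (G.r k), g y ∈ closedBall z (G.r k) := by
    intro y hy
    rw [mem_closedBall, dist_eq_norm]
    have e : g y - z = -(G.Q (k+1) x (G.f (k+1) (h y) - y)) := by simp only [hg]; abel
    rw [e, norm_neg]
    have e2 : G.f (k+1) (h y) - y = (G.f (k+1) (h y) - G.P k x y) + (G.P k x y - y) := by abel
    rw [e2, Qadd]
    have h1 : ‖G.f (k+1) (h y) - G.P k x y‖ ≤ G.r k / 8 + G.r k / 8 :=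
      (tri0 _ (G.f k (h y)) _).trans (add_le_add (hdisp y) (hfh y hy))
    have h2 : G.Q k x (G.P k x y - y) = 0 := by
      rw [← hQ]
      unfold P; rw [pr_pr, sub_self]
    have h3 := hperp _ h2
    have h4 := tri3 (G.P k x y) x y
    have := hPy y hy
    have := hyx y hy
    refine (norm_add_le _ _).trans ?_
    have := (hQN _).trans h1
    linarith
  have hglip : ∀ y ∈ closedBall z (G.r k), ∀ y' ∈ closedBall z (G.r k), ‖g y - g y'‖ ≤ 1 / 2 * ‖y - y'‖ := by
    intro y hy y' hy'
    obtain ⟨a1, a2⟩ := hPh y hy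
    obtain ⟨b1, b2⟩ := hPh y' hy'
    set v := G.f k (h y) - G.f k (h y') with hv
    set v' := G.f (k+1) (h y) - G.f (k+1) (h y') with hv'
    set w := G.Q k x (y - y') with hw
    have hQv : G.Q k x v = w := by
      rw [hv, ← hQ, a1, b1, hQ]
    have c1 := (ih x hxk (h y) (h y') a2 b2).2
    rw [← hv, hQv] at c1
    have c2 := (step ih hxk a2 b2).1
    rw [← hv, ← hv'] at c2
    have hwn : ‖w‖ ≤ ‖y - y'‖ := norm_proj_le _ _
    have c3 : ‖v - w‖ ≤ 1 / 8 * ‖v‖ := by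
      refine c1.trans (mul_le_mul_of_nonneg_right ?_ (norm_nonneg _))
      nlinarith
    have c4 : ‖v' - v‖ ≤ 1 / 8 * ‖v‖ := c2.trans (mul_le_mul_of_nonneg_right hbl (norm_nonneg _))
    have c5 : ‖v‖ - ‖w‖ ≤ ‖v - w‖ := norm_sub_norm_le v w
    have c6 := tri0 v' v w
    have e : g y - g y' = -(G.Q (k+1) x (v' - w) + G.Q (k+1) x (w - (y - y'))) := by
      rw [← Qadd]
      simp only [hg]
      have : v' - w + (w - (y - y')) = (G.f (k+1) (h y) - y) - (G.f (k+1) (h y') - y') := by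
        rw [hv']; abel
      rw [this]
      unfold Q
      rw [map_sub _ (G.f (k+1) (h y) - y)]; abel
    rw [e, norm_neg]
    have c7 := hperp _ (hQk (y - y'))
    rw [← hw] at c7
    have c8 : ‖w - (y - y')‖ ≤ ‖w‖ + ‖y - y'‖ := norm_sub_le _ _
    have c9 := hQN (v' - w)
    refine (norm_add_le _ _).trans ?_
    linarith [norm_nonneg v, norm_nonneg w, norm_nonneg (y - y')]
  obtain ⟨y, hy, hfix⟩ := fixed_point hr.le g hgball hglip
  refine ⟨h y, ?_⟩
  have hPz : ∀ w, G.P (k+1) x (z - G.Q (k+1) x w) = z - G.Q (k+1) x w := by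
    intro w
    have : G.P (k+1) x (z - G.Q (k+1) x w) - G.P (k+1) x z = - G.Q (k+1) x w := by
      unfold P Q; rw [pr_sub, sub_sub_cancel_left, map_neg, proj_proj]
    rw [hz] at this
    rw [eq_add_of_sub_eq this]; abel
  have hPyy : G.P (k+1) x y = y := by
    rw [← hfix]; exact hPz _
  have hfin : G.P (k+1) x (G.f (k+1) (h y)) = z := by
    have h1 : G.P (k+1) x (G.f (k+1) (h y)) - G.P (k+1) x y = G.Q (k+1) x (G.f (k+1) (h y) - y) := pr_sub _ _ _ _
    have h2 : z - G.Q (k+1) x (G.f (k+1) (h y) - y) = y := hfix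
    rw [hPyy] at h1
    rw [eq_add_of_sub_eq h1]
    exact (sub_eq_iff_eq_add'.1 h2).symm
  refine ⟨hfin, ?_⟩
  have k1 := hfh y hy
  have k2 := hdisp y
  have k3 := tri0 (G.f (k+1) (h y)) (G.f k (h y)) (G.P k x y)
  have k4 := tri3 (G.f (k+1) (h y)) x (G.P k x y)
  have k5 : ‖G.f (k+1) (h y) - x‖ ≤ 12 * G.r (k+1) := by
    have e1 := tri0 (G.f (k+1) (h y)) (G.P k x y) x
    have e2 : ‖G.f (k+1) (h y) - z‖ ≤ G.r k := by
      have e3 : G.Q k x (G.P k x y - y) = 0 := by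
        rw [← hQ]
        unfold P; rw [pr_pr, sub_self]
      have e4 : ‖G.P k x y - G.P (k+1) x y‖ ≤ 7 * G.b (k+1) x * G.r k := by
        have d3 := pr_diff (G.c k x) (G.c (k+1) x) (G.V k x) (G.V (k+1) x) x y
        have d4 := h3a (y - x)
        have d5 : G.b (k+1) x * ‖y - x‖ ≤ G.b (k+1) x * (6 * G.r k) :=
          mul_le_mul_of_nonneg_left (hyx y hy) hb'
        have h3b' : ‖pr (G.c k x) (G.V k x) x - pr (G.c (k + 1) x) (G.V (k + 1) x) x‖ ≤ G.b (k+1) x * G.r k := h3b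
        unfold P
        linarith
      rw [hPyy] at e4
      have e5 : G.b (k+1) x * G.r k ≤ 1 / 100 * G.r k := by
        apply mul_le_mul_of_nonneg_right _ hr.le
        nlinarith
      have e6 : ‖G.f (k+1) (h y) - y‖ ≤ G.r k / 2 := by
        have := tri0 (G.f (k+1) (h y)) (G.P k x y) y
        linarith
      have e7 : ‖y - z‖ ≤ G.r k / 2 := by
        have : z - y = G.Q (k+1) x (G.f (k+1) (h y) - y) := by
          have h2 : z - G.Q (k+1) x (G.f (k+1) (h y) - y) = y := hfix
          exact sub_eq_iff_eq_add.2 (sub_eq_iff_eq_add'.1 h2)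
        rw [norm_sub_rev, this]
        exact (hQN _).trans e6
      have := tri0 (G.f (k+1) (h y)) y z
      linarith
    have := tri0 (G.f (k+1) (h y)) z x
    linarith
  have k6 := (G.IH_all (k+1) x hx (h y) (h y) k5 k5).1
  rw [hfin] at k6
  refine k6.trans ?_
  apply mul_le_mul_of_nonneg_right _ (G.r_pos (k+1)).le
  nlinarith

theorem Cov_all (k : ℕ) : G.Cov k := by
  induction k with
  | zero => exact G.Cov_zero
  | succ k ih => exact G.Cov_succ ih

theorem L1 (k : ℕ) : ∀ x ∈ G.E k, ∀ u, ‖G.f k u - x‖ ≤ 12 * G.r k → ∀ᶠ u' in nhds u,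
    ‖G.f k u' - G.f k u‖ ^ 2 ≤ Real.exp (3 * Kay H ^ 2 * ∑ l ∈ Finset.range k, G.b l x ^ 2) * ‖u' - u‖ ^ 2 := by
  induction k with
  | zero =>
    intro x _ u _
    refine Eventually.of_forall (fun u' => ?_)
    unfold f
    simp
  | succ k ihk =>
    intro x hx u hu
    have hxk := G.anti k hx
    have hr := G.r_pos k
    have hr2 := G.r_succ k
    have hd := disp (G.IH_all k) u
    have hu7 : ‖G.f k u - x‖ ≤ 7 * G.r k := by
      have := tri1 (G.f k u) (G.f (k+1) u) x
      linarith
    have h1 := ihk x hxk u (by linarith)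
    have h2 : ∀ᶠ u' in nhds u, ‖G.f k u' - x‖ < 12 * G.r k := by
      have : Continuous (fun u' => ‖G.f k u' - x‖) := ((G.f_cont k).sub continuous_const).norm
      exact this.continuousAt.eventually_lt continuousAt_const (by linarith)
    filter_upwards [h1, h2] with u' h1 h2
    have h3 := (step (G.IH_all k) hxk h2.le (by linarith : ‖G.f k u - x‖ ≤ 12 * G.r k)).2
    rw [Finset.sum_range_succ, mul_add, Real.exp_add]
    have h4 : 1 + 3 * Kay H ^ 2 * G.b k x ^ 2 ≤ Real.exp (3 * Kay H ^ 2 * G.b k x ^ 2) := by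
      rw [add_comm]; exact Real.add_one_le_exp _
    calc _ ≤ _ := h3
      _ ≤ Real.exp (3 * Kay H ^ 2 * G.b k x ^ 2) * (Real.exp (3 * Kay H ^ 2 * ∑ l ∈ Finset.range k, G.b l x ^ 2) * ‖u' - u‖ ^ 2) := by
        gcongr
      _ = _ := by ring

theorem L2 (k : ℕ) : ∀ u, ∀ᶠ u' in nhds u, ‖G.f k u' - G.f k u‖ ≤ 2 * ‖u' - u‖ := by
  induction k with
  | zero =>
    intro u
    refine Eventually.of_forall (fun u' => ?_)
    unfold f
    have := norm_nonneg (u' - u)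
    simp only [add_sub_add_left_eq_sub]
    rw [← Submodule.coe_sub, ← Submodule.coe_norm]
    linarith
  | succ k ihk =>
    intro u
    have hr := G.r_pos k
    by_cases h : ∃ j ∈ G.J k, ‖G.f k u - j‖ < 12 * G.r k
    · obtain ⟨x, hxJ, hx⟩ := h
      have hxE := G.J_sub k hxJ
      have h1 := G.L1 k x hxE u hx.le
      have h2 : ∀ᶠ u' in nhds u, ‖G.f k u' - x‖ < 12 * G.r k := by
        have : Continuous (fun u' => ‖G.f k u' - x‖) := ((G.f_cont k).sub continuous_const).norm
        exact this.continuousAt.eventually_lt continuousAt_const hx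
      filter_upwards [h1, h2] with u' h1 h2
      have h3 := (step (G.IH_all k) hxE h2.le hx.le).2
      have h5 : 3 * Kay H ^ 2 * ∑ l ∈ Finset.range k, G.b l x ^ 2 + 3 * Kay H ^ 2 * G.b k x ^ 2 ≤ 1 := by
        rw [← mul_add, ← Finset.sum_range_succ]
        have e1 := G.b_sum k x hxE
        have e2 := G.hε
        have e0 : 0 ≤ Kay H := by linarith [Kay_ge H, Cone_ge H]
        have e3 := mul_nonneg e0 G.ε_nonneg
        have e4 := mul_le_mul_of_nonneg_left e1 (sq_nonneg (Kay H))
        nlinarith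
      have h4 : 1 + 3 * Kay H ^ 2 * G.b k x ^ 2 ≤ Real.exp (3 * Kay H ^ 2 * G.b k x ^ 2) := by
        rw [add_comm]; exact Real.add_one_le_exp _
      have h6 : ‖G.f (k+1) u' - G.f (k+1) u‖ ^ 2 ≤ (2 * ‖u' - u‖) ^ 2 := by
        calc _ ≤ _ := h3
          _ ≤ Real.exp (3 * Kay H ^ 2 * G.b k x ^ 2) * (Real.exp (3 * Kay H ^ 2 * ∑ l ∈ Finset.range k, G.b l x ^ 2) * ‖u' - u‖ ^ 2) := by
            gcongr
          _ = Real.exp (3 * Kay H ^ 2 * ∑ l ∈ Finset.range k, G.b l x ^ 2 + 3 * Kay H ^ 2 * G.b k x ^ 2) * ‖u' - u‖ ^ 2 := by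
            rw [Real.exp_add]; ring
          _ ≤ Real.exp 1 * ‖u' - u‖ ^ 2 := by gcongr
          _ ≤ 4 * ‖u' - u‖ ^ 2 := by
            gcongr
            have := Real.exp_one_lt_d9
            linarith
          _ = _ := by ring
      exact (sq_le_sq₀ (norm_nonneg _) (by positivity)).1 h6
    · push Not at h
      have h1 : ∀ᶠ u' in nhds u, ∀ j ∈ G.J k, 11 * G.r k < ‖G.f k u' - j‖ := by
        rw [eventually_all_finset]
        intro j hj
        have : Continuous (fun u' => ‖G.f k u' - j‖) := ((G.f_cont k).sub continuous_const).norm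
        exact continuousAt_const.eventually_lt this.continuousAt (by linarith [h j hj])
      have e : ∀ u', (∀ j ∈ G.J k, 11 * G.r k < ‖G.f k u' - j‖) → G.f (k+1) u' = G.f k u' :=
        fun u' hu' => sg_eq_self hr (fun j hj => (hu' j hj).le)
      filter_upwards [h1, ihk u] with u' h1 h2
      rw [e u' h1, e u (fun j hj => by linarith [h j hj])]
      exact h2

theorem main : ∃ f : G.V0 → H, LipschitzWith 2 f ∧ ∀ k, ∀ x ∈ G.E k, ∃ u : G.V0,
    ‖f u - x‖ ≤ 4 * (G.r0 / 2 ^ k) ∧ ‖G.c0 + (u : H) - x‖ ≤ 5 * G.r0 := by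
  have hd : ∀ u k, dist (G.f k u) (G.f (k+1) u) ≤ (G.r0 / 4) / 2 / 2 ^ k := by
    intro u k
    rw [dist_comm, dist_eq_norm]
    refine (disp (G.IH_all k) u).trans (le_of_eq ?_)
    unfold r; ring
  have hlim : ∀ u, ∃ y, Tendsto (fun k => G.f k u) atTop (nhds y) := fun u =>
    cauchySeq_tendsto_of_complete (cauchySeq_of_le_geometric_two (hd u))
  choose f hf using hlim
  have hdist : ∀ u k, ‖G.f k u - f u‖ ≤ G.r0 / 4 / 2 ^ k := by
    intro u k
    rw [← dist_eq_norm]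
    exact dist_le_of_le_geometric_two_of_tendsto (hd u) (hf u) k
  refine ⟨f, ?_, ?_⟩
  · apply LipschitzWith.of_dist_le_mul
    intro u u'
    have h1 : ∀ k, dist (G.f k u) (G.f k u') ≤ 2 * dist u u' := by
      intro k
      rw [dist_eq_norm, dist_eq_norm]
      exact lip_of_local (G.f_cont k) 2 (G.L2 k) u' u
    exact le_of_tendsto ((hf u).dist (hf u')) (Eventually.of_forall h1)
  · intro k x hx
    have hr := G.r_pos k
    have h1 : ‖x - G.P k x x‖ ≤ G.r k := G.h1 k x hx
    obtain ⟨u, hu1, hu2⟩ := G.Cov_all k x hx (G.P k x x) (pr_pr _ _ _) (by rw [norm_sub_rev]; linarith)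
    have h2 := hdist u k
    have h3 := hdist u 0
    have h4 := tri3 (G.f k u) (G.P k x x) x
    have h5 := tri1 (f u) (G.f k u) x
    have h6 := tri0 (G.f 0 u) (f u) x
    have e1 : G.r k = G.r0 / 2 ^ k := rfl
    have e2 : G.r0 / 4 / 2 ^ k = G.r k / 4 := by unfold r; ring
    have h7 : ‖f u - x‖ ≤ 4 * G.r k := by linarith
    refine ⟨u, by rw [← e1]; exact h7, ?_⟩
    have e3 : G.r k ≤ G.r0 := div_le_self G.r0_pos.le (one_le_pow₀ (by norm_num))
    have e4 : G.c0 + (u : H) = G.f 0 u := rfl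
    rw [e4]
    have e5 : G.r0 / 4 / 2 ^ 0 = G.r0 / 4 := by simp
    have := G.r0_pos
    linarith
end Geo
end geo2
end AT

namespace AT

section close
variable {H : Type*} [NormedAddCommGroup H] [InnerProductSpace ℝ H] [FiniteDimensional ℝ H]

theorem proj_symm (V : Submodule ℝ H) (v w : H) :
    inner ℝ (V.starProjection v) w = inner ℝ v (V.starProjection w) := by
  have h1 := inner_perp V w v
  have h2 := inner_perp V v w
  rw [inner_sub_left] at h1 h2
  rw [real_inner_comm w, ]
  rw [real_inner_comm] at h1
  linarith [real_inner_comm (V.starProjection v) (V.starProjection w), real_inner_comm (V.starProjection v) w]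

/-- decomposition along a slab -/
theorem slab_norm (V : Submodule ℝ H) (a : H) (ha : a ∈ V) (ha0 : a ≠ 0) (d : H) :
    ‖d‖ ≤ ‖d - V.starProjection d‖ + |inner ℝ d a| / ‖a‖ + ‖((ℝ ∙ a)ᗮ ⊓ V).starProjection d‖ := by
  set Q := (ℝ ∙ a)ᗮ ⊓ V with hQ
  set t : ℝ := inner ℝ d a / ‖a‖ ^ 2 with ht
  have hna : ‖a‖ ≠ 0 := norm_ne_zero_iff.2 ha0
  set d' := V.starProjection d - t • a with hd'
  have hPa : V.starProjection a = a := Submodule.starProjection_eq_self_iff.2 ha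
  have hmem : d' ∈ Q := by
    refine Submodule.mem_inf.2 ⟨?_, V.sub_mem (Submodule.starProjection_apply_mem _ _) (V.smul_mem _ ha)⟩
    rw [Submodule.mem_orthogonal_singleton_iff_inner_left, hd', inner_sub_left, proj_symm, hPa,
      inner_smul_left, real_inner_self_eq_norm_sq, ht]
    simp only [conj_trivial]
    field_simp
    ring
  have hproj : Q.starProjection d = d' := by
    have h1 : Q.starProjection (d - d') = 0 := by
      rw [Submodule.starProjection_apply_eq_zero_iff, Submodule.mem_orthogonal']
      intro q hq
      obtain ⟨hq1, hq2⟩ := Submodule.mem_inf.1 hq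
      rw [Submodule.mem_orthogonal_singleton_iff_inner_right] at hq1
      have e : d - d' = (d - V.starProjection d) + t • a := by rw [hd']; abel
      rw [e, inner_add_left, inner_smul_left, hq1, mul_zero, add_zero]
      exact Submodule.starProjection_inner_eq_zero _ _ hq2
    rw [map_sub, Submodule.starProjection_eq_self_iff.2 hmem, sub_eq_zero] at h1
    exact h1
  rw [hproj]
  have e : d = (d - V.starProjection d) + t • a + d' := by rw [hd']; abel
  have h2 : ‖t • a‖ = |inner ℝ d a| / ‖a‖ := by
    rw [norm_smul, Real.norm_eq_abs, ht, abs_div, abs_of_nonneg (sq_nonneg ‖a‖)]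
    field_simp
  calc ‖d‖ = ‖(d - V.starProjection d) + t • a + d'‖ := by rw [← e]
    _ ≤ ‖(d - V.starProjection d) + t • a‖ + ‖d'‖ := norm_add_le _ _
    _ ≤ _ := by rw [← h2]; gcongr; exact norm_add_le _ _

variable [MeasurableSpace H] [BorelSpace H]

/-- mass of a slab -/
theorem slab_mass {n : ℕ} (hn : 1 ≤ n) (C0 s r : ℝ) (hC0 : 0 < C0) (hs : 0 < s) (hs1 : s ≤ 1) (hr : 0 < r)
    (ν : Measure H) (hν : ∀ y, ∀ t, 0 < t → t ≤ 5 * r → ν (closedBall y t) ≤ ENNReal.ofReal (C0 * t ^ n))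
    (V : Submodule ℝ H) (hV : Module.finrank ℝ V = n) (a : H) (ha : a ∈ V) (ha0 : a ≠ 0)
    (A : Set H) (h1 : ∀ y ∈ A, ∀ z ∈ A, ‖y - z‖ ≤ 2 * r)
    (h2 : ∀ y ∈ A, ∀ z ∈ A, ‖(y - z) - V.starProjection (y - z)‖ ≤ 2 * s * r)
    (h3 : ∀ y ∈ A, ∀ z ∈ A, |inner ℝ (y - z) a| / ‖a‖ ≤ 2 * s * r) :
    ν A ≤ ENNReal.ofReal (25 ^ n * C0 * s * r ^ n) := by
  rcases A.eq_empty_or_nonempty with rfl | ⟨y0, hy0⟩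
  · simp
  set Q := (ℝ ∙ a)ᗮ ⊓ V with hQ
  have hfin : Module.finrank ℝ Q = n - 1 := by
    have hle : (ℝ ∙ a) ≤ V := by
      rw [Submodule.span_singleton_le_iff_mem]; exact ha
    have := Submodule.finrank_add_inf_finrank_orthogonal hle
    rw [finrank_span_singleton ha0, hV] at this
    change 1 + Module.finrank ℝ Q = n at this
    omega
  have hg : ∀ y z, ‖Q.starProjection (y - y0) - Q.starProjection (z - y0)‖ = ‖Q.starProjection (y - z)‖ := by
    intro y z
    rw [← map_sub]; congr 2; abel
  let g : H → Q := fun y => ⟨Q.starProjection (y - y0), Submodule.starProjection_apply_mem _ _⟩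
  have hgn : ∀ y z, ‖g y - g z‖ = ‖Q.starProjection (y - z)‖ := by
    intro y z
    rw [← hg]; rfl
  have hgR : ∀ y ∈ A, ‖g y - 0‖ ≤ 2 * r := by
    intro y hy
    rw [sub_zero]
    exact (norm_proj_le Q _).trans (h1 y hy y0 hy0)
  obtain ⟨J, hJA, hsep, hcov⟩ := exists_net g A 0 (2 * r) (s * r) (by positivity) hgR
  have hcard := card_separated J g 0 (2 * r) (s * r) (by positivity) (by positivity)
    (fun i hi => hgR i (hJA hi)) hsep
  rw [hfin] at hcard
  have hcard2 : (J.card : ℝ) ≤ (5 / s) ^ (n - 1) := by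
    refine hcard.trans ?_
    gcongr
    have : 2 * (2 * r) / (s * r) = 4 / s := by field_simp; norm_num
    rw [this]
    have : 1 ≤ 1 / s := by rw [le_div_iff₀ hs]; linarith
    have e : 5 / s = 1 / s + 4 / s := by ring
    linarith
  have hsub : A ⊆ ⋃ j ∈ J, closedBall j (5 * (s * r)) := by
    intro y hy
    obtain ⟨j, hj, hyj⟩ := hcov y hy
    rw [mem_iUnion₂]
    refine ⟨j, hj, ?_⟩
    rw [mem_closedBall, dist_eq_norm]
    have k1 := slab_norm V a ha ha0 (y - j)
    have k2 := h2 y hy j (hJA hj)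
    have k3 := h3 y hy j (hJA hj)
    rw [hgn] at hyj
    linarith
  calc ν A ≤ ν (⋃ j ∈ J, closedBall j (5 * (s * r))) := measure_mono hsub
    _ ≤ ∑ j ∈ J, ν (closedBall j (5 * (s * r))) := measure_biUnion_finset_le _ _
    _ ≤ ∑ j ∈ J, ENNReal.ofReal (C0 * (5 * (s * r)) ^ n) := by
      apply Finset.sum_le_sum
      intro j _
      apply hν j _ (by positivity)
      nlinarith
    _ = ENNReal.ofReal (J.card * (C0 * (5 * (s * r)) ^ n)) := by
      rw [Finset.sum_const, nsmul_eq_mul, ENNReal.ofReal_mul (p := (J.card : ℝ)) (by positivity), ENNReal.ofReal_natCast]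
    _ ≤ _ := by
      apply ENNReal.ofReal_le_ofReal
      calc (J.card : ℝ) * (C0 * (5 * (s * r)) ^ n) ≤ (5 / s) ^ (n - 1) * (C0 * (5 * (s * r)) ^ n) := by gcongr
        _ ≤ _ := by
          obtain ⟨m, rfl⟩ : ∃ m, n = m + 1 := ⟨n - 1, by omega⟩
          rw [Nat.add_sub_cancel]
          have e : (5 / s) ^ m * (C0 * (5 * (s * r)) ^ (m + 1)) = 5 * (25 ^ m * C0 * s * r ^ (m + 1)) := by
            rw [show (25 : ℝ) = 5 * 5 by norm_num]
            simp only [mul_pow, div_pow, pow_succ]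
            field_simp
          have e2 : (25 : ℝ) ^ (m+1) * C0 * s * r ^ (m + 1) = 25 * (25 ^ m * C0 * s * r ^ (m + 1)) := by ring
          rw [e, e2]
          have : 0 ≤ 25 ^ m * C0 * s * r ^ (m + 1) := by positivity
          linarith

/-- Chebyshev -/
theorem cheb {n : ℕ} (ν : Measure H) (τ b r : ℝ) (hτ : 0 < τ) (hb : 0 < b) (hr : 0 < r) (x c : H) (V : Submodule ℝ H)
    (h : ∫⁻ y in closedBall x r, ENNReal.ofReal (‖y - pr c V y‖ ^ 2) ∂ν ≤ ENNReal.ofReal (b ^ 2 * r ^ (n + 2))) :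
    ν (closedBall x r ∩ {y | 2 / √τ * b * r < ‖y - pr c V y‖}) ≤ ENNReal.ofReal (τ / 4 * r ^ n) := by
  have hsq : 0 < √τ := Real.sqrt_pos.2 hτ
  have hm : Measurable (fun y => ENNReal.ofReal (‖y - pr c V y‖ ^ 2)) := by
    apply Measurable.ennreal_ofReal
    exact (((continuous_id.sub (pr_cont c V)).norm).pow 2).measurable
  set T : ℝ := (2 / √τ * b * r) ^ 2 with hT
  have hTpos : 0 < T := by positivity
  have h1 := mul_meas_ge_le_lintegral (μ := ν.restrict (closedBall x r)) hm (ENNReal.ofReal T)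
  have hsub : closedBall x r ∩ {y | 2 / √τ * b * r < ‖y - pr c V y‖} ⊆
      {y | ENNReal.ofReal T ≤ ENNReal.ofReal (‖y - pr c V y‖ ^ 2)} ∩ closedBall x r := by
    rintro y ⟨hy1, hy2⟩
    refine ⟨?_, hy1⟩
    apply ENNReal.ofReal_le_ofReal
    rw [hT]
    have : 2 / √τ * b * r < ‖y - pr c V y‖ := hy2
    gcongr
  have h2 : ν (closedBall x r ∩ {y | 2 / √τ * b * r < ‖y - pr c V y‖}) ≤ (ν.restrict (closedBall x r))
      {y | ENNReal.ofReal T ≤ ENNReal.ofReal (‖y - pr c V y‖ ^ 2)} := by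
    rw [Measure.restrict_apply (measurableSet_le measurable_const hm)]
    exact measure_mono hsub
  have h3 := (mul_le_mul_right h2 (ENNReal.ofReal T)).trans (h1.trans h)
  have e : b ^ 2 * r ^ (n + 2) = T * (τ / 4 * r ^ n) := by
    rw [hT, mul_pow, mul_pow, div_pow, Real.sq_sqrt hτ.le]
    field_simp
    ring
  rw [e, ENNReal.ofReal_mul hTpos.le] at h3
  exact (ENNReal.mul_le_mul_iff_right (by simpa using hTpos) ENNReal.ofReal_ne_top).1 h3

/-- Closeness of planes. -/
theorem close {n : ℕ} (hn : 1 ≤ n) (C0 τ : ℝ) (hC0 : 0 < C0) (hτ : 0 < τ) : ∃ C > 0, 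
    ∀ (ν : Measure H) (x : H) (r b : ℝ) (c c' : H) (V V' : Submodule ℝ H), 0 < r → 0 < b →
    (∀ y, ∀ t, 0 < t → t ≤ 5 * r → ν (closedBall y t) ≤ ENNReal.ofReal (C0 * t ^ n)) →
    ENNReal.ofReal (τ * r ^ n) ≤ ν (closedBall x r) →
    Module.finrank ℝ V = n → Module.finrank ℝ V' = n →
    ∫⁻ y in closedBall x r, ENNReal.ofReal (‖y - pr c V y‖ ^ 2) ∂ν ≤ ENNReal.ofReal (b ^ 2 * r ^ (n + 2)) →
    ∫⁻ y in closedBall x r, ENNReal.ofReal (‖y - pr c' V' y‖ ^ 2) ∂ν ≤ ENNReal.ofReal (b ^ 2 * r ^ (n + 2)) →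
    (∀ v, ‖V.starProjection v - V'.starProjection v‖ ≤ C * b * ‖v‖) ∧ ‖pr c V x - pr c' V' x‖ ≤ C * b * r := by
  set t : ℝ := 2 / √τ with ht
  have htpos : 0 < t := div_pos two_pos (Real.sqrt_pos.2 hτ)
  set s : ℝ := min 1 (τ / (4 * 25 ^ n * C0)) with hs
  have hspos : 0 < s := lt_min one_pos (by positivity)
  have hs1 : s ≤ 1 := min_le_left _ _
  have hs2 : 25 ^ n * C0 * s ≤ τ / 4 := by
    have : s ≤ τ / (4 * 25 ^ n * C0) := min_le_right _ _
    rw [le_div_iff₀ (by positivity)] at this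
    linarith
  set C' : ℝ := 4 * t / s with hC'
  have hC'pos : 0 < C' := by positivity
  have htC' : 4 * t ≤ C' := by
    rw [hC', le_div_iff₀ hspos]; nlinarith
  refine ⟨3 * C', by positivity, ?_⟩
  intro ν x r b c c' V V' hr hb hν hmass hV hV' hi hi'
  set A : Set H := closedBall x r ∩ {y | ‖y - pr c V y‖ ≤ t * b * r ∧ ‖y - pr c' V' y‖ ≤ t * b * r} with hA
  have hAm : ENNReal.ofReal (τ / 2 * r ^ n) ≤ ν A := by
    have k1 := cheb ν τ b r hτ hb hr x c V hi
    have k2 := cheb ν τ b r hτ hb hr x c' V' hi'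
    rw [← ht] at k1 k2
    have hsub : closedBall x r ⊆ A ∪ ((closedBall x r ∩ {y | t * b * r < ‖y - pr c V y‖}) ∪ (closedBall x r ∩ {y | t * b * r < ‖y - pr c' V' y‖})) := by
      intro y hy
      by_cases h1 : ‖y - pr c V y‖ ≤ t * b * r
      · by_cases h2 : ‖y - pr c' V' y‖ ≤ t * b * r
        · exact Or.inl ⟨hy, h1, h2⟩
        · exact Or.inr (Or.inr ⟨hy, not_le.1 h2⟩)
      · exact Or.inr (Or.inl ⟨hy, not_le.1 h1⟩)
    have k3 := hmass.trans ((measure_mono hsub).trans ((measure_union_le _ _).trans (add_le_add_right ((measure_union_le _ _).trans (add_le_add k1 k2)) _)))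
    rw [← ENNReal.ofReal_add (by positivity) (by positivity)] at k3
    have e : τ * r ^ n = τ / 2 * r ^ n + (τ / 4 * r ^ n + τ / 4 * r ^ n) := by ring
    rw [e, ENNReal.ofReal_add (by positivity) (by positivity)] at k3
    exact (ENNReal.add_le_add_iff_right ENNReal.ofReal_ne_top).1 k3
  have hAne : A.Nonempty := by
    by_contra hc
    rw [not_nonempty_iff_eq_empty.1 hc, measure_empty, nonpos_iff_eq_zero, ENNReal.ofReal_eq_zero] at hAm
    have : 0 < τ / 2 * r ^ n := by positivity
    linarith
  have claim : ∀ (c c' : H) (V V' : Submodule ℝ H), Module.finrank ℝ V = n → 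
      (∀ y ∈ A, ‖y - pr c V y‖ ≤ t * b * r ∧ ‖y - pr c' V' y‖ ≤ t * b * r) →
      ∀ e, V'.starProjection e = 0 → ‖V.starProjection e‖ ≤ C' * b * ‖e‖ := by
    intro c c' V V' hV hAA e he
    by_cases hts : s ≤ t * b
    · refine (norm_proj_le V e).trans ?_
      have : 1 ≤ C' * b := by
        rw [hC', div_mul_eq_mul_div, le_div_iff₀ hspos]; nlinarith
      nlinarith [norm_nonneg e]
    · push Not at hts
      by_contra hcon
      push Not at hcon
      set a := V.starProjection e with ha
      have hapos : 0 < ‖a‖ := lt_of_le_of_lt (by positivity) hcon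
      have ha0 : a ≠ 0 := norm_pos_iff.1 hapos
      have haV : a ∈ V := Submodule.starProjection_apply_mem _ _
      have hinn : ∀ y z, inner ℝ (y - z) a = inner ℝ ((pr c V y - pr c' V' y) - (pr c V z - pr c' V' z)) e := by
        intro y z
        have e1 : (pr c V y - pr c' V' y) - (pr c V z - pr c' V' z) = V.starProjection (y - z) - V'.starProjection (y - z) := by
          rw [← pr_sub c, ← pr_sub c']; abel
        rw [e1, inner_sub_left (V.starProjection (y - z)), proj_symm, proj_symm, he, inner_zero_right, sub_zero]
      have hpp : ∀ y ∈ A, ‖pr c V y - pr c' V' y‖ ≤ 2 * (t * b * r) := by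
        intro y hy
        have := tri1 (pr c V y) y (pr c' V' y)
        linarith [(hAA y hy).1, (hAA y hy).2]
      have key := slab_mass hn C0 s r hC0 hspos hs1 hr ν hν V hV a haV ha0 A ?_ ?_ ?_
      · have k1 := hAm.trans key
        rw [ENNReal.ofReal_le_ofReal_iff (by positivity)] at k1
        have k2 := mul_le_mul_of_nonneg_right hs2 (pow_nonneg hr.le n)
        have k3 : 0 < τ * r ^ n := by positivity
        linarith
      · intro y hy z hz
        have h1 := hy.1
        have h2 := hz.1
        rw [mem_closedBall, dist_eq_norm] at h1 h2
        have := tri3 y x z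
        linarith
      · intro y hy z hz
        have e1 : (y - z) - V.starProjection (y - z) = (y - pr c V y) - (z - pr c V z) := by
          rw [← pr_sub c]; abel
        rw [e1]
        refine (norm_sub_le _ _).trans ?_
        have k1 := (hAA y hy).1
        have k2 := (hAA z hz).1
        have k3 := mul_le_mul_of_nonneg_right hts.le hr.le
        linarith
      · intro y hy z hz
        rw [div_le_iff₀ hapos, hinn]
        refine (abs_real_inner_le_norm _ _).trans ?_
        have k1 : ‖(pr c V y - pr c' V' y) - (pr c V z - pr c' V' z)‖ ≤ 4 * t * b * r := by
          refine (norm_sub_le _ _).trans ?_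
          linarith [hpp y hy, hpp z hz]
        have k2 : s * r * (C' * b * ‖e‖) ≤ s * r * ‖a‖ := by gcongr
        have k3 : s * r * (C' * b * ‖e‖) = 4 * t * b * r * ‖e‖ := by rw [hC']; field_simp
        have k4 := mul_le_mul_of_nonneg_right k1 (norm_nonneg e)
        have k5 : 0 ≤ s * r * ‖a‖ := by positivity
        linarith
  have cl1 := claim c c' V V' hV (fun y hy => hy.2)
  have cl2 := claim c' c V' V hV' (fun y hy => ⟨hy.2.2, hy.2.1⟩)
  have lin : ∀ v, ‖V.starProjection v - V'.starProjection v‖ ≤ 2 * C' * b * ‖v‖ := by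
    intro v
    have z1 : V'.starProjection (v - V'.starProjection v) = 0 := by rw [map_sub, proj_proj, sub_self]
    have k1 := cl1 _ z1
    have k1' := k1.trans (mul_le_mul_of_nonneg_left (norm_perp_le V' v) (by positivity))
    set w := V'.starProjection v - V.starProjection (V'.starProjection v) with hw
    have z2 : V.starProjection w = 0 := by rw [hw, map_sub, proj_proj, sub_self]
    have k2 := cl2 w z2
    have k3 : ‖w‖ ^ 2 = inner ℝ (V'.starProjection w) v := by
      rw [proj_symm, ← real_inner_self_eq_norm_sq]
      nth_rewrite 2 [hw]
      rw [inner_sub_right, ← proj_symm V, z2, inner_zero_left, sub_zero]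
    have k4 : ‖w‖ ≤ C' * b * ‖v‖ := by
      have k5 : ‖w‖ ^ 2 ≤ C' * b * ‖w‖ * ‖v‖ := by
        rw [k3]
        refine (real_inner_le_norm _ _).trans ?_
        gcongr
      rcases (norm_nonneg w).eq_or_lt with h0 | h0
      · rw [← h0]; positivity
      · have : ‖w‖ * ‖w‖ ≤ ‖w‖ * (C' * b * ‖v‖) := by linarith [sq ‖w‖]
        exact le_of_mul_le_mul_left this h0
    have e : V.starProjection v - V'.starProjection v = V.starProjection (v - V'.starProjection v) - w := by
      rw [hw, map_sub]; abel
    rw [e]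
    refine (norm_sub_le _ _).trans ?_
    linarith
  refine ⟨fun v => (lin v).trans ?_, ?_⟩
  · have : 0 ≤ C' * b * ‖v‖ := by positivity
    linarith
  · obtain ⟨y, hy⟩ := hAne
    have k1 := pr_diff c c' V V' y x
    have k2 := lin (x - y)
    have k3 := hy.1
    rw [mem_closedBall, dist_eq_norm, norm_sub_rev] at k3
    have k4 := tri1 (pr c V y) y (pr c' V' y)
    have k5 : 2 * C' * b * ‖x - y‖ ≤ 2 * C' * b * r := by gcongr
    have k6 := hy.2.1
    have k7 := hy.2.2
    have k8 : 4 * t * (b * r) ≤ C' * (b * r) := by gcongr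
    have : 0 < t * b * r := by positivity
    linarith
end close
end AT

namespace AT

section beta
variable {n d : ℕ} {μ : Measure (EuclideanSpace ℝ (Fin d))}

theorem beta_mono (x x' : EuclideanSpace ℝ (Fin d)) (s t : ℝ) (hs : 0 < s) (ht : 0 < t)
    (h : closedBall x s ⊆ closedBall x' t) :
    beta2sq n d μ x s ≤ ENNReal.ofReal ((t / s) ^ (n + 2)) * beta2sq n d μ x' t := by
  unfold beta2sq
  rw [ENNReal.mul_iInf_of_ne (by simpa using by positivity) ENNReal.ofReal_ne_top]
  refine le_iInf (fun L => iInf_le_of_le L ?_)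
  have e1 : ∀ y, ENNReal.ofReal ((infDist y (L.1 : Set (EuclideanSpace ℝ (Fin d))) / s) ^ 2)
      = ENNReal.ofReal ((t / s) ^ 2) * ENNReal.ofReal ((infDist y (L.1 : Set (EuclideanSpace ℝ (Fin d))) / t) ^ 2) := by
    intro y
    rw [← ENNReal.ofReal_mul (by positivity)]
    congr 1
    field_simp
  simp_rw [e1]
  rw [lintegral_const_mul' _ _ ENNReal.ofReal_ne_top]
  have e2 : ENNReal.ofReal ((t / s) ^ (n + 2)) = ENNReal.ofReal ((t / s) ^ 2) * ENNReal.ofReal ((t / s) ^ n) := by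
    rw [← ENNReal.ofReal_mul (by positivity)]
    congr 1; ring
  have e3 : ENNReal.ofReal ((t / s) ^ n) / ENNReal.ofReal (t ^ n) = (ENNReal.ofReal (s ^ n))⁻¹ := by
    rw [← ENNReal.ofReal_div_of_pos (by positivity), ← ENNReal.ofReal_inv_of_pos (by positivity)]
    congr 1
    rw [div_pow]; field_simp
  rw [e2, ENNReal.div_eq_inv_mul, ENNReal.div_eq_inv_mul, ← e3, ENNReal.div_eq_inv_mul]
  calc _ ≤ (ENNReal.ofReal (t ^ n))⁻¹ * ENNReal.ofReal ((t / s) ^ n) * (ENNReal.ofReal ((t / s) ^ 2) *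
      ∫⁻ y in closedBall x' t, ENNReal.ofReal ((infDist y (L.1 : Set (EuclideanSpace ℝ (Fin d))) / t) ^ 2) ∂μ) := by
        gcongr
    _ = _ := by ring

theorem exists_plane (hn : 1 ≤ n) (x : EuclideanSpace ℝ (Fin d)) (s a : ℝ) (hs : 0 < s) (ha : 0 ≤ a)
    (h : beta2sq n d μ x s < ENNReal.ofReal a) : 
    ∃ (c : EuclideanSpace ℝ (Fin d)) (V : Submodule ℝ (EuclideanSpace ℝ (Fin d))), Module.finrank ℝ V = n ∧
      ∫⁻ y in closedBall x s, ENNReal.ofReal (‖y - pr c V y‖ ^ 2) ∂μ ≤ ENNReal.ofReal (a * s ^ (n + 2)) := by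
  unfold beta2sq at h
  obtain ⟨⟨L, hL⟩, hlt⟩ := iInf_lt_iff.1 h
  simp only at hlt
  have hne : (L : Set (EuclideanSpace ℝ (Fin d))).Nonempty := by
    rw [nonempty_iff_ne_empty]
    intro h0
    rw [AffineSubspace.coe_eq_bot_iff] at h0
    rw [h0, AffineSubspace.direction_bot] at hL
    simp at hL; omega
  obtain ⟨c, hc⟩ := hne
  refine ⟨c, L.direction, hL, ?_⟩
  have hdist : ∀ y, ‖y - pr c L.direction y‖ ≤ infDist y (L : Set (EuclideanSpace ℝ (Fin d))) := by
    intro y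
    refine (le_infDist ⟨c, hc⟩).2 (fun z hz => ?_)
    rw [dist_eq_norm]
    have e : pr c L.direction z = z := by
      unfold pr
      rw [Submodule.starProjection_eq_self_iff.2]
      · abel
      · exact AffineSubspace.vsub_mem_direction hz hc
    have := pr_min c L.direction y z
    rwa [e] at this
  rw [ENNReal.div_lt_iff (Or.inl (by simpa using by positivity)) (Or.inl ENNReal.ofReal_ne_top)] at hlt
  calc _ ≤ ∫⁻ y in closedBall x s, ENNReal.ofReal (s ^ 2) * ENNReal.ofReal ((infDist y (L : Set (EuclideanSpace ℝ (Fin d))) / s) ^ 2) ∂μ := by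
        apply lintegral_mono
        intro y
        simp only
        rw [← ENNReal.ofReal_mul (by positivity)]
        apply ENNReal.ofReal_le_ofReal
        have : s ^ 2 * (infDist y (L : Set (EuclideanSpace ℝ (Fin d))) / s) ^ 2 = infDist y (L : Set (EuclideanSpace ℝ (Fin d))) ^ 2 := by
          field_simp
        rw [this]
        have := hdist y
        gcongr
    _ = ENNReal.ofReal (s ^ 2) * ∫⁻ y in closedBall x s, ENNReal.ofReal ((infDist y (L : Set (EuclideanSpace ℝ (Fin d))) / s) ^ 2) ∂μ :=
        lintegral_const_mul' _ _ ENNReal.ofReal_ne_top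
    _ ≤ ENNReal.ofReal (s ^ 2) * (ENNReal.ofReal a * ENNReal.ofReal (s ^ n)) := by gcongr
    _ = _ := by
        rw [← ENNReal.ofReal_mul ha, ← ENNReal.ofReal_mul (by positivity)]
        congr 1; ring

end beta

/-- Carleson packing. -/
theorem pack {F : Type*} [NormedAddCommGroup F] [NormedSpace ℝ F] [FiniteDimensional ℝ F]
    {ι : Type*} (s : Finset ι) (u : ι → F) (ρ : ι → ℝ) (a : ι → ℝ≥0∞) (A : ℝ≥0∞) (u0 : F) (R : ℝ)
    (hR : 0 < R) (hρ : ∀ i ∈ s, 0 < ρ i) (hu : ∀ i ∈ s, ‖u i - u0‖ + ρ i ≤ R)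
    (hA : ∀ v, ∑ i ∈ s with ‖v - u i‖ < ρ i, a i ≤ A) :
    ∑ i ∈ s, a i * ENNReal.ofReal (ρ i ^ Module.finrank ℝ F) ≤ A * ENNReal.ofReal (R ^ Module.finrank ℝ F) := by
  classical
  borelize F
  let vol : Measure F := Measure.addHaar
  have h1 : ∑ i ∈ s, a i * ENNReal.ofReal (ρ i ^ Module.finrank ℝ F) * vol (ball 0 1) ≤
      A * ENNReal.ofReal (R ^ Module.finrank ℝ F) * vol (ball 0 1) := by
    calc ∑ i ∈ s, a i * ENNReal.ofReal (ρ i ^ Module.finrank ℝ F) * vol (ball 0 1) 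
        = ∑ i ∈ s, ∫⁻ v, (ball (u i) (ρ i)).indicator (fun _ => a i) v ∂vol := by
          apply Finset.sum_congr rfl
          intro i hi
          rw [lintegral_indicator measurableSet_ball, setLIntegral_const, vol.addHaar_ball_of_pos _ (hρ i hi), mul_assoc]
      _ = ∫⁻ v, ∑ i ∈ s, (ball (u i) (ρ i)).indicator (fun _ => a i) v ∂vol := by
          rw [lintegral_finsetSum]
          intro i _
          exact measurable_const.indicator measurableSet_ball
      _ ≤ ∫⁻ v, (ball u0 R).indicator (fun _ => A) v ∂vol := by
          apply lintegral_mono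
          intro v
          by_cases hv : v ∈ ball u0 R
          · simp only [indicator_of_mem hv]
            refine le_trans (le_of_eq ?_) (hA v)
            rw [Finset.sum_filter]
            apply Finset.sum_congr rfl
            intro i _
            simp only [indicator_apply, mem_ball, dist_eq_norm]
          · simp only [indicator_of_notMem hv]
            rw [nonpos_iff_eq_zero]
            apply Finset.sum_eq_zero
            intro i hi
            apply indicator_of_notMem
            intro hvi
            apply hv
            rw [mem_ball, dist_eq_norm] at hvi ⊢
            have := norm_sub_le_norm_sub_add_norm_sub v (u i) u0
            linarith [hu i hi]
      _ = _ := by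
          rw [lintegral_indicator measurableSet_ball, setLIntegral_const, vol.addHaar_ball_of_pos _ hR, mul_assoc]
  rw [← Finset.sum_mul] at h1
  exact (ENNReal.mul_le_mul_iff_left (measure_ball_pos _ _ zero_lt_one).ne' measure_ball_lt_top.ne).1 h1
end AT

namespace AT

section stopping_time
variable {X : Type*} [NormedAddCommGroup X] [InnerProductSpace ℝ X] [FiniteDimensional ℝ X]
  [MeasurableSpace X] [BorelSpace X]
  {F : Type*} [NormedAddCommGroup F] [NormedSpace ℝ F] [FiniteDimensional ℝ F]

theorem packT1 (μ : Measure X) (E : Set X) (T : ℕ → Set X) (f : F → X) (hf : LipschitzWith 2 f)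
    (r0 τ : ℝ) (hr0 : 0 < r0) (u0 : F)
    (hU : ∀ k, ∀ x ∈ T k, ∃ u, ‖f u - x‖ ≤ 4 * (r0 / 2 ^ k) ∧ ‖u - u0‖ ≤ 6 * r0)
    (hTE : ∀ k, T k ⊆ E)
    (h : ∀ k, ∀ x ∈ T k, μ (E ∩ closedBall x (200 * (r0 / 2 ^ (k + 1)))) ≤
      ENNReal.ofReal τ * ENNReal.ofReal ((r0 / 2 ^ (k + 1)) ^ Module.finrank ℝ F)) :
    μ (⋃ k, T k) ≤ ENNReal.ofReal τ * ENNReal.ofReal ((13 * r0) ^ Module.finrank ℝ F) := by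
  classical
  have hU' : ∀ i : ℕ × X, ∃ u, i.2 ∈ T i.1 → ‖f u - i.2‖ ≤ 4 * (r0 / 2 ^ i.1) ∧ ‖u - u0‖ ≤ 6 * r0 := by
    intro i
    by_cases hi : i.2 ∈ T i.1
    · obtain ⟨u, hu⟩ := hU _ _ hi
      exact ⟨u, fun _ => hu⟩
    · exact ⟨u0, fun h => absurd h hi⟩
  choose u hu using hU'
  set ρ : ℕ × X → ℝ := fun i => r0 / 2 ^ (i.1 + 1) with hρ
  have hρpos : ∀ i, 0 < ρ i := fun i => by simp only [hρ]; positivity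
  have hρle : ∀ i, ρ i ≤ r0 := fun i => by
    simp only [hρ]
    exact div_le_self hr0.le (one_le_pow₀ (by norm_num))
  have hρ2 : ∀ i, r0 / 2 ^ i.1 = 2 * ρ i := fun i => by simp only [hρ, pow_succ]; field_simp
  obtain ⟨w, hwt, hdisj, hcov⟩ := Vitali.exists_disjoint_subfamily_covering_enlargement_closedBall
    {i : ℕ × X | i.2 ∈ T i.1} (fun i => i.2) (fun i => 40 * ρ i) (40 * r0) 
    (fun i _ => by have := hρle i; linarith) 5 (by norm_num)
  have hcount : w.Countable := by
    apply hdisj.countable_of_nonempty_interior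
    intro i _
    refine ⟨i.2, ?_⟩
    refine interior_mono ball_subset_closedBall ?_
    rw [interior_eq_iff_isOpen.2 isOpen_ball]
    exact mem_ball_self (by have := hρpos i; positivity)
  have hsub : (⋃ k, T k) ⊆ ⋃ i ∈ w, E ∩ closedBall i.2 (200 * ρ i) := by
    intro x hx
    obtain ⟨k, hk⟩ := mem_iUnion.1 hx
    obtain ⟨b, hb, hbs⟩ := hcov (k, x) hk
    refine mem_iUnion₂.2 ⟨b, hb, hTE k hk, ?_⟩
    have h1 := hbs (mem_closedBall_self (by have := hρpos (k, x); positivity))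
    rwa [show 5 * (40 * ρ b) = 200 * ρ b by ring] at h1
  calc μ (⋃ k, T k) ≤ μ (⋃ i ∈ w, E ∩ closedBall i.2 (200 * ρ i)) := measure_mono hsub
    _ ≤ ∑' i : w, μ (E ∩ closedBall i.1.2 (200 * ρ i.1)) := measure_biUnion_le _ hcount _
    _ ≤ _ := by
      rw [ENNReal.tsum_eq_iSup_sum]
      refine iSup_le (fun s => ?_)
      calc ∑ i ∈ s, μ (E ∩ closedBall i.1.2 (200 * ρ i.1))
          ≤ ∑ i ∈ s, ENNReal.ofReal τ * ENNReal.ofReal (ρ i.1 ^ Module.finrank ℝ F) :=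
            Finset.sum_le_sum (fun i _ => h _ _ (hwt i.2))
        _ ≤ _ := by
          refine pack s (fun i => u i.1) (fun i => ρ i.1) (fun _ => ENNReal.ofReal τ) _ u0 (13 * r0) (by positivity)
            (fun i _ => hρpos _) (fun i _ => ?_) (fun v => ?_)
          · have h1 := (hu i.1 (hwt i.2)).2
            have h2 := hρle i.1
            linarith
          · rw [Finset.sum_const]
            have hc : (s.filter (fun i => ‖v - u i.1‖ < ρ i.1)).card ≤ 1 := by
              rw [Finset.card_le_one]
              intro i hi j hj
              by_contra hij
              have key : ∀ i : w, ‖v - u i.1‖ < ρ i.1 → f v ∈ closedBall i.1.2 (40 * ρ i.1) := by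
                intro i hi
                rw [mem_closedBall, dist_eq_norm]
                have h1 := (hu i.1 (hwt i.2)).1
                have h2 := hf.dist_le_mul v (u i.1)
                rw [dist_eq_norm, dist_eq_norm] at h2
                rw [hρ2] at h1
                have h3 := tri0 (f v) (f (u i.1)) i.1.2
                have := hρpos i.1
                simp at h2
                linarith
              have hne : i.1 ≠ j.1 := fun h => hij (Subtype.ext h)
              exact Set.disjoint_left.1 (hdisj i.2 j.2 hne) (key i (Finset.mem_filter.1 hi).2) (key j (Finset.mem_filter.1 hj).2)
            calc _ ≤ 1 • ENNReal.ofReal τ := by gcongr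
              _ = _ := one_smul _ _

theorem packT2 (μ : Measure X) (T : ℕ → Set X) (f : F → X) (hf : LipschitzWith 2 f)
    (r0 δ : ℝ) (hr0 : 0 < r0) (hδ : 0 ≤ δ) (u0 : F) (xs : X) (R : ℝ)
    (al g : ℕ → X → ℝ) (hal : ∀ k x, 0 ≤ al k x) (hg : ∀ k x, 0 ≤ g k x)
    (hbdd : ∀ k, ∀ x ∈ T k, ‖x - xs‖ ≤ R)
    (hU : ∀ k, ∀ x ∈ T k, ∃ u, ‖f u - x‖ ≤ 4 * (r0 / 2 ^ k) ∧ ‖u - u0‖ ≤ 6 * r0)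
    (h : ∀ k, ∀ x ∈ T k, μ (closedBall x (r0 / 2 ^ (k + 1) / 2)) ≤
      ENNReal.ofReal (al k x * (r0 / 2 ^ (k + 1)) ^ Module.finrank ℝ F))
    (hag : ∀ k m, k ≤ m → ∀ x ∈ T k, ∀ x' ∈ T m, ‖x - x'‖ ≤ 20 * (r0 / 2 ^ (k + 1)) → al k x ≤ g k x')
    (hgs : ∀ m, ∀ x ∈ T m, ∑ k ∈ Finset.range (m + 1), g k x ≤ δ) :
    μ (⋃ k, T k) ≤ ENNReal.ofReal (41 ^ Module.finrank ℝ X * δ) * ENNReal.ofReal ((13 * r0) ^ Module.finrank ℝ F) := by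
  classical
  have hU' : ∀ i : ℕ × X, ∃ u, i.2 ∈ T i.1 → ‖f u - i.2‖ ≤ 4 * (r0 / 2 ^ i.1) ∧ ‖u - u0‖ ≤ 6 * r0 := by
    intro i
    by_cases hi : i.2 ∈ T i.1
    · obtain ⟨u, hu⟩ := hU _ _ hi
      exact ⟨u, fun _ => hu⟩
    · exact ⟨u0, fun h => absurd h hi⟩
  choose u hu using hU'
  have hpos : ∀ k : ℕ, 0 < r0 / 2 ^ (k + 1) := fun k => by positivity
  have hanti : ∀ k m : ℕ, k ≤ m → r0 / 2 ^ (m + 1) ≤ r0 / 2 ^ (k + 1) := by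
    intro k m hkm
    gcongr
    · norm_num
  have hle : ∀ k : ℕ, r0 / 2 ^ (k + 1) ≤ r0 := fun k => 
    div_le_self hr0.le (one_le_pow₀ (by norm_num))
  have h2 : ∀ k : ℕ, r0 / 2 ^ k = 2 * (r0 / 2 ^ (k + 1)) := fun k => by rw [pow_succ]; field_simp
  have hnet := fun k => exists_net (fun y : X => y) (T k) xs R (r0 / 2 ^ (k + 1) / 2) (by have := hpos k; positivity) (hbdd k)
  choose J hJT hJsep hJcov using hnet
  refine (measure_iUnion_le T).trans ?_
  refine ENNReal.tsum_le_of_sum_range_le (fun N => ?_)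
  have hTk : ∀ k, μ (T k) ≤ ∑ x ∈ J k, ENNReal.ofReal (al k x) * ENNReal.ofReal ((r0 / 2 ^ (k + 1)) ^ Module.finrank ℝ F) := by
    intro k
    calc μ (T k) ≤ μ (⋃ x ∈ J k, closedBall x (r0 / 2 ^ (k + 1) / 2)) := by
          apply measure_mono
          intro y hy
          obtain ⟨j, hj, hyj⟩ := hJcov k y hy
          refine mem_iUnion₂.2 ⟨j, hj, ?_⟩
          rw [mem_closedBall, dist_eq_norm]
          exact hyj.le
      _ ≤ ∑ x ∈ J k, μ (closedBall x (r0 / 2 ^ (k + 1) / 2)) := measure_biUnion_finset_le _ _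
      _ ≤ _ := by
          apply Finset.sum_le_sum
          intro x hx
          rw [← ENNReal.ofReal_mul (hal _ _)]
          exact h k x (hJT k hx)
  let s : Finset (ℕ × X) := (Finset.range N).biUnion (fun k => (J k).image (fun x => (k, x)))
  have hs : ∀ i : ℕ × X, i ∈ s ↔ i.1 < N ∧ i.2 ∈ J i.1 := by
    rintro ⟨k, x⟩
    simp only [s, Finset.mem_biUnion, Finset.mem_image, Finset.mem_range, Prod.mk.injEq]
    constructor
    · rintro ⟨a, ha, b, hb, rfl, rfl⟩; exact ⟨ha, hb⟩
    · rintro ⟨ha, hb⟩; exact ⟨k, ha, x, hb, rfl, rfl⟩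
  have hsum : ∀ φ : ℕ × X → ℝ≥0∞, ∑ k ∈ Finset.range N, ∑ x ∈ J k, φ (k, x) = ∑ i ∈ s, φ i := by
    intro φ
    rw [Finset.sum_biUnion]
    · apply Finset.sum_congr rfl
      intro k _
      rw [Finset.sum_image]
      intro a _ b _ hab
      exact (Prod.mk.inj hab).2
    · intro k _ m _ hkm
      simp only [Function.onFun]
      rw [Finset.disjoint_left]
      intro i hi hi'
      obtain ⟨a, _, rfl⟩ := Finset.mem_image.1 hi
      obtain ⟨b, _, hb⟩ := Finset.mem_image.1 hi'
      exact hkm (Prod.mk.inj hb).1.symm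
  calc ∑ k ∈ Finset.range N, μ (T k) ≤ ∑ k ∈ Finset.range N, ∑ x ∈ J k, ENNReal.ofReal (al k x) * ENNReal.ofReal ((r0 / 2 ^ (k + 1)) ^ Module.finrank ℝ F) :=
        Finset.sum_le_sum (fun k _ => hTk k)
    _ = ∑ i ∈ s, ENNReal.ofReal (al i.1 i.2) * ENNReal.ofReal ((r0 / 2 ^ (i.1 + 1)) ^ Module.finrank ℝ F) :=
        hsum (fun i => ENNReal.ofReal (al i.1 i.2) * ENNReal.ofReal ((r0 / 2 ^ (i.1 + 1)) ^ Module.finrank ℝ F))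
    _ ≤ _ := by
      refine pack s u (fun i => r0 / 2 ^ (i.1 + 1)) _ _ u0 (13 * r0) (by positivity)
            (fun i _ => hpos _) (fun i hi => ?_) (fun v => ?_)
      · have h1 := (hu i (hJT _ ((hs i).1 hi).2)).2
        have h2 := hle i.1
        linarith
      · set s' := s.filter (fun i => ‖v - u i‖ < r0 / 2 ^ (i.1 + 1)) with hs'
        rcases s'.eq_empty_or_nonempty with h0 | hne
        · rw [h0]; simp
        obtain ⟨m, hm, hmax⟩ := s'.exists_max_image (fun i => i.1) hne
        have hin : ∀ i ∈ s', i.2 ∈ J i.1 ∧ i.2 ∈ T i.1 := fun i hi => 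
          have := ((hs i).1 (Finset.mem_filter.1 hi).1).2
          ⟨this, hJT _ this⟩
        have key : ∀ i ∈ s', ‖i.2 - f v‖ ≤ 10 * (r0 / 2 ^ (i.1 + 1)) := by
          intro i hi
          have h1 := (hu i (hin i hi).2).1
          have h3 := hf.dist_le_mul v (u i)
          rw [dist_eq_norm, dist_eq_norm] at h3
          rw [h2] at h1
          have h4 := tri2 i.2 (f (u i)) (f v)
          have := (Finset.mem_filter.1 hi).2
          simp at h3
          linarith
        have hal2 : ∀ i ∈ s', al i.1 i.2 ≤ g i.1 m.2 := by
          intro i hi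
          refine hag i.1 m.1 (hmax i hi) i.2 (hin i hi).2 m.2 (hin m hm).2 ?_
          have h1 := key i hi
          have h3 := key m hm
          have h4 := hanti _ _ (hmax i hi)
          have h5 := tri3 i.2 (f v) m.2
          linarith
        rw [← ENNReal.ofReal_sum_of_nonneg (fun i _ => hal _ _)]
        apply ENNReal.ofReal_le_ofReal
        have hmaps : ∀ i ∈ s', i.1 ∈ Finset.range (m.1 + 1) := fun i hi => 
          Finset.mem_range.2 (Nat.lt_succ_of_le (hmax i hi))
        calc ∑ i ∈ s', al i.1 i.2 ≤ ∑ i ∈ s', g i.1 m.2 := Finset.sum_le_sum hal2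
          _ = ∑ k ∈ Finset.range (m.1 + 1), ∑ i ∈ s' with i.1 = k, g i.1 m.2 := 
              (Finset.sum_fiberwise_of_maps_to hmaps _).symm
          _ ≤ ∑ k ∈ Finset.range (m.1 + 1), 41 ^ Module.finrank ℝ X * g k m.2 := by
              apply Finset.sum_le_sum
              intro k _
              have e : ∑ i ∈ s' with i.1 = k, g i.1 m.2 = ∑ i ∈ s' with i.1 = k, g k m.2 := by
                apply Finset.sum_congr rfl
                intro i hi
                rw [(Finset.mem_filter.1 hi).2]
              rw [e, Finset.sum_const, nsmul_eq_mul]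
              apply mul_le_mul_of_nonneg_right _ (hg _ _)
              have := card_separated (s'.filter (fun i => i.1 = k)) (fun i => i.2) (f v) (10 * (r0 / 2 ^ (k + 1))) (r0 / 2 ^ (k + 1) / 2)
                (by have := hpos k; positivity) (by have := hpos k; positivity) ?_ ?_
              · have hp := hpos k
                have e2 : 1 + 2 * (10 * (r0 / 2 ^ (k + 1))) / (r0 / 2 ^ (k + 1) / 2) = 41 := by
                  field_simp; norm_num
                rwa [e2] at this
              · intro i hi
                obtain ⟨hi1, hi2⟩ := Finset.mem_filter.1 hi
                rw [← hi2]
                exact key i hi1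
              · intro i hi j hj hij
                obtain ⟨hi1, hi2⟩ := Finset.mem_filter.1 hi
                obtain ⟨hj1, hj2⟩ := Finset.mem_filter.1 hj
                have h1 := (hin i hi1).1
                have h3 := (hin j hj1).1
                rw [hi2] at h1
                rw [hj2] at h3
                refine hJsep k _ h1 _ h3 (fun h => hij (Prod.ext (hi2.trans hj2.symm) h))
          _ = 41 ^ Module.finrank ℝ X * ∑ k ∈ Finset.range (m.1 + 1), g k m.2 := by rw [Finset.mul_sum]
          _ ≤ _ := by
              have := hgs m.1 m.2 (hin m hm).2
              gcongr

end stopping_time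
end AT

namespace AT

/-- Data for the core construction. -/
structure Dat (n : ℕ) (X : Type*) [NormedAddCommGroup X] [InnerProductSpace ℝ X] [FiniteDimensional ℝ X]
    [MeasurableSpace X] [BorelSpace X] where
  μ : Measure X
  E : Set X
  xs : X
  xsE : xs ∈ E
  r0 : ℝ
  r0_pos : 0 < r0
  bdd : ∀ x ∈ E, ‖x - xs‖ ≤ r0
  C0 : ℝ
  growth : ∀ x ∈ E, ∀ s, 0 < s → s ≤ 4096 * r0 → μ (closedBall x s) ≤ ENNReal.ofReal (C0 * s ^ n)
  c : ℕ → X → X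
  V : ℕ → X → Submodule ℝ X
  hV : ∀ k, ∀ x ∈ E, Module.finrank ℝ (V k x) = n
  c0 : X
  V0 : Submodule ℝ X
  h0c : ∀ x ∈ E, c 0 x = c0
  h0V : ∀ x ∈ E, V 0 x = V0
  al : ℕ → X → ℝ
  g : ℕ → X → ℝ
  al_nonneg : ∀ k x, 0 ≤ al k x
  g_pos : ∀ k x, 0 < g k x
  int : ∀ x ∈ E, ∀ k, ∫⁻ y in closedBall x (400 * (r0 / 2 ^ k)), ENNReal.ofReal (‖y - pr (c k x) (V k x) y‖ ^ 2) ∂μ ≤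
    ENNReal.ofReal (al k x * (r0 / 2 ^ k) ^ (n + 2))
  al_g : ∀ k, ∀ x ∈ E, ∀ x' ∈ E, ‖x - x'‖ ≤ 100 * (r0 / 2 ^ k) → al k x' ≤ g k x
  al_g' : ∀ k, ∀ x ∈ E, ∀ x' ∈ E, ‖x - x'‖ ≤ 100 * (r0 / 2 ^ k) → al k x' ≤ g (k + 1) x
  δ : ℝ
  g_sum : ∀ x ∈ E, ∀ k, ∑ l ∈ Finset.range k, g l x ≤ δ

namespace Dat
variable {n : ℕ} {X : Type*} [NormedAddCommGroup X] [InnerProductSpace ℝ X] [FiniteDimensional ℝ X]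
    [MeasurableSpace X] [BorelSpace X] (D : Dat n X)

/-- The stopping-time sets. -/
def S (τ : ℝ) (k : ℕ) : Set X := {x | x ∈ D.E ∧ ∀ l ≤ k,
  ENNReal.ofReal (τ * (D.r0 / 2 ^ l) ^ n) ≤ D.μ (D.E ∩ closedBall x (200 * (D.r0 / 2 ^ l))) ∧
  ‖x - pr (D.c l x) (D.V l x) x‖ ≤ D.r0 / 2 ^ l}

theorem S_E {τ : ℝ} {k : ℕ} {x : X} (h : x ∈ D.S τ k) : x ∈ D.E := h.1

theorem rpos (k : ℕ) : 0 < D.r0 / 2 ^ k := by have := D.r0_pos; positivity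

theorem rle (k : ℕ) : D.r0 / 2 ^ k ≤ D.r0 := 
    div_le_self D.r0_pos.le (one_le_pow₀ (by norm_num))

theorem δ_pos : 0 < D.δ := by
  have := D.g_sum D.xs D.xsE 1
  simp at this
  linarith [D.g_pos 0 D.xs]

theorem C0_pos_growth (hC : 0 < D.C0) (k : ℕ) (y : X) (t : ℝ) (ht : 0 < t) (ht1 : t ≤ 5 * (200 * (D.r0 / 2 ^ k))) :
    (D.μ.restrict D.E) (closedBall y t) ≤ ENNReal.ofReal (2 ^ n * D.C0 * t ^ n) := by
  rw [Measure.restrict_apply measurableSet_closedBall]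
  by_cases h : (closedBall y t ∩ D.E).Nonempty
  · obtain ⟨z, hz1, hz2⟩ := h
    calc _ ≤ D.μ (closedBall z (2 * t)) := by
          apply measure_mono
          rintro w ⟨hw, _⟩
          rw [mem_closedBall] at *
          linarith [dist_triangle_right w z y]
      _ ≤ _ := by
          have := D.rle k
          refine (D.growth z hz2 (2 * t) (by positivity) (by linarith)).trans (le_of_eq ?_)
          congr 1; ring
  · rw [not_nonempty_iff_eq_empty] at h
    rw [h]; simp

theorem close_planes (hn : 1 ≤ n) {τ C : ℝ}
    (hC0 : 0 < D.C0)
    (hC : ∀ (ν : Measure X) (x : X) (r b : ℝ) (c c' : X) (V V' : Submodule ℝ X), 0 < r → 0 < b →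
    (∀ y, ∀ t, 0 < t → t ≤ 5 * r → ν (closedBall y t) ≤ ENNReal.ofReal (2 ^ n * D.C0 * t ^ n)) →
    ENNReal.ofReal (τ / 200 ^ n * r ^ n) ≤ ν (closedBall x r) →
    Module.finrank ℝ V = n → Module.finrank ℝ V' = n →
    ∫⁻ y in closedBall x r, ENNReal.ofReal (‖y - pr c V y‖ ^ 2) ∂ν ≤ ENNReal.ofReal (b ^ 2 * r ^ (n + 2)) →
    ∫⁻ y in closedBall x r, ENNReal.ofReal (‖y - pr c' V' y‖ ^ 2) ∂ν ≤ ENNReal.ofReal (b ^ 2 * r ^ (n + 2)) →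
    (∀ v, ‖V.starProjection v - V'.starProjection v‖ ≤ C * b * ‖v‖) ∧ ‖pr c V x - pr c' V' x‖ ≤ C * b * r)
    (hCpos : 0 < C) {k l l' m : ℕ} {x y y' : X} (hx : x ∈ D.S τ k) (hy : y ∈ D.E) (hy' : y' ∈ D.E)
    (hl : closedBall x (200 * (D.r0 / 2 ^ k)) ⊆ closedBall y (400 * (D.r0 / 2 ^ l))) (hkl : k ≤ l)
    (hl' : closedBall x (200 * (D.r0 / 2 ^ k)) ⊆ closedBall y' (400 * (D.r0 / 2 ^ l'))) (hkl' : k ≤ l')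
    (ha : D.al l y ≤ D.g m x) (ha' : D.al l' y' ≤ D.g m x) :
    (∀ v, ‖(D.V l y).starProjection v - (D.V l' y').starProjection v‖ ≤ 200 * C * √(D.g m x) * ‖v‖) ∧
    ‖pr (D.c l y) (D.V l y) x - pr (D.c l' y') (D.V l' y') x‖ ≤ 200 * C * √(D.g m x) * (D.r0 / 2 ^ k) := by
  have hg := D.g_pos m x
  have hr := D.rpos k
  have hinta : ∀ l y, k ≤ l → y ∈ D.E → D.al l y ≤ D.g m x → closedBall x (200 * (D.r0 / 2 ^ k)) ⊆ closedBall y (400 * (D.r0 / 2 ^ l)) →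
    ∫⁻ z in closedBall x (200 * (D.r0 / 2 ^ k)), ENNReal.ofReal (‖z - pr (D.c l y) (D.V l y) z‖ ^ 2) ∂(D.μ.restrict D.E) ≤
      ENNReal.ofReal (√(D.g m x) ^ 2 * (200 * (D.r0 / 2 ^ k)) ^ (n + 2)) := by
    intro l y hkl hy hal hsub
    calc _ ≤ ∫⁻ z in closedBall y (400 * (D.r0 / 2 ^ l)), ENNReal.ofReal (‖z - pr (D.c l y) (D.V l y) z‖ ^ 2) ∂D.μ := by
          refine lintegral_mono' ?_ le_rfl
          exact Measure.restrict_mono hsub Measure.restrict_le_self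
      _ ≤ _ := D.int y hy l
      _ ≤ _ := by
          apply ENNReal.ofReal_le_ofReal
          rw [Real.sq_sqrt hg.le]
          have h1 : D.r0 / 2 ^ l ≤ D.r0 / 2 ^ k := by
            have := D.r0_pos
            gcongr
            norm_num
          have h2 := D.rpos l
          apply mul_le_mul hal _ (by positivity) hg.le
          gcongr
          linarith
  have := hC (D.μ.restrict D.E) x (200 * (D.r0 / 2 ^ k)) (√(D.g m x)) (D.c l y) (D.c l' y') (D.V l y) (D.V l' y')
    (by positivity) (Real.sqrt_pos.2 hg) (D.C0_pos_growth hC0 k) ?_ (D.hV _ _ hy) (D.hV _ _ hy') (hinta l y hkl hy ha hl) (hinta l' y' hkl' hy' ha' hl')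
  · refine ⟨fun v => (this.1 v).trans ?_, this.2.trans (le_of_eq (by ring))⟩
    have : 0 ≤ C * √(D.g m x) * ‖v‖ := by positivity
    linarith
  · rw [Measure.restrict_apply measurableSet_closedBall, inter_comm]
    refine le_trans (le_of_eq ?_) (hx.2 k le_rfl).1
    congr 1
    rw [mul_pow]; field_simp

theorem ball_sub {k : ℕ} {x y : X} (h : ‖x - y‖ ≤ 100 * (D.r0 / 2 ^ k)) :
    closedBall x (200 * (D.r0 / 2 ^ k)) ⊆ closedBall y (400 * (D.r0 / 2 ^ k)) := by
  apply closedBall_subset_closedBall'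
  rw [dist_eq_norm]
  linarith [D.rpos k]

theorem ball_sub' (k : ℕ) (x : X)  :
    closedBall x (200 * (D.r0 / 2 ^ k)) ⊆ closedBall x (400 * (D.r0 / 2 ^ (k + 1))) := by
  apply closedBall_subset_closedBall
  rw [pow_succ]
  apply le_of_eq
  field_simp
  ring

/-- Existence of the Lipschitz parametrization. -/
theorem exists_param (hn : 1 ≤ n) (C0 τ : ℝ) (hC0 : 0 < C0) (hτ : 0 < τ) : ∃ δ0 > 0, ∀ D : Dat n X, D.C0 = C0 → D.δ ≤ δ0 →
    ∃ f : D.V0 → X, LipschitzWith 2 f ∧ ∀ k, ∀ x ∈ D.S τ k, ∃ u : D.V0, ‖f u - x‖ ≤ 4 * (D.r0 / 2 ^ k) ∧ ‖D.c0 + (u : X) - x‖ ≤ 5 * D.r0 := by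
  obtain ⟨C, hCpos, hC⟩ := close (H := X) hn (2 ^ n * C0) (τ / 200 ^ n) (by positivity) (by positivity)
  have hK : 0 < Kay X := by linarith [Kay_ge X, Cone_ge X]
  refine ⟨(1 / (8 * Kay X * (200 * C))) ^ 2, by positivity, ?_⟩
  rintro D rfl hδ
  have hanti : ∀ k, D.S τ (k + 1) ⊆ D.S τ k := fun k x hx => ⟨hx.1, fun l hl => hx.2 l (hl.trans k.le_succ)⟩
  have hsq : √D.δ ≤ 1 / (8 * Kay X * (200 * C)) := by
    rw [← Real.sqrt_sq (show 0 ≤ 1 / (8 * Kay X * (200 * C)) by positivity)]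
    exact Real.sqrt_le_sqrt hδ
  have hself : ∀ k (x : X), ‖x - x‖ ≤ 100 * (D.r0 / 2 ^ k) := fun k x => by
    rw [sub_self, norm_zero]; have := D.rpos k; positivity
  let G : Geo X := 
    { r0 := D.r0
      r0_pos := D.r0_pos
      E := D.S τ
      c := D.c
      V := D.V
      b := fun k x => 200 * C * √(D.g k x)
      c0 := D.c0
      V0 := D.V0
      xs := D.xs
      ε := 200 * C * √D.δ
      ε_nonneg := by positivity
      hε := by
        calc Kay X * (200 * C * √D.δ) ≤ Kay X * (200 * C * (1 / (8 * Kay X * (200 * C)))) := by gcongr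
          _ = 1 / 8 := by field_simp
      anti := hanti
      bdd := fun x hx => D.bdd x hx.1
      b_nonneg := fun k x => by positivity
      b_sum := by
        intro k x hx
        calc ∑ l ∈ Finset.range (k + 1), (200 * C * √(D.g l x)) ^ 2 = (200 * C) ^ 2 * ∑ l ∈ Finset.range (k + 1), D.g l x := by
              rw [Finset.mul_sum]
              apply Finset.sum_congr rfl
              intro l _
              rw [mul_pow, Real.sq_sqrt (D.g_pos l x).le]
          _ ≤ (200 * C) ^ 2 * D.δ := by
              have := D.g_sum x hx.1 (k + 1)
              gcongr
          _ = _ := by rw [mul_pow _ (√D.δ), Real.sq_sqrt D.δ_pos.le]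
      h0c := fun x hx => D.h0c x hx.1
      h0V := fun x hx => D.h0V x hx.1
      h1 := fun k x hx => (hx.2 k le_rfl).2
      h2 := by
        intro k x hx x' hx' hxx
        have hr := D.rpos k
        have h' : ‖x - x'‖ ≤ 100 * (D.r0 / 2 ^ k) := by linarith
        exact D.close_planes hn hC0 hC hCpos hx hx.1 hx'.1 (D.ball_sub (hself k x)) le_rfl (D.ball_sub h') le_rfl
          (D.al_g k x hx.1 x hx.1 (hself k x)) (D.al_g k x hx.1 x' hx'.1 h')
      h2' := by
        intro k x hx x' hx' hxx
        have hr := D.rpos k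
        have h' : ‖x - x'‖ ≤ 100 * (D.r0 / 2 ^ k) := by linarith
        exact D.close_planes hn hC0 hC hCpos (hanti k hx) hx.1 hx'.1 (D.ball_sub (hself k x)) le_rfl (D.ball_sub h') le_rfl
          (D.al_g' k x hx.1 x hx.1 (hself k x)) (D.al_g' k x hx.1 x' hx'.1 h')
      h3 := by
        intro k x hx
        exact D.close_planes hn hC0 hC hCpos (hanti k hx) hx.1 hx.1 (D.ball_sub (hself k x)) le_rfl (D.ball_sub' k x) k.le_succ
          (D.al_g' k x hx.1 x hx.1 (hself k x)) (D.al_g (k + 1) x hx.1 x hx.1 (hself (k + 1) x)) }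
  exact G.main

end Dat
end AT

namespace AT
namespace Dat
variable {n : ℕ} {X : Type*} [NormedAddCommGroup X] [InnerProductSpace ℝ X] [FiniteDimensional ℝ X]
    [MeasurableSpace X] [BorelSpace X] (D : Dat n X)

theorem cheb {k : ℕ} {x : X} (hx : x ∈ D.E) (ρ : ℝ) (hρ : 0 < ρ) (A : Set X)
    (hA : A ⊆ closedBall x (400 * (D.r0 / 2 ^ k))) (h : ∀ y ∈ A, ρ ≤ ‖y - pr (D.c k x) (D.V k x) y‖) :
    D.μ A ≤ ENNReal.ofReal (D.al k x * (D.r0 / 2 ^ k) ^ (n + 2) / ρ ^ 2) := by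
  set φ : X → ℝ≥0∞ := fun y => ENNReal.ofReal (‖y - pr (D.c k x) (D.V k x) y‖ ^ 2) with hφ
  have hm : Measurable φ := by
    have : Continuous (fun y => ‖y - pr (D.c k x) (D.V k x) y‖ ^ 2) := by
      have := pr_cont (D.c k x) (D.V k x)
      fun_prop
    exact this.measurable.ennreal_ofReal
  have h1 := mul_meas_ge_le_lintegral (μ := D.μ.restrict (closedBall x (400 * (D.r0 / 2 ^ k)))) hm (ENNReal.ofReal (ρ ^ 2))
  have h2 : D.μ A ≤ (D.μ.restrict (closedBall x (400 * (D.r0 / 2 ^ k)))) {y | ENNReal.ofReal (ρ ^ 2) ≤ φ y} := by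
    refine le_trans (measure_mono ?_) (Measure.le_restrict_apply _ _)
    intro y hy
    refine ⟨?_, hA hy⟩
    apply ENNReal.ofReal_le_ofReal
    have := h y hy
    gcongr
  have h3 := h1.trans (D.int x hx k)
  rw [ENNReal.ofReal_div_of_pos (by positivity)]
  rw [ENNReal.le_div_iff_mul_le (Or.inl (by simpa using by positivity)) (Or.inl ENNReal.ofReal_ne_top), mul_comm]
  exact (mul_le_mul_right h2 _).trans h3

theorem range_sub {τ : ℝ} (f : D.V0 → X) (hf : LipschitzWith 2 f)
    (h : ∀ k, ∀ x ∈ D.S τ k, ∃ u : D.V0, ‖f u - x‖ ≤ 4 * (D.r0 / 2 ^ k) ∧ ‖D.c0 + (u : X) - x‖ ≤ 5 * D.r0) :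
    (⋂ k, D.S τ k) ⊆ D.E ∩ range f := by
  intro x hx
  rw [mem_iInter] at hx
  refine ⟨(hx 0).1, ?_⟩
  have hc : IsClosed (f '' closedBall 0 (5 * D.r0 + ‖x - D.c0‖)) :=
    ((isCompact_closedBall _ _).image hf.continuous).isClosed
  suffices x ∈ f '' closedBall 0 (5 * D.r0 + ‖x - D.c0‖) from image_subset_range _ _ this
  rw [← hc.closure_eq, Metric.mem_closure_iff]
  intro ε hε
  obtain ⟨k, hk⟩ := exists_pow_lt_of_lt_one (show 0 < ε / (4 * D.r0) by have := D.r0_pos; positivity) (show (1 / 2 : ℝ) < 1 by norm_num)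
  obtain ⟨u, hu1, hu2⟩ := h k x (hx k)
  refine ⟨f u, ⟨u, ?_, rfl⟩, ?_⟩
  · rw [mem_closedBall, dist_zero_right, ← Submodule.norm_coe]
    have : (u : X) = (D.c0 + (u : X) - x) + (x - D.c0) := by abel
    rw [this]
    exact (norm_add_le _ _).trans (by linarith)
  · rw [dist_comm, dist_eq_norm]
    have := D.r0_pos
    rw [lt_div_iff₀ (by positivity)] at hk
    calc _ ≤ _ := hu1
      _ = (1 / 2) ^ k * (4 * D.r0) := by rw [div_pow, one_pow]; ring
      _ < ε := hk

theorem core (hn : 1 ≤ n) (C0 c0 : ℝ) (hC0 : 0 < C0) (hc0 : 0 < c0) : ∃ δ0 > 0, ∀ D : Dat n X, D.C0 = C0 → D.δ ≤ δ0 →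
    ENNReal.ofReal (c0 * D.r0 ^ n) ≤ D.μ D.E → 
    ∃ f : D.V0 → X, LipschitzWith 2 f ∧ 0 < D.μ (D.E ∩ range f) := by
  set τ : ℝ := c0 / (4 * 13 ^ n) with hτ
  have hτpos : 0 < τ := by positivity
  obtain ⟨δ0, hδ0, hpar⟩ := exists_param (X := X) hn C0 τ hC0 hτpos
  set Q : ℝ := 4 * 41 ^ Module.finrank ℝ X * 13 ^ n with hQ
  have hQpos : 0 < Q := by positivity
  refine ⟨min δ0 (c0 / (4 * (1 + Q))), lt_min hδ0 (by positivity), ?_⟩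
  intro D hDC hδ hmass
  obtain ⟨f, hf, hfS⟩ := hpar D hDC (hδ.trans (min_le_left _ _))
  have hδ2 : D.δ * (1 + Q) ≤ c0 / 4 := by
    have := hδ.trans (min_le_right _ _)
    rw [le_div_iff₀ (by positivity)] at this
    linarith
  have hδpos := D.δ_pos
  refine ⟨f, hf, ?_⟩
  have hr0 := D.r0_pos
  have hV0 : Module.finrank ℝ D.V0 = n := by
    have := D.hV 0 D.xs D.xsE
    rwa [D.h0V D.xs D.xsE] at this
  by_contra hzero
  rw [not_lt, nonpos_iff_eq_zero] at hzero
  let u0 : D.V0 := ⟨D.V0.starProjection (D.xs - D.c0), Submodule.starProjection_apply_mem _ _⟩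
  have hU : ∀ k, ∀ x ∈ D.S τ k, ∃ u : D.V0, ‖f u - x‖ ≤ 4 * (D.r0 / 2 ^ k) ∧ ‖u - u0‖ ≤ 6 * D.r0 := by
    intro k x hx
    obtain ⟨u, hu1, hu2⟩ := hfS k x hx
    refine ⟨u, hu1, ?_⟩
    have e : ((u - u0 : D.V0) : X) = D.V0.starProjection (D.c0 + (u : X) - D.xs) := by
      have h1 : D.V0.starProjection (u : X) = u := Submodule.starProjection_eq_self_iff.2 u.2
      have h2 : D.c0 + (u : X) - D.xs = u - (D.xs - D.c0) := by abel
      rw [h2, map_sub, h1]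
      simp [u0]
    rw [← Submodule.norm_coe, e]
    refine (norm_proj_le _ _).trans ?_
    have := D.bdd x hx.1
    have := tri0 (D.c0 + (u : X)) x D.xs
    linarith
  set T1 : ℕ → Set X := fun k => {x | x ∈ D.S τ k ∧ 
    D.μ (D.E ∩ closedBall x (200 * (D.r0 / 2 ^ (k + 1)))) < ENNReal.ofReal (τ * (D.r0 / 2 ^ (k + 1)) ^ n)} with hT1
  set T2 : ℕ → Set X := fun k => {x | x ∈ D.S τ k ∧ 
    D.r0 / 2 ^ (k + 1) < ‖x - pr (D.c (k + 1) x) (D.V (k + 1) x) x‖} with hT2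
  set B : Set X := {x | x ∈ D.E ∧ D.r0 < ‖x - pr (D.c 0 x) (D.V 0 x) x‖} with hB
  have hcover : D.E ⊆ (D.E ∩ range f) ∪ B ∪ (⋃ k, T1 k) ∪ (⋃ k, T2 k) := by
    intro x hx
    by_contra hno
    simp only [mem_union, not_or] at hno
    obtain ⟨⟨⟨h1, h2⟩, h3⟩, h4⟩ := hno
    apply h1
    apply D.range_sub f hf hfS
    rw [mem_iInter]
    intro k
    induction k with
    | zero =>
      refine ⟨hx, fun l hl => ?_⟩
      obtain rfl : l = 0 := Nat.le_zero.1 hl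
      constructor
      · rw [inter_eq_self_of_subset_left]
        · refine le_trans (ENNReal.ofReal_le_ofReal ?_) hmass
          rw [pow_zero, div_one]
          gcongr
          rw [hτ]
          apply div_le_self hc0.le
          have : (1 : ℝ) ≤ 13 ^ n := one_le_pow₀ (by norm_num)
          linarith
        · intro y hy
          rw [mem_closedBall, dist_eq_norm, pow_zero, div_one]
          have := D.bdd x hx
          have := D.bdd y hy
          have := tri3 y D.xs x
          linarith
      · rw [pow_zero, div_one]
        by_contra hcon
        exact h2 ⟨hx, not_le.1 hcon⟩
    | succ k ih =>
      refine ⟨hx, fun l hl => ?_⟩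
      rcases Nat.lt_or_ge l (k + 1) with hlt | hge
      · exact ih.2 l (Nat.lt_succ_iff.1 hlt)
      · obtain rfl : l = k + 1 := le_antisymm hl hge
        constructor
        · by_contra hcon
          exact h3 (mem_iUnion.2 ⟨k, ih, not_le.1 hcon⟩)
        · by_contra hcon
          exact h4 (mem_iUnion.2 ⟨k, ih, not_le.1 hcon⟩)
  have hBm : D.μ B ≤ ENNReal.ofReal (D.δ * D.r0 ^ n) := by
    refine (D.cheb (k := 0) D.xsE D.r0 hr0 B ?_ ?_).trans (ENNReal.ofReal_le_ofReal ?_)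
    · intro y hy
      rw [mem_closedBall, dist_eq_norm, pow_zero, div_one]
      have := D.bdd y hy.1
      linarith
    · intro y hy
      rw [D.h0c _ D.xsE, D.h0V _ D.xsE]
      have := hy.2
      rw [D.h0c _ hy.1, D.h0V _ hy.1] at this
      exact this.le
    · have h1 := D.al_g 0 D.xs D.xsE D.xs D.xsE (by rw [sub_self, norm_zero]; have := D.rpos 0; positivity)
      have h2 := D.g_sum D.xs D.xsE 1
      simp only [Finset.sum_range_one] at h2
      have e : D.al 0 D.xs * (D.r0 / 2 ^ 0) ^ (n + 2) / D.r0 ^ 2 = D.al 0 D.xs * D.r0 ^ n := by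
        rw [pow_zero, div_one, pow_add, ← mul_assoc, mul_div_assoc, div_self (by positivity), mul_one]
      rw [e]
      gcongr
      linarith
  have hT1m : D.μ (⋃ k, T1 k) ≤ ENNReal.ofReal (τ * (13 * D.r0) ^ n) := by
    have := packT1 D.μ D.E T1 f hf D.r0 τ hr0 u0 (fun k x hx => hU k x hx.1) (fun k x hx => hx.1.1) (by
      intro k x hx
      rw [hV0, ← ENNReal.ofReal_mul hτpos.le]
      exact hx.2.le)
    rwa [hV0, ← ENNReal.ofReal_mul hτpos.le] at this
  have hT2m : D.μ (⋃ k, T2 k) ≤ ENNReal.ofReal (41 ^ Module.finrank ℝ X * (4 * D.δ) * (13 * D.r0) ^ n) := by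
    have := packT2 D.μ T2 f hf D.r0 (4 * D.δ) hr0 (by positivity) u0 D.xs D.r0 
      (fun k x => 4 * D.al (k + 1) x) (fun k x => 4 * D.g (k + 1) x) 
      (fun k x => by have := D.al_nonneg (k + 1) x; positivity) (fun k x => by have := D.g_pos (k + 1) x; positivity)
      (fun k x hx => D.bdd x hx.1.1) (fun k x hx => hU k x hx.1) ?_ ?_ ?_
    · rwa [hV0, ← ENNReal.ofReal_mul (by positivity)] at this
    · intro k x hx
      have hr := D.rpos (k + 1)
      refine (D.cheb (k := k + 1) hx.1.1 (D.r0 / 2 ^ (k + 1) / 2) (by positivity) _ ?_ ?_).trans (ENNReal.ofReal_le_ofReal (le_of_eq ?_))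
      · apply closedBall_subset_closedBall
        linarith
      · intro y hy
        rw [mem_closedBall, dist_eq_norm] at hy
        have h1 := pr_min (D.c (k + 1) x) (D.V (k + 1) x) x y
        have h2 := tri2 x y (pr (D.c (k + 1) x) (D.V (k + 1) x) y)
        have h3 := hx.2
        rw [norm_sub_rev _ y] at h2
        linarith
      · rw [hV0]
        generalize D.r0 / 2 ^ (k + 1) = t at hr ⊢
        rw [pow_add, div_pow]
        field_simp
        ring
    · intro k m hkm x hx x' hx' hxx
      have hr := D.rpos (k + 1)
      have := D.al_g (k + 1) x' hx'.1.1 x hx.1.1 (by rw [norm_sub_rev]; linarith)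
      linarith
    · intro m x hx
      rw [← Finset.mul_sum]
      have := D.g_sum x hx.1.1 (m + 1 + 1)
      rw [Finset.sum_range_succ'] at this
      have := D.g_pos 0 x
      linarith
  have hfinal : D.μ D.E ≤ ENNReal.ofReal (c0 / 2 * D.r0 ^ n) := by
    calc D.μ D.E ≤ D.μ ((D.E ∩ range f) ∪ B ∪ (⋃ k, T1 k) ∪ (⋃ k, T2 k)) := measure_mono hcover
      _ ≤ D.μ (D.E ∩ range f) + D.μ B + D.μ (⋃ k, T1 k) + D.μ (⋃ k, T2 k) := by
          refine (measure_union_le _ _).trans ?_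
          gcongr
          refine (measure_union_le _ _).trans ?_
          gcongr
          exact measure_union_le _ _
      _ ≤ 0 + ENNReal.ofReal (D.δ * D.r0 ^ n) + ENNReal.ofReal (τ * (13 * D.r0) ^ n) + ENNReal.ofReal (41 ^ Module.finrank ℝ X * (4 * D.δ) * (13 * D.r0) ^ n) := by
          gcongr
          exact hzero.le
      _ = ENNReal.ofReal (D.δ * D.r0 ^ n + τ * (13 * D.r0) ^ n + 41 ^ Module.finrank ℝ X * (4 * D.δ) * (13 * D.r0) ^ n) := by
          rw [zero_add, ← ENNReal.ofReal_add (by positivity) (by positivity), ← ENNReal.ofReal_add (by positivity) (by positivity)]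
      _ ≤ _ := by
          apply ENNReal.ofReal_le_ofReal
          have e1 : τ * (13 * D.r0) ^ n = c0 / 4 * D.r0 ^ n := by
            rw [hτ, mul_pow]; field_simp
          have e2 : 41 ^ Module.finrank ℝ X * (4 * D.δ) * (13 * D.r0) ^ n = D.δ * Q * D.r0 ^ n := by
            rw [hQ, mul_pow]; ring
          rw [e1, e2]
          have : 0 < D.r0 ^ n := by positivity
          nlinarith
  have := hmass.trans hfinal
  rw [ENNReal.ofReal_le_ofReal_iff (by positivity)] at this
  have h0 : 0 < D.r0 ^ n := by positivity
  nlinarith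

end Dat
end AT

namespace AT

theorem core_beta {n d : ℕ} (hn : 1 ≤ n) (C0 c0 : ℝ) (hC0 : 0 < C0) (hc0 : 0 < c0) : ∃ η > 0,
    ∀ (μ : Measure (EuclideanSpace ℝ (Fin d))) (E : Set (EuclideanSpace ℝ (Fin d)))
      (xs : EuclideanSpace ℝ (Fin d)) (r0 : ℝ), xs ∈ E → 0 < r0 → (∀ x ∈ E, ‖x - xs‖ ≤ r0) →
      (∀ x ∈ E, ∀ s, 0 < s → s ≤ 4096 * r0 → μ (closedBall x s) ≤ ENNReal.ofReal (C0 * s ^ n)) →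
      ENNReal.ofReal (c0 * r0 ^ n) ≤ μ E →
      (∀ x ∈ E, ∑' k : ℕ, beta2sq n d μ x (2048 * (r0 / 2 ^ k)) ≤ ENNReal.ofReal η) →
      ∃ f : EuclideanSpace ℝ (Fin n) → EuclideanSpace ℝ (Fin d), LipschitzWith 2 f ∧ 0 < μ (E ∩ range f) := by
  classical
  obtain ⟨δ0, hδ0, hcore⟩ := Dat.core (X := EuclideanSpace ℝ (Fin d)) hn C0 c0 hC0 hc0
  set M : ℝ := 512 ^ (n + 2) * (2 * 4 ^ (n + 2)) with hM
  have hMpos : 0 < M := by positivity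
  refine ⟨δ0 / (3 * M), by positivity, ?_⟩
  set η := δ0 / (3 * M) with hη
  have hηpos : 0 < η := by positivity
  intro μ E xs r0 hxs hr0 hbdd hgrow hmass hbeta
  have hrpos : ∀ k : ℕ, 0 < r0 / 2 ^ k := fun k => by positivity
  have hr2 : ∀ k : ℕ, r0 / 2 ^ k = 2 * (r0 / 2 ^ (k + 1)) := fun k => by rw [pow_succ]; field_simp
  have hfin : ∀ x ∈ E, ∀ k, beta2sq n d μ x (2048 * (r0 / 2 ^ k)) ≠ ⊤ := by
    intro x hx k
    exact ne_top_of_le_ne_top ENNReal.ofReal_ne_top ((ENNReal.le_tsum k).trans (hbeta x hx))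
  have hcmp : ∀ z x, x ∈ E → ∀ k l, 512 * (r0 / 2 ^ k) + ‖z - x‖ ≤ 2048 * (r0 / 2 ^ l) → k ≤ l →
      beta2sq n d μ z (512 * (r0 / 2 ^ k)) ≤ ENNReal.ofReal (4 ^ (n + 2)) * beta2sq n d μ x (2048 * (r0 / 2 ^ l)) := by
    intro z x hx k l hkl hle
    have h1 := hrpos k
    have h2 := hrpos l
    refine (beta_mono z x (512 * (r0 / 2 ^ k)) (2048 * (r0 / 2 ^ l)) (by positivity) (by positivity) ?_).trans ?_
    · apply closedBall_subset_closedBall'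
      rw [dist_eq_norm]; exact hkl
    · gcongr
      rw [div_le_iff₀ (by positivity)]
      have : r0 / 2 ^ l ≤ r0 / 2 ^ k := by gcongr; norm_num
      linarith
  have hcmpR : ∀ z x, x ∈ E → ∀ k l, 512 * (r0 / 2 ^ k) + ‖z - x‖ ≤ 2048 * (r0 / 2 ^ l) → k ≤ l →
      (beta2sq n d μ z (512 * (r0 / 2 ^ k))).toReal ≤ 4 ^ (n + 2) * (beta2sq n d μ x (2048 * (r0 / 2 ^ l))).toReal := by
    intro z x hx k l hkl hle
    have h1 := ENNReal.toReal_mono (ENNReal.mul_ne_top ENNReal.ofReal_ne_top (hfin x hx l)) (hcmp z x hx k l hkl hle)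
    rwa [ENNReal.toReal_mul, ENNReal.toReal_ofReal (by positivity)] at h1
  have hfin' : ∀ x ∈ E, ∀ k, beta2sq n d μ x (512 * (r0 / 2 ^ k)) ≠ ⊤ := by
    intro x hx k
    refine ne_top_of_le_ne_top (ENNReal.mul_ne_top ENNReal.ofReal_ne_top (hfin x hx k)) (hcmp x x hx k k ?_ le_rfl)
    rw [sub_self, norm_zero]
    linarith [hrpos k]
  let A : ℕ → EuclideanSpace ℝ (Fin d) → ℝ := fun k x => (beta2sq n d μ x (512 * (r0 / 2 ^ k))).toReal + η / 2 ^ k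
  have hApos : ∀ k x, 0 < A k x := fun k x => by simp only [A]; positivity
  have hplane : ∀ k x, ∃ (c : EuclideanSpace ℝ (Fin d)) (V : Submodule ℝ (EuclideanSpace ℝ (Fin d))), x ∈ E → Module.finrank ℝ V = n ∧
      ∫⁻ y in closedBall x (512 * (r0 / 2 ^ k)), ENNReal.ofReal (‖y - pr c V y‖ ^ 2) ∂μ ≤ ENNReal.ofReal (A k x * (512 * (r0 / 2 ^ k)) ^ (n + 2)) := by
    intro k x
    by_cases hx : x ∈ E
    · obtain ⟨c, V, h1, h2⟩ := exists_plane (μ := μ) hn x (512 * (r0 / 2 ^ k)) (A k x) (by have := hrpos k; positivity) (hApos k x).le (by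
        rw [← ENNReal.ofReal_toReal (hfin' x hx k)]
        apply (ENNReal.ofReal_lt_ofReal_iff (hApos k x)).2
        simp only [A]
        have : 0 < η / 2 ^ k := by positivity
        linarith)
      exact ⟨c, V, fun _ => ⟨h1, h2⟩⟩
    · exact ⟨0, ⊥, fun h => absurd h hx⟩
  choose c V hcV using hplane
  let ctr : ℕ → EuclideanSpace ℝ (Fin d) → EuclideanSpace ℝ (Fin d) := fun k x => if k = 0 then xs else x
  have hctrE : ∀ k, ∀ x ∈ E, ctr k x ∈ E := by
    intro k x hx
    simp only [ctr]
    split_ifs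
    · exact hxs
    · exact hx
  have hctr : ∀ k, ∀ x ∈ E, ‖x - ctr k x‖ ≤ r0 / 2 ^ k := by
    intro k x hx
    simp only [ctr]
    split_ifs with h
    · rw [h, pow_zero, div_one]; exact hbdd x hx
    · rw [sub_self, norm_zero]; exact (hrpos k).le
  let D : Dat n (EuclideanSpace ℝ (Fin d)) := 
    { μ := μ
      E := E
      xs := xs
      xsE := hxs
      r0 := r0
      r0_pos := hr0
      bdd := hbdd
      C0 := C0
      growth := hgrow
      c := fun k x => c k (ctr k x)
      V := fun k x => V k (ctr k x)
      hV := fun k x hx => (hcV k _ (hctrE k x hx)).1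
      c0 := c 0 xs
      V0 := V 0 xs
      h0c := fun x _ => by simp [ctr]
      h0V := fun x _ => by simp [ctr]
      al := fun k x => 512 ^ (n + 2) * A k (ctr k x)
      g := fun k x => M * ((beta2sq n d μ x (2048 * (r0 / 2 ^ k))).toReal + η / 2 ^ k)
      al_nonneg := fun k x => by have := hApos k (ctr k x); positivity
      g_pos := fun k x => by positivity
      int := by
        intro x hx k
        have h1 := hctr k x hx
        have hr := hrpos k
        calc _ ≤ ∫⁻ y in closedBall (ctr k x) (512 * (r0 / 2 ^ k)), ENNReal.ofReal (‖y - pr (c k (ctr k x)) (V k (ctr k x)) y‖ ^ 2) ∂μ := by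
              apply lintegral_mono_set
              apply closedBall_subset_closedBall'
              rw [dist_eq_norm]; linarith
          _ ≤ _ := (hcV k _ (hctrE k x hx)).2
          _ = _ := by congr 1; rw [mul_pow]; ring
      al_g := by
        intro k x hx x' hx' hxx
        have h1 := hctr k x' hx'
        have hr := hrpos k
        have h2 := hcmpR (ctr k x') x hx k k (by
          have := tri1 (ctr k x') x' x
          rw [norm_sub_rev x' x] at this
          linarith) le_rfl
        have h3 : 0 < η / 2 ^ k := by positivity
        have h4 : (0:ℝ) ≤ (beta2sq n d μ x (2048 * (r0 / 2 ^ k))).toReal := ENNReal.toReal_nonneg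
        have h5 : (1:ℝ) ≤ 4 ^ (n + 2) := one_le_pow₀ (by norm_num)
        simp only [A, hM]
        rw [mul_assoc]
        apply mul_le_mul_of_nonneg_left _ (by positivity)
        nlinarith [mul_nonneg (zero_le_one.trans h5) h4, mul_nonneg (sub_nonneg.2 h5) h3.le]
      al_g' := by
        intro k x hx x' hx' hxx
        have h1 := hctr k x' hx'
        have hr := hrpos k
        have h2 := hcmpR (ctr k x') x hx k (k + 1) (by
          have := tri1 (ctr k x') x' x
          rw [norm_sub_rev x' x] at this
          have := hr2 k
          linarith) k.le_succ
        have h3 : 0 < η / 2 ^ (k + 1) := by positivity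
        have h3' : η / 2 ^ k = 2 * (η / 2 ^ (k + 1)) := by rw [pow_succ]; field_simp
        have h4 : (0:ℝ) ≤ (beta2sq n d μ x (2048 * (r0 / 2 ^ (k + 1)))).toReal := ENNReal.toReal_nonneg
        have h5 : (1:ℝ) ≤ 4 ^ (n + 2) := one_le_pow₀ (by norm_num)
        simp only [A, hM]
        rw [mul_assoc, h3']
        apply mul_le_mul_of_nonneg_left _ (by positivity)
        nlinarith [mul_nonneg (zero_le_one.trans h5) h4, mul_nonneg (sub_nonneg.2 h5) h3.le]
      δ := δ0
      g_sum := by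
        intro x hx k
        rw [← Finset.mul_sum, Finset.sum_add_distrib]
        have h1 : ∑ l ∈ Finset.range k, (beta2sq n d μ x (2048 * (r0 / 2 ^ l))).toReal ≤ η := by
          rw [← ENNReal.toReal_sum (fun l _ => hfin x hx l)]
          refine ENNReal.toReal_le_of_le_ofReal hηpos.le ?_
          exact (ENNReal.sum_le_tsum _).trans (hbeta x hx)
        have h2 : ∑ l ∈ Finset.range k, η / 2 ^ l ≤ 2 * η := by
          have h3 := sum_geometric_two_le k
          have : ∑ l ∈ Finset.range k, η / 2 ^ l = η * ∑ l ∈ Finset.range k, (1 / 2 : ℝ) ^ l := by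
            rw [Finset.mul_sum]
            apply Finset.sum_congr rfl
            intro l _
            rw [div_pow, one_pow]; ring
          rw [this]
          nlinarith
        calc _ ≤ M * (η + 2 * η) := by gcongr
          _ = δ0 := by rw [hη]; field_simp; ring }
  obtain ⟨f, hf, hpos⟩ := hcore D rfl le_rfl hmass
  have hdim : Module.finrank ℝ D.V0 = n := (hcV 0 xs hxs).1
  let e : D.V0 ≃ₗᵢ[ℝ] EuclideanSpace ℝ (Fin n) := 
    ((stdOrthonormalBasis ℝ D.V0).reindex (finCongr hdim)).repr
  refine ⟨f ∘ e.symm, ?_, ?_⟩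
  · have := hf.comp e.symm.lipschitz
    rwa [mul_one] at this
  · have : range (f ∘ e.symm) = range f := by
      rw [range_comp, e.symm.surjective.range_eq, image_univ]
    rw [this]
    exact hpos

end AT

namespace AT

section partA
variable {n d : ℕ} {μ : Measure (EuclideanSpace ℝ (Fin d))}

theorem dyadic (x : EuclideanSpace ℝ (Fin d)) (s : ℝ) (hs : 0 < s) :
    ∑' k : ℕ, beta2sq n d μ x (s / 2 ^ k) ≤
      ENNReal.ofReal (2 ^ (n + 3)) * ∫⁻ r in Ioo (0 : ℝ) (2 * s), beta2sq n d μ x r / ENNReal.ofReal r := by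
  have h1 : ∀ k : ℕ, beta2sq n d μ x (s / 2 ^ k) ≤ ENNReal.ofReal (2 ^ (n + 3)) *
      ∫⁻ r in Ioo (s / 2 ^ k) (2 * (s / 2 ^ k)), beta2sq n d μ x r / ENNReal.ofReal r := by
    intro k
    have ht : 0 < s / 2 ^ k := by positivity
    generalize s / 2 ^ k = t at ht
    have h2 : ∀ r ∈ Ioo t (2 * t), beta2sq n d μ x t / ENNReal.ofReal (2 ^ (n + 2) * (2 * t)) ≤ beta2sq n d μ x r / ENNReal.ofReal r := by
      intro r hr
      have hr0 : 0 < r := ht.trans hr.1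
      rw [ENNReal.ofReal_mul (by positivity), ]
      have h3 := beta_mono (n := n) (μ := μ) x x t r ht hr0 (closedBall_subset_closedBall hr.1.le)
      have h4 : beta2sq n d μ x t ≤ ENNReal.ofReal (2 ^ (n + 2)) * beta2sq n d μ x r := by
        refine h3.trans ?_
        gcongr
        rw [div_le_iff₀ ht]; exact hr.2.le
      refine ENNReal.div_le_of_le_mul ?_
      calc beta2sq n d μ x t ≤ ENNReal.ofReal (2 ^ (n + 2)) * beta2sq n d μ x r := h4
        _ = beta2sq n d μ x r / ENNReal.ofReal r * (ENNReal.ofReal (2 ^ (n + 2)) * ENNReal.ofReal r) := by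
            have : beta2sq n d μ x r / ENNReal.ofReal r * ENNReal.ofReal r = beta2sq n d μ x r := 
              ENNReal.div_mul_cancel (by simpa using hr0) ENNReal.ofReal_ne_top
            rw [mul_comm (ENNReal.ofReal (2 ^ (n + 2))) (ENNReal.ofReal r), ← mul_assoc, this, mul_comm]
        _ ≤ _ := by
            gcongr
            exact hr.2.le
    have h5 := setLIntegral_mono' (μ := (volume : Measure ℝ)) measurableSet_Ioo h2
    rw [setLIntegral_const, Real.volume_Ioo] at h5
    calc beta2sq n d μ x t = ENNReal.ofReal (2 ^ (n + 3)) * (beta2sq n d μ x t / ENNReal.ofReal (2 ^ (n + 2) * (2 * t)) * ENNReal.ofReal (2 * t - t)) := by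
          rw [div_eq_mul_inv, ← ENNReal.ofReal_inv_of_pos (by positivity), mul_assoc, ← ENNReal.ofReal_mul (by positivity), mul_left_comm,
            ← ENNReal.ofReal_mul (by positivity)]
          have : (2:ℝ) ^ (n + 3) * ((2 ^ (n + 2) * (2 * t))⁻¹ * (2 * t - t)) = 1 := by
            rw [pow_succ 2 (n + 2)]
            field_simp
            ring
          rw [this]; simp
      _ ≤ _ := by gcongr
  refine (ENNReal.tsum_le_tsum h1).trans ?_
  rw [ENNReal.tsum_mul_left]
  gcongr
  have hanti : ∀ i j : ℕ, i ≤ j → s / 2 ^ j ≤ s / 2 ^ i := by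
    intro i j hij
    gcongr
    norm_num
  rw [← lintegral_iUnion (fun k => measurableSet_Ioo)]
  · apply lintegral_mono_set
    apply iUnion_subset
    intro k r hr
    have h3 := hanti 0 k k.zero_le
    rw [pow_zero, div_one] at h3
    exact ⟨lt_trans (by positivity) hr.1, hr.2.trans_le (by linarith)⟩
  · have key : ∀ i j : ℕ, i < j → Disjoint (Ioo (s / 2 ^ i) (2 * (s / 2 ^ i))) (Ioo (s / 2 ^ j) (2 * (s / 2 ^ j))) := by
      intro i j hij
      rw [Set.disjoint_left]
      intro r hr hr'
      have h3 := hanti (i + 1) j hij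
      have : s / 2 ^ i = 2 * (s / 2 ^ (i + 1)) := by rw [pow_succ]; field_simp
      have := hr.1
      have := hr'.2
      linarith
    intro i j hij
    rcases lt_or_gt_of_ne hij with h | h
    · exact key i j h
    · exact (key j i h).symm

theorem jones_small (F : ℝ → ℝ≥0∞) (h : ∫⁻ r in Ioo (0 : ℝ) 1, F r < ⊤) (ε : ℝ) (hε : 0 < ε) :
    ∀ᶠ m : ℕ in atTop, ∫⁻ r in Ioo (0 : ℝ) (1 / (m + 1)), F r ≤ ENNReal.ofReal ε := by
  have h1 := tendsto_setLIntegral_zero (μ := (volume : Measure ℝ).restrict (Ioo (0:ℝ) 1)) (f := F) h.ne (l := atTop)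
    (s := fun m : ℕ => Ioo (0 : ℝ) (1 / (m + 1))) (by
      have h2 : Tendsto (fun m : ℕ => ENNReal.ofReal (1 / ((m : ℝ) + 1))) atTop (nhds 0) := by
        rw [← ENNReal.ofReal_zero]
        exact ENNReal.tendsto_ofReal tendsto_one_div_add_atTop_nhds_zero_nat
      refine tendsto_of_tendsto_of_tendsto_of_le_of_le tendsto_const_nhds h2 (fun _ => zero_le) (fun m => ?_)
      refine (Measure.restrict_apply_le _ _).trans ?_
      rw [Real.volume_Ioo, sub_zero])
  have h3 := h1.eventually_le_const (show (0:ℝ≥0∞) < ENNReal.ofReal ε by simpa using hε)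
  filter_upwards [h3] with m hm
  rw [Measure.restrict_restrict measurableSet_Ioo, inter_eq_self_of_subset_left] at hm
  · exact hm
  · apply Ioo_subset_Ioo_right
    rw [div_le_one (by positivity)]
    linarith [(Nat.cast_nonneg m : (0:ℝ) ≤ m)]

theorem upper_growth (x : EuclideanSpace ℝ (Fin d)) (h : upperDensity n d μ x < ⊤) :
    ∃ M0 : ℕ, ∀ M ≥ M0, ∀ᶠ m : ℕ in atTop, ∀ s, 0 < s → s ≤ 1 / ((m : ℝ) + 1) →
      μ (closedBall x s) ≤ ENNReal.ofReal (((M : ℝ) + 1) * s ^ n) := by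
  obtain ⟨a, ha1, ha2⟩ := exists_between h
  have h1 := eventually_lt_of_limsup_lt ha1
  obtain ⟨M0, hM0⟩ := exists_nat_ge (a.toReal * 2 ^ n)
  refine ⟨M0, fun M hM => ?_⟩
  rw [eventually_nhdsWithin_iff, Metric.eventually_nhds_iff] at h1
  obtain ⟨ε, hε, h1⟩ := h1
  have h2 := (tendsto_one_div_add_atTop_nhds_zero_nat (𝕜 := ℝ)).eventually_lt_const hε
  filter_upwards [h2] with m hm s hs hsm
  have h3 := h1 (y := s) (by rw [Real.dist_eq, sub_zero, abs_of_pos hs]; linarith) hs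
  rw [ENNReal.div_lt_iff (Or.inl (by simpa using by positivity)) (Or.inl ENNReal.ofReal_ne_top), ← ENNReal.ofReal_toReal ha2.ne, 
    ← ENNReal.ofReal_mul ENNReal.toReal_nonneg] at h3
  refine h3.le.trans (ENNReal.ofReal_le_ofReal ?_)
  rw [mul_pow, ← mul_assoc]
  have : (M0 : ℝ) ≤ M := by exact_mod_cast hM
  gcongr
  linarith

theorem lower_freq (x : EuclideanSpace ℝ (Fin d)) (h : 0 < upperDensity n d μ x) :
    ∃ M0 : ℕ, ∀ M ≥ M0, ∃ᶠ r in nhdsWithin (0:ℝ) (Ioi 0), ENNReal.ofReal (r ^ n / ((M : ℝ) + 1)) ≤ μ (closedBall x r) := by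
  obtain ⟨b, hb0, hb⟩ := exists_between h
  have hbt : b ≠ ⊤ := hb.ne_top
  have hbpos : 0 < b.toReal := ENNReal.toReal_pos hb0.ne' hbt
  have h1 := frequently_lt_of_lt_limsup (by isBoundedDefault) hb
  obtain ⟨M0, hM0⟩ := exists_nat_ge (1 / b.toReal)
  refine ⟨M0, fun M hM => ?_⟩
  refine (h1.and_eventually self_mem_nhdsWithin).mono ?_
  rintro r ⟨hr, hr0⟩
  have hr0 : 0 < r := hr0
  rw [ENNReal.lt_div_iff_mul_lt (Or.inl (by simpa using by positivity)) (Or.inl ENNReal.ofReal_ne_top), ← ENNReal.ofReal_toReal hbt,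
    ← ENNReal.ofReal_mul ENNReal.toReal_nonneg] at hr
  refine le_trans (ENNReal.ofReal_le_ofReal ?_) hr.le
  have hM' : (M0 : ℝ) ≤ M := by exact_mod_cast hM
  rw [div_le_iff₀ (by positivity), mul_pow]
  have h2 : 1 ≤ b.toReal * ((M : ℝ) + 1) := by
    rw [div_le_iff₀ hbpos] at hM0
    nlinarith
  have h3 : (1:ℝ) ≤ 2 ^ n := one_le_pow₀ (by norm_num)
  have h4 : 0 < r ^ n := by positivity
  calc r ^ n = 1 * 1 * r ^ n := by ring
    _ ≤ (b.toReal * ((M : ℝ) + 1)) * 2 ^ n * r ^ n := by gcongr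
    _ = _ := by ring

theorem abscont [IsFiniteMeasure μ] (h : ∀ᵐ x ∂μ, upperDensity n d μ x < ⊤) : μ ≪ μH[(n : ℝ)] := by
  intro N hN
  set A : ℕ → ℕ → Set (EuclideanSpace ℝ (Fin d)) := fun M m => {x | ∀ s, 0 < s → s ≤ 1 / ((m : ℝ) + 1) →
      μ (closedBall x s) ≤ ENNReal.ofReal (((M : ℝ) + 1) * s ^ n)} with hA
  have hcov : N ⊆ {x | ¬ upperDensity n d μ x < ⊤} ∪ ⋃ M, ⋃ m, (N ∩ A M m) := by
    intro x hx
    by_cases hxd : upperDensity n d μ x < ⊤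
    · obtain ⟨M, hM⟩ := upper_growth x hxd
      obtain ⟨m, hm⟩ := (hM M le_rfl).exists
      exact Or.inr (mem_iUnion₂.2 ⟨M, m, hx, hm⟩)
    · exact Or.inl hxd
  refine measure_mono_null hcov (measure_union_null (by simpa using ae_iff.1 h) ?_)
  refine measure_iUnion_null (fun M => measure_iUnion_null (fun m => ?_))
  have hle : ENNReal.ofReal (1 / ((M : ℝ) + 1)) • (μ.restrict (A M m)) ≤ μH[(n : ℝ)] := by
    refine Measure.le_hausdorffMeasure _ _ (ENNReal.ofReal (1 / (2 * ((m : ℝ) + 1)))) (by simpa using by positivity) ?_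
    intro s hs
    have hst : Metric.ediam s ≠ ⊤ := ne_top_of_le_ne_top ENNReal.ofReal_ne_top hs
    set D := (Metric.ediam s).toReal with hD
    have hD0 : 0 ≤ D := ENNReal.toReal_nonneg
    have hDs : D < 1 / ((m : ℝ) + 1) := by
      have h1 : D ≤ 1 / (2 * ((m : ℝ) + 1)) := ENNReal.toReal_le_of_le_ofReal (by positivity) hs
      have h2 : 1 / (2 * ((m : ℝ) + 1)) < 1 / ((m : ℝ) + 1) := by
        apply one_div_lt_one_div_of_lt (by positivity)
        linarith [show (0:ℝ) < (m:ℝ) + 1 by positivity]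
      linarith
    have e1 : Metric.ediam s ^ (n : ℝ) = ENNReal.ofReal (D ^ n) := by
      rw [ENNReal.rpow_natCast, ENNReal.ofReal_pow hD0, hD, ENNReal.ofReal_toReal hst]
    have key : (μ.restrict (A M m)) s ≤ ENNReal.ofReal (((M : ℝ) + 1) * D ^ n) := by
      refine (measure_mono subset_closure).trans ?_
      rw [Measure.restrict_apply isClosed_closure.measurableSet]
      rcases (closure s ∩ A M m).eq_empty_or_nonempty with h0 | ⟨x, hx1, hx2⟩
      · rw [h0]; simp
      have hsub : ∀ t, D < t → t ≤ 1 / ((m : ℝ) + 1) → μ (closure s ∩ A M m) ≤ ENNReal.ofReal (((M : ℝ) + 1) * t ^ n) := by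
        intro t ht1 ht2
        refine le_trans (measure_mono ?_) (hx2 t (hD0.trans_lt ht1) ht2)
        rintro y ⟨hy, _⟩
        have h3 := Metric.edist_le_ediam_of_mem hy hx1
        rw [Metric.ediam_closure, edist_dist] at h3
        rw [mem_closedBall]
        have h4 := (ENNReal.ofReal_le_iff_le_toReal hst).1 h3
        linarith
      have hlim : Tendsto (fun t : ℝ => ENNReal.ofReal (((M : ℝ) + 1) * t ^ n)) (nhdsWithin D (Ioi D)) (nhds (ENNReal.ofReal (((M : ℝ) + 1) * D ^ n))) := by
        apply Tendsto.mono_left _ nhdsWithin_le_nhds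
        apply ENNReal.tendsto_ofReal
        exact Continuous.tendsto (by fun_prop) D
      refine ge_of_tendsto hlim ?_
      filter_upwards [Ioc_mem_nhdsGT hDs] with t ht
      exact hsub t ht.1 ht.2
    rw [e1, Measure.smul_apply, smul_eq_mul]
    calc _ ≤ ENNReal.ofReal (1 / ((M : ℝ) + 1)) * ENNReal.ofReal (((M : ℝ) + 1) * D ^ n) := by gcongr
      _ = _ := by
        rw [← ENNReal.ofReal_mul (by positivity)]
        congr 1
        field_simp
  have h0 := hle N
  rw [hN, Measure.smul_apply, smul_eq_mul, nonpos_iff_eq_zero, mul_eq_zero] at h0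
  rcases h0 with h0 | h0
  · exfalso
    rw [ENNReal.ofReal_eq_zero] at h0
    have : 0 < 1 / ((M : ℝ) + 1) := by positivity
    linarith
  · exact le_antisymm ((Measure.le_restrict_apply _ _).trans h0.le) zero_le

theorem case_zero [IsFiniteMeasure μ] (h : ∀ᵐ x ∂μ, 0 < upperDensity 0 d μ x) :
    ∃ f : ℕ → EuclideanSpace ℝ (Fin 0) → EuclideanSpace ℝ (Fin d),
      (∀ i, ∃ K : NNReal, LipschitzWith K (f i)) ∧
      μ (Set.univ \ ⋃ i, Set.range (f i)) = 0 := by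
  have hc : {x | 0 < μ {x}}.Countable := Measure.countable_meas_pos_of_disjoint_iUnion (fun x => measurableSet_singleton x)
    (fun x y hxy => by simpa using hxy)
  have hc' : ({x | 0 < μ {x}} ∪ {0}).Countable := hc.union (countable_singleton 0)
  obtain ⟨g, hg⟩ := hc'.exists_eq_range ⟨0, Or.inr rfl⟩
  refine ⟨fun i _ => g i, fun i => ⟨0, LipschitzWith.const _⟩, ?_⟩
  refine measure_mono_null ?_ (ae_iff.1 h)
  rintro x ⟨_, hx⟩ hpos
  apply hx
  have hx0 : 0 < μ {x} := by
    by_contra hcon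
    rw [not_lt, nonpos_iff_eq_zero] at hcon
    obtain ⟨b, hb0, hb⟩ := exists_between hpos
    have h1 := frequently_lt_of_lt_limsup (by isBoundedDefault) hb
    obtain ⟨U, hU, hUo, hUb⟩ := Set.exists_isOpen_lt_of_lt {x} b (by rw [hcon]; exact hb0)
    obtain ⟨ε, hε, hball⟩ := Metric.isOpen_iff.1 hUo x (hU rfl)
    have h2 : ∀ᶠ r in nhdsWithin (0:ℝ) (Ioi 0), r < ε := 
      nhdsWithin_le_nhds (eventually_lt_nhds hε)
    obtain ⟨r, hr1, hr2⟩ := (h1.and_eventually h2).exists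
    simp only [pow_zero, ENNReal.ofReal_one, div_one] at hr1
    have h3 : μ (closedBall x r) ≤ μ U := measure_mono ((closedBall_subset_ball hr2).trans hball)
    exact absurd (hr1.trans_le h3) (not_lt.2 hUb.le)
  have : x ∈ range g := by rw [← hg]; exact Or.inl hx0
  obtain ⟨i, hi⟩ := this
  exact mem_iUnion.2 ⟨i, 0, hi⟩

end partA
end AT

namespace AT

section partB
variable {n d : ℕ} {μ : Measure (EuclideanSpace ℝ (Fin d))}

theorem exists_piece (hn : 1 ≤ n) [IsFiniteMeasure μ]
    (hdens : ∀ᵐ x ∂μ, 0 < upperDensity n d μ x ∧ upperDensity n d μ x < ⊤)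
    (hjones : ∀ᵐ x ∂μ,
      (∫⁻ r in Set.Ioo (0 : ℝ) 1, beta2sq n d μ x r / ENNReal.ofReal r) < ⊤)
    (B : Set (EuclideanSpace ℝ (Fin d))) (hB : μ B ≠ 0) :
    ∃ f : EuclideanSpace ℝ (Fin n) → EuclideanSpace ℝ (Fin d), LipschitzWith 2 f ∧ 0 < μ (B ∩ range f) := by
  have hη := fun M : ℕ => core_beta (d := d) hn ((M : ℝ) + 1) (1 / (2 * ((M : ℝ) + 1))) (by positivity) (by positivity)
  choose η hηpos hcore using hη
  set E : ℕ → ℕ → Set (EuclideanSpace ℝ (Fin d)) := fun M m => {x | x ∈ B ∧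
    (∀ s, 0 < s → s ≤ 1 / ((m : ℝ) + 1) → μ (closedBall x s) ≤ ENNReal.ofReal (((M : ℝ) + 1) * s ^ n)) ∧
    (∃ᶠ r in nhdsWithin (0:ℝ) (Ioi 0), ENNReal.ofReal (r ^ n / ((M : ℝ) + 1)) ≤ μ (closedBall x r)) ∧
    ∫⁻ r in Ioo (0 : ℝ) (1 / ((m : ℝ) + 1)), beta2sq n d μ x r / ENNReal.ofReal r ≤ ENNReal.ofReal (η M / 2 ^ (n + 3))} with hE
  have hex : ∃ M m, μ (E M m) ≠ 0 := by
    by_contra hcon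
    push Not at hcon
    apply hB
    have hcov : B ⊆ ({x | ¬ (0 < upperDensity n d μ x ∧ upperDensity n d μ x < ⊤)} ∪ 
        {x | ¬ (∫⁻ r in Set.Ioo (0 : ℝ) 1, beta2sq n d μ x r / ENNReal.ofReal r) < ⊤}) ∪ ⋃ M, ⋃ m, E M m := by
      intro x hx
      by_cases h1 : 0 < upperDensity n d μ x ∧ upperDensity n d μ x < ⊤
      swap
      · exact Or.inl (Or.inl h1)
      by_cases h2 : (∫⁻ r in Set.Ioo (0 : ℝ) 1, beta2sq n d μ x r / ENNReal.ofReal r) < ⊤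
      swap
      · exact Or.inl (Or.inr h2)
      obtain ⟨M1, hM1⟩ := upper_growth x h1.2
      obtain ⟨M2, hM2⟩ := lower_freq x h1.1
      have h3 := hM1 (max M1 M2) (le_max_left _ _)
      have h4 := hM2 (max M1 M2) (le_max_right _ _)
      have h5 := jones_small _ h2 (η (max M1 M2) / 2 ^ (n + 3)) (by have := hηpos (max M1 M2); positivity)
      obtain ⟨m, hm1, hm2⟩ := (h3.and h5).exists
      exact Or.inr (mem_iUnion₂.2 ⟨max M1 M2, m, hx, hm1, h4, hm2⟩)
    refine measure_mono_null hcov (measure_union_null (measure_union_null (ae_iff.1 hdens) (ae_iff.1 hjones)) ?_)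
    exact measure_iUnion_null (fun M => measure_iUnion_null (fun m => hcon M m))
  obtain ⟨M, m, hMm⟩ := hex
  have hdp := Besicovitch.ae_tendsto_measure_inter_div μ (E M m)
  obtain ⟨x0, hx0E, hx0⟩ : ∃ x0 ∈ E M m, Tendsto (fun r => μ (E M m ∩ closedBall x0 r) / μ (closedBall x0 r)) (nhdsWithin 0 (Ioi 0)) (nhds 1) := by
    by_contra hcon
    push Not at hcon
    apply hMm
    rw [← Measure.restrict_apply_self]
    exact measure_mono_null (fun x hx => hcon x hx) (ae_iff.1 hdp)
  have h1 := hx0.eventually_const_le (show (2⁻¹ : ℝ≥0∞) < 1 by simp)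
  have h2 : ∀ᶠ r in nhdsWithin (0:ℝ) (Ioi 0), r < 1 / (4096 * ((m : ℝ) + 1)) := 
      nhdsWithin_le_nhds (eventually_lt_nhds (by positivity))
  obtain ⟨ρ, hρ1, ⟨hρ2, hρ3⟩, hρ4⟩ := (hx0E.2.2.1.and_eventually ((h1.and h2).and self_mem_nhdsWithin)).exists
  have hρ : 0 < ρ := hρ4
  have hρ5 : 4096 * ρ ≤ 1 / ((m : ℝ) + 1) := by
    rw [lt_div_iff₀ (by positivity)] at hρ3
    rw [le_div_iff₀ (by positivity)]
    linarith
  have hM1 : (0:ℝ) < (M : ℝ) + 1 := by positivity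
  have hmass : ENNReal.ofReal (1 / (2 * ((M : ℝ) + 1)) * ρ ^ n) ≤ μ (E M m ∩ closedBall x0 ρ) := by
    have hb0 : μ (closedBall x0 ρ) ≠ 0 := by
      intro h0
      rw [h0] at hρ1
      have : ENNReal.ofReal (ρ ^ n / ((M : ℝ) + 1)) = 0 := le_antisymm hρ1 zero_le
      rw [ENNReal.ofReal_eq_zero] at this
      have : 0 < ρ ^ n / ((M : ℝ) + 1) := by positivity
      linarith
    rw [ENNReal.le_div_iff_mul_le (Or.inl hb0) (Or.inl (measure_ne_top _ _))] at hρ2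
    refine le_trans ?_ hρ2
    calc ENNReal.ofReal (1 / (2 * ((M : ℝ) + 1)) * ρ ^ n) = 2⁻¹ * ENNReal.ofReal (ρ ^ n / ((M : ℝ) + 1)) := by
          have : (2⁻¹ : ℝ≥0∞) = ENNReal.ofReal (2⁻¹) := by
            rw [ENNReal.ofReal_inv_of_pos (by norm_num)]; simp
          rw [this, ← ENNReal.ofReal_mul (by positivity)]
          congr 1
          field_simp
      _ ≤ _ := by gcongr
  have hsum : ∀ x ∈ E M m ∩ closedBall x0 ρ, ∑' k : ℕ, beta2sq n d μ x (2048 * (ρ / 2 ^ k)) ≤ ENNReal.ofReal (η M) := by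
    intro x hx
    have h3 := dyadic (n := n) (μ := μ) x (2048 * ρ) (by positivity)
    simp only [mul_div_assoc] at h3
    refine h3.trans ?_
    calc _ ≤ ENNReal.ofReal (2 ^ (n + 3)) * ENNReal.ofReal (η M / 2 ^ (n + 3)) := by
          gcongr
          refine le_trans (lintegral_mono_set (Ioo_subset_Ioo_right ?_)) hx.1.2.2.2
          linarith
      _ = _ := by
          rw [← ENNReal.ofReal_mul (by positivity)]
          congr 1
          field_simp
  obtain ⟨f, hf, hpos⟩ := hcore M μ (E M m ∩ closedBall x0 ρ) x0 ρ ⟨hx0E, mem_closedBall_self hρ.le⟩ hρ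
    (fun x hx => by rw [← dist_eq_norm]; exact hx.2)
    (fun x hx s hs hs' => hx.1.2.1 s hs (hs'.trans hρ5)) hmass hsum
  refine ⟨f, hf, hpos.trans_le (measure_mono ?_)⟩
  rintro y ⟨hy, hy'⟩
  exact ⟨hy.1.1, hy'⟩

theorem measurableSet_range_lip (f : EuclideanSpace ℝ (Fin n) → EuclideanSpace ℝ (Fin d)) (hf : Continuous f) :
    MeasurableSet (range f) := by
  obtain ⟨K, hK, hK'⟩ := isSigmaCompact_range hf
  rw [← hK']
  exact MeasurableSet.iUnion (fun i => (hK i).isClosed.measurableSet)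

theorem exhaust [IsFiniteMeasure μ]
    (h : ∀ B : Set (EuclideanSpace ℝ (Fin d)), μ B ≠ 0 → 
      ∃ f : EuclideanSpace ℝ (Fin n) → EuclideanSpace ℝ (Fin d), LipschitzWith 2 f ∧ 0 < μ (B ∩ range f)) :
    ∃ f : ℕ → EuclideanSpace ℝ (Fin n) → EuclideanSpace ℝ (Fin d),
      (∀ i, LipschitzWith 2 (f i)) ∧ μ (Set.univ \ ⋃ i, Set.range (f i)) = 0 := by
  set S : Set ℝ≥0∞ := {a | ∃ f : ℕ → EuclideanSpace ℝ (Fin n) → EuclideanSpace ℝ (Fin d),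
      (∀ i, LipschitzWith 2 (f i)) ∧ a = μ (⋃ i, range (f i))} with hS
  have hne : S.Nonempty := ⟨_, fun _ _ => 0, fun _ => LipschitzWith.const' _, rfl⟩
  obtain ⟨u, -, hu, huS⟩ := exists_seq_tendsto_sSup hne (OrderTop.bddAbove S)
  choose g hg hgu using huS
  set F : ℕ → EuclideanSpace ℝ (Fin n) → EuclideanSpace ℝ (Fin d) := fun i => g (Nat.unpair i).1 (Nat.unpair i).2 with hF
  have hFL : ∀ i, LipschitzWith 2 (F i) := fun i => hg _ _
  have hmeas : ∀ i, MeasurableSet (range (F i)) := fun i => measurableSet_range_lip _ (hFL i).continuous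
  refine ⟨F, hFL, ?_⟩
  have hsup : sSup S ≤ μ (⋃ i, range (F i)) := by
    refine le_of_tendsto' hu (fun k => ?_)
    rw [hgu k]
    apply measure_mono
    apply iUnion_subset
    intro i
    refine subset_iUnion_of_subset (Nat.pair k i) ?_
    simp [hF]
  by_contra hcon
  obtain ⟨f, hf, hpos⟩ := h _ hcon
  let G : ℕ → EuclideanSpace ℝ (Fin n) → EuclideanSpace ℝ (Fin d) := fun i => if i = 0 then f else F (i - 1)
  have hG : ∀ i, LipschitzWith 2 (G i) := by
    intro i
    simp only [G]
    split_ifs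
    · exact hf
    · exact hFL _
  have h1 : μ (⋃ i, range (G i)) ≤ sSup S := le_sSup ⟨G, hG, rfl⟩
  have h2 : (⋃ i, range (F i)) ∪ ((Set.univ \ ⋃ i, Set.range (F i)) ∩ range f) ⊆ ⋃ i, range (G i) := by
    apply union_subset
    · apply iUnion_subset
      intro i
      refine subset_iUnion_of_subset (i + 1) ?_
      simp [G]
    · refine inter_subset_right.trans (subset_iUnion_of_subset 0 ?_)
      simp [G]
  have h3 := measure_mono (μ := μ) h2
  rw [measure_union' (by
    rw [Set.disjoint_left]
    intro x hx hx'
    exact hx'.1.2 hx) (MeasurableSet.iUnion hmeas)] at h3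
  have h4 := h3.trans (h1.trans hsup)
  have h5 : μ (⋃ i, range (F i)) < μ (⋃ i, range (F i)) + μ ((Set.univ \ ⋃ i, Set.range (F i)) ∩ range f) := 
    ENNReal.lt_add_right (measure_ne_top _ _) hpos.ne'
  exact absurd h4 (not_le.2 h5)

end partB
end AT

/-- If `μ` is a finite Borel measure on `ℝ^d` with `0 < Θ^{n,*}(x,μ) < ∞` μ-a.e. and
`∫₀¹ β_{μ,2}(x,r)² dr/r < ∞` μ-a.e., then `μ` is `n`-rectifiable. -/
theorem stmt0 (n d : ℕ) (μ : Measure (EuclideanSpace ℝ (Fin d))) [IsFiniteMeasure μ]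
    (hdens : ∀ᵐ x ∂μ, 0 < upperDensity n d μ x ∧ upperDensity n d μ x < ⊤)
    (hjones : ∀ᵐ x ∂μ,
      (∫⁻ r in Set.Ioo (0 : ℝ) 1, beta2sq n d μ x r / ENNReal.ofReal r) < ⊤) :
    ∃ f : ℕ → EuclideanSpace ℝ (Fin n) → EuclideanSpace ℝ (Fin d),
      (∀ i, ∃ K : NNReal, LipschitzWith K (f i)) ∧
      μ (Set.univ \ ⋃ i, Set.range (f i)) = 0 ∧
      μ ≪ μH[(n : ℝ)] := by
  have hac : μ ≪ μH[(n : ℝ)] := AT.abscont (hdens.mono fun x hx => hx.2)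
  rcases Nat.eq_zero_or_pos n with rfl | hn
  · obtain ⟨f, h1, h2⟩ := AT.case_zero (hdens.mono fun x hx => hx.1)
    exact ⟨f, h1, h2, hac⟩
  · obtain ⟨f, h1, h2⟩ := AT.exhaust (AT.exists_piece hn hdens hjones)
    exact ⟨f, fun i => ⟨2, h1 i⟩, h2, hac⟩
end

section
/- Let μ be a Radon measure on ℝ^d, B ⊂ ℝ^d a ball of radius r with μ(B) > 0, and let 0 < t < 1 and 0 < γ < 1. Then there exists ε = ε(t) > 0 (independent of γ) such that at least one of the following holds: (a) there are points x₀, x₁, …, x_n ∈ B with μ(B(x_k, t r) ∩ B) ≥ ε μ(B) for all 0 ≤ k ≤ n, and, letting L_k be the affine k-plane through x₀, …, x_k, dist(x_k, L_{k−1}) ≥ γ r for 1 ≤ k ≤ n; (b) there exists a family of balls {B_i}_{i∈I} of radius 4γr centered in B such that the balls 10B_i are pairwise disjoint, ∑_{i∈I} μ(B_i) ≳ μ(B), and Θ_μ(B_i) ≳ γ^{-1} Θ_μ(B) for all i ∈ I. -/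
open MeasureTheory Metric Set Filter
open scoped ENNReal NNReal

lemma packing_card {ι E : Type*} [NormedAddCommGroup E] [NormedSpace ℝ E] [FiniteDimensional ℝ E]
    (s : Finset ι) (f : ι → E) (x₀ : E) (R δ : ℝ) (hR : 0 ≤ R) (hδ : 0 < δ)
    (hs : ∀ c ∈ s, dist (f c) x₀ ≤ R)
    (h : ∀ c ∈ s, ∀ e ∈ s, c ≠ e → δ ≤ dist (f c) (f e)) :
    (s.card : ℝ) ≤ (2 * R / δ + 1) ^ Module.finrank ℝ E := by
  borelize E
  let μ : Measure E := Measure.addHaar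
  have hδ2 : 0 < δ / 2 := by positivity
  have ρpos : 0 < R + δ / 2 := by positivity
  set A := ⋃ c ∈ s, ball (f c) (δ / 2) with hA
  have D : Set.Pairwise (s : Set ι) (Function.onFun Disjoint fun c => ball (f c) (δ / 2)) := by
    rintro c hc e he hce
    apply ball_disjoint_ball
    have := h c hc e he hce
    linarith
  have A_subset : A ⊆ ball x₀ (R + δ / 2) := by
    refine iUnion₂_subset fun x hx => ?_
    apply ball_subset_ball'
    have := hs x hx
    linarith
  have I : (s.card : ℝ≥0∞) * ENNReal.ofReal ((δ / 2) ^ Module.finrank ℝ E) * μ (ball 0 1) ≤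
      ENNReal.ofReal ((R + δ / 2) ^ Module.finrank ℝ E) * μ (ball 0 1) :=
    calc
      (s.card : ℝ≥0∞) * ENNReal.ofReal ((δ / 2) ^ Module.finrank ℝ E) * μ (ball 0 1) = μ A := by
        rw [hA, measure_biUnion_finset D fun c _ => measurableSet_ball]
        simp only [μ.addHaar_ball_of_pos _ hδ2]
        simp only [Finset.sum_const, nsmul_eq_mul, mul_assoc]
      _ ≤ μ (ball x₀ (R + δ / 2)) := measure_mono A_subset
      _ = _ := by simp only [μ.addHaar_ball_of_pos _ ρpos]
  have J : (s.card : ℝ≥0∞) * ENNReal.ofReal ((δ / 2) ^ Module.finrank ℝ E) ≤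
      ENNReal.ofReal ((R + δ / 2) ^ Module.finrank ℝ E) :=
    (ENNReal.mul_le_mul_iff_left (measure_ball_pos _ _ zero_lt_one).ne' measure_ball_lt_top.ne).1 I
  have K := ENNReal.toReal_le_of_le_ofReal (pow_nonneg ρpos.le _) J
  rw [ENNReal.toReal_mul, ENNReal.toReal_natCast, ENNReal.toReal_ofReal (by positivity)] at K
  have e : 2 * R / δ + 1 = (R + δ / 2) / (δ / 2) := by field_simp
  rw [e, div_pow, le_div_iff₀ (by positivity)]
  exact K

lemma exists_net {E : Type*} [MetricSpace E] (A : Set E) (δ : ℝ) (hδ : 0 < δ) (N : ℝ)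
    (hN : ∀ s : Finset E, (s : Set E) ⊆ A → (∀ c ∈ s, ∀ e ∈ s, c ≠ e → δ ≤ dist c e) →
      (s.card : ℝ) ≤ N) :
    ∃ s : Finset E, (s : Set E) ⊆ A ∧ (∀ c ∈ s, ∀ e ∈ s, c ≠ e → δ ≤ dist c e) ∧
      ∀ a ∈ A, ∃ c ∈ s, dist a c < δ := by
  classical
  let Q : ℕ → Prop := fun k => ∃ s : Finset E, (s : Set E) ⊆ A ∧
    (∀ c ∈ s, ∀ e ∈ s, c ≠ e → δ ≤ dist c e) ∧ s.card = k
  have hQ0 : Q 0 := ⟨∅, by simp, by simp, rfl⟩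
  have hb : ∀ k, Q k → k ≤ ⌊N⌋₊ := by
    rintro k ⟨s, h1, h2, rfl⟩
    exact Nat.le_floor (hN s h1 h2)
  obtain ⟨s, h1, h2, h3⟩ : Q (Nat.findGreatest Q ⌊N⌋₊) :=
    Nat.findGreatest_spec (P := Q) (Nat.zero_le _) hQ0
  refine ⟨s, h1, h2, ?_⟩
  intro a ha
  by_contra! hcon
  have has : a ∉ s := by
    intro h
    have := hcon a h
    rw [dist_self] at this
    linarith
  have hQ : Q (s.card + 1) := by
    refine ⟨insert a s, ?_, ?_, Finset.card_insert_of_notMem has⟩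
    · intro x hx
      rcases Finset.mem_insert.1 (Finset.mem_coe.1 hx) with rfl | hx
      · exact ha
      · exact h1 hx
    · intro c hc e he hce
      rcases Finset.mem_insert.1 hc with rfl | hc' <;> rcases Finset.mem_insert.1 he with rfl | he'
      · exact absurd rfl hce
      · exact hcon e he'
      · rw [dist_comm]; exact hcon c hc'
      · exact h2 c hc' e he' hce
  have := Nat.le_findGreatest (P := Q) (hb _ hQ) hQ
  omega

lemma greedy {E : Type*} [MetricSpace E] (m : E → ℝ) (D M : ℝ) (hD : 0 ≤ D)
    (hm : ∀ x, 0 ≤ m x) (k : ℕ) :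
    ∀ G : Finset E, G.card ≤ k →
    (∀ p ∈ G, ∀ T : Finset E, T ⊆ G → (∀ q ∈ T, dist q p ≤ D) → (T.card : ℝ) ≤ M) →
    ∃ S : Finset E, S ⊆ G ∧ (∀ p ∈ S, ∀ q ∈ S, p ≠ q → D < dist p q) ∧
      ∑ p ∈ G, m p ≤ M * ∑ p ∈ S, m p := by
  classical
  induction k with
  | zero =>
    intro G hG _
    have : G = ∅ := Finset.card_eq_zero.1 (by omega)
    subst this
    exact ⟨∅, by simp, by simp, by simp⟩
  | succ k ih =>
    intro G hG hM
    rcases G.eq_empty_or_nonempty with rfl | hne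
    · exact ⟨∅, by simp, by simp, by simp⟩
    obtain ⟨p, hp, hmax⟩ := G.exists_max_image m hne
    let F := G.filter (fun q => D < dist q p)
    have hFG : F ⊆ G := Finset.filter_subset _ _
    have hpF : p ∉ F := by
      intro h
      have := (Finset.mem_filter.1 h).2
      rw [dist_self] at this
      linarith
    have hcard : F.card < G.card := Finset.card_lt_card
      ⟨hFG, fun h => hpF (h hp)⟩
    obtain ⟨S, hS1, hS2, hS3⟩ := ih F (by omega)
      (fun p hp T hT h => hM p (hFG hp) T (hT.trans hFG) h)
    have hpS : p ∉ S := fun h => hpF (hS1 h)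
    refine ⟨insert p S, ?_, ?_, ?_⟩
    · intro x hx
      rcases Finset.mem_insert.1 hx with rfl | hx
      · exact hp
      · exact hFG (hS1 hx)
    · intro c hc e he hce
      rcases Finset.mem_insert.1 hc with rfl | hc' <;> rcases Finset.mem_insert.1 he with rfl | he'
      · exact absurd rfl hce
      · rw [dist_comm]; exact (Finset.mem_filter.1 (hS1 he')).2
      · exact (Finset.mem_filter.1 (hS1 hc')).2
      · exact hS2 c hc' e he' hce
    · rw [Finset.sum_insert hpS, ← Finset.sum_filter_add_sum_filter_not G (fun q => D < dist q p)]
      have h1 : ∑ x ∈ G.filter (fun q => ¬ D < dist q p), m x ≤ M * m p := by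
        calc _ ≤ (G.filter (fun q => ¬ D < dist q p)).card • m p :=
              Finset.sum_le_card_nsmul _ _ _ (fun x hx => hmax x (Finset.mem_filter.1 hx).1)
          _ ≤ M * m p := by
              rw [nsmul_eq_mul]
              refine mul_le_mul_of_nonneg_right ?_ (hm p)
              exact hM p hp _ (Finset.filter_subset _ _)
                (fun q hq => not_lt.1 (Finset.mem_filter.1 hq).2)
      have h3 : ∑ x ∈ F, m x ≤ M * ∑ p ∈ S, m p := hS3
      change ∑ x ∈ F, m x + _ ≤ _
      linarith

lemma chain {E : Type*} [NormedAddCommGroup E] [NormedSpace ℝ E]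
    (H : Set E) (hH : H.Nonempty) (n : ℕ) (ρ : ℝ) :
    (∃ x : ℕ → E, ∀ j < n + 1, x j ∈ H ∧
      (0 < j → ρ ≤ infDist (x j) (affineSpan ℝ (x '' Iio j) : Set E))) ∨
    (∃ L : AffineSubspace ℝ E, (L : Set E).Nonempty ∧ FiniteDimensional ℝ L.direction ∧
      Module.finrank ℝ L.direction + 1 ≤ n ∧
      ∀ x ∈ H, infDist x (L : Set E) < ρ) := by
  classical
  by_cases hL : ∃ L : AffineSubspace ℝ E, (L : Set E).Nonempty ∧
      FiniteDimensional ℝ L.direction ∧ Module.finrank ℝ L.direction + 1 ≤ n ∧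
      ∀ x ∈ H, infDist x (L : Set E) < ρ
  · exact Or.inr hL
  left
  push Not at hL
  obtain ⟨h0, hh0⟩ := hH
  have key : ∀ k ≤ n + 1, ∃ x : ℕ → E, ∀ j < k, x j ∈ H ∧
      (0 < j → ρ ≤ infDist (x j) (affineSpan ℝ (x '' Iio j) : Set E)) := by
    intro k
    induction k with
    | zero => intro _; exact ⟨fun _ => h0, by simp⟩
    | succ k ih =>
      intro hk
      obtain ⟨x, hx⟩ := ih (by omega)
      have hy : ∃ y ∈ H, 0 < k → ρ ≤ infDist y (affineSpan ℝ (x '' Iio k) : Set E) := by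
        rcases Nat.eq_zero_or_pos k with rfl | hkpos
        · exact ⟨h0, hh0, by simp⟩
        · have hfin : (x '' Iio k).Finite := (Set.finite_Iio k).image x
          have hfd : FiniteDimensional ℝ (affineSpan ℝ (x '' Iio k)).direction := by
            rw [direction_affineSpan]
            exact finiteDimensional_vectorSpan_of_finite ℝ hfin
          have hrank : Module.finrank ℝ (affineSpan ℝ (x '' Iio k)).direction + 1 ≤ n := by
            have := finrank_vectorSpan_image_finset_le ℝ x (Finset.range k) (n := k - 1)
              (by rw [Finset.card_range]; omega)
            rw [Finset.coe_image, Finset.coe_range] at this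
            rw [direction_affineSpan]
            omega
          obtain ⟨y, hy, hy2⟩ := hL (affineSpan ℝ (x '' Iio k))
            ((affineSpan_nonempty ℝ).2 ⟨x 0, 0, hkpos, rfl⟩) hfd hrank
          exact ⟨y, hy, fun _ => hy2⟩
      obtain ⟨y, hyH, hyd⟩ := hy
      have himg : ∀ j ≤ k, Function.update x k y '' Iio j = x '' Iio j := by
        intro j hj
        apply Set.image_congr
        intro i hi
        have : i < j := hi
        exact Function.update_of_ne (by omega) _ _
      refine ⟨Function.update x k y, ?_⟩
      intro j hj
      rw [himg j (by omega)]
      rcases Nat.lt_or_ge j k with h | h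
      · rw [Function.update_of_ne (by omega)]
        exact hx j h
      · have : j = k := by omega
        subst this
        rw [Function.update_self]
        exact ⟨hyH, hyd⟩
  exact key (n + 1) le_rfl

lemma plane_card {E : Type*} [NormedAddCommGroup E] [NormedSpace ℝ E]
    (L : AffineSubspace ℝ E) (hfd : FiniteDimensional ℝ L.direction) (n : ℕ)
    (hrank : Module.finrank ℝ L.direction + 1 ≤ n) (hne : (L : Set E).Nonempty)
    (x₀ : E) (r γ : ℝ) (hr : 0 < r) (hγ : 0 < γ) (hγ1 : γ < 1)
    (P : Finset E) (hP : (P : Set E) ⊆ closedBall x₀ r)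
    (hPL : ∀ x ∈ P, infDist x (L : Set E) < γ * r)
    (hsep : ∀ c ∈ P, ∀ e ∈ P, c ≠ e → 4 * γ * r ≤ dist c e) :
    (P.card : ℝ) ≤ (5 / γ) ^ (n - 1) := by
  rcases P.eq_empty_or_nonempty with rfl | ⟨p0, hp0⟩
  · simp only [Finset.card_empty, Nat.cast_zero]; positivity
  have hy : ∀ x : E, ∃ y ∈ L, x ∈ P → dist x y < γ * r := by
    intro x
    by_cases hx : x ∈ P
    · obtain ⟨y, hy, hd⟩ := (infDist_lt_iff hne).1 (hPL x hx)
      exact ⟨y, hy, fun _ => hd⟩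
    · obtain ⟨y, hy⟩ := hne
      exact ⟨y, hy, fun h => absurd h hx⟩
  choose y hyL hyd using hy
  let f : E → L.direction := fun x => ⟨y x -ᵥ y p0, AffineSubspace.vsub_mem_direction (hyL x) (hyL p0)⟩
  have hf : ∀ a b, dist (f a) (f b) = dist (y a) (y b) := by
    intro a b
    rw [Subtype.dist_eq]
    simp [f]
  have hγr : 0 < γ * r := by positivity
  have hγr1 : γ * r ≤ r := by nlinarith
  have h1 := packing_card P f (f p0) (4 * r) (2 * (γ * r)) (by positivity) (by positivity)
    (by
      intro c hc
      rw [hf]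
      have h1 := hyd c hc
      have h2 := hyd p0 hp0
      have h3 := mem_closedBall.1 (hP hc)
      have h4 := mem_closedBall.1 (hP hp0)
      have h5 := dist_triangle_right c p0 x₀
      have h6 := dist_triangle4 (y c) c p0 (y p0)
      rw [dist_comm (y c) c] at h6
      linarith)
    (by
      intro c hc e he hce
      rw [hf]
      have h1 := hyd c hc
      have h2 := hyd e he
      have h3 := hsep c hc e he hce
      have h6 := dist_triangle4 c (y c) (y e) e
      rw [dist_comm (y e) e] at h6
      linarith)
  have e1 : 2 * (4 * r) / (2 * (γ * r)) + 1 ≤ 5 / γ := by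
    have : 2 * (4 * r) / (2 * (γ * r)) = 4 / γ := by field_simp
    rw [this, div_add_one hγ.ne']
    gcongr
    linarith
  calc (P.card : ℝ) ≤ _ := h1
    _ ≤ (5 / γ) ^ Module.finrank ℝ L.direction := by gcongr
    _ ≤ (5 / γ) ^ (n - 1) := by
      apply pow_le_pow_right₀
      · rw [le_div_iff₀ hγ]; linarith
      · omega

/-- Balanced-balls lemma: either there are `n+1` quantitatively affinely independent points
carrying a fixed fraction of the mass (alternative (a)), or a disjoint family of small balls of
radius `4γr`, with centers in `B`, disjoint tenfold dilations, carrying a fixed fraction of the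
mass and having densities `≳ γ⁻¹ Θ_μ(B)` (alternative (b)). The constant `ε = ε(t)` does not
depend on `γ`, and the implicit constant `c` depends only on `n, d`. -/
theorem stmt2 (n d : ℕ) (hnd : n < d) :
    ∃ c : ℝ, 0 < c ∧
    ∀ t : ℝ, 0 < t → t < 1 →
    ∃ ε : ℝ, 0 < ε ∧
    ∀ (μ : Measure (EuclideanSpace ℝ (Fin d))), IsLocallyFiniteMeasure μ →
    ∀ (x₀ : EuclideanSpace ℝ (Fin d)) (r : ℝ), 0 < r → 0 < μ (closedBall x₀ r) →
    ∀ γ : ℝ, 0 < γ → γ < 1 →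
      -- alternative (a)
      ((∃ x : Fin (n + 1) → EuclideanSpace ℝ (Fin d),
          (∀ k, x k ∈ closedBall x₀ r) ∧
          (∀ k, ENNReal.ofReal ε * μ (closedBall x₀ r) ≤
            μ (closedBall (x k) (t * r) ∩ closedBall x₀ r)) ∧
          (∀ k : Fin (n + 1), 0 < (k : ℕ) →
            γ * r ≤ infDist (x k)
              (affineSpan ℝ (x '' {j : Fin (n + 1) | (j : ℕ) < (k : ℕ)}) :
                Set (EuclideanSpace ℝ (Fin d))))) ∨
      -- alternative (b)
      (∃ S : Set (EuclideanSpace ℝ (Fin d)), S.Countable ∧ S ⊆ closedBall x₀ r ∧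
          (S.Pairwise fun y z =>
            Disjoint (closedBall y (10 * (4 * γ * r))) (closedBall z (10 * (4 * γ * r)))) ∧
          ENNReal.ofReal c * μ (closedBall x₀ r) ≤ ∑' y : S, μ (closedBall y (4 * γ * r)) ∧
          (∀ y ∈ S,
            ENNReal.ofReal (c / γ) *
                (μ (closedBall x₀ r) / ENNReal.ofReal (r ^ n)) ≤
              μ (closedBall y (4 * γ * r)) / ENNReal.ofReal ((4 * γ * r) ^ n)))) := by
  classical
  set c1 : ℝ := 1 / (4 * 5 ^ (n - 1) * 4 ^ n) with hc1
  set c2 : ℝ := 1 / (4 * 41 ^ d) with hc2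
  have hc1p : 0 < c1 := by positivity
  have hc2p : 0 < c2 := by positivity
  refine ⟨min c1 c2, lt_min hc1p hc2p, ?_⟩
  intro t ht ht1
  set N : ℝ := (2 / t + 1) ^ d with hN
  have hNp : 0 < N := by positivity
  refine ⟨1 / (2 * N), by positivity, ?_⟩
  intro μ hμ x₀ r hr hB γ hγ hγ1
  set B := closedBall x₀ r with hBdef
  have hfinB : ∀ (y : EuclideanSpace ℝ (Fin d)) (s : ℝ), μ (closedBall y s) ≠ ∞ :=
    fun y s => (isCompact_closedBall y s).measure_lt_top.ne
  have hBfin : μ B ≠ ∞ := hfinB _ _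
  set b := μ.real B with hb
  have hbp : 0 < b := ENNReal.toReal_pos hB.ne' hBfin
  have hμB : μ B = ENNReal.ofReal b := (ofReal_measureReal hBfin).symm
  -- light and heavy points
  set A : Set (EuclideanSpace ℝ (Fin d)) :=
    {x | x ∈ B ∧ μ.real (closedBall x (t * r) ∩ B) < 1 / (2 * N) * b} with hA
  set H : Set (EuclideanSpace ℝ (Fin d)) :=
    {x | x ∈ B ∧ 1 / (2 * N) * b ≤ μ.real (closedBall x (t * r) ∩ B)} with hH
  have hIfin : ∀ x, μ (closedBall x (t * r) ∩ B) ≠ ∞ := fun x =>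
    measure_ne_top_of_subset inter_subset_right hBfin
  have hAcard : ∀ s : Finset (EuclideanSpace ℝ (Fin d)), (s : Set _) ⊆ A →
      (∀ c ∈ s, ∀ e ∈ s, c ≠ e → t * r ≤ dist c e) → (s.card : ℝ) ≤ N := by
    intro s hs hsep
    have := packing_card s id x₀ r (t * r) hr.le (by positivity)
      (fun c hc => mem_closedBall.1 (hs hc).1) hsep
    rw [finrank_euclideanSpace_fin] at this
    have e : 2 * r / (t * r) = 2 / t := by field_simp
    rw [e] at this
    exact this
  have hAmass : μ.real A ≤ b / 2 := by
    obtain ⟨s, hs, hsep, hcov⟩ := exists_net A (t * r) (by positivity) N hAcard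
    have hsub : A ⊆ ⋃ p ∈ s, (closedBall p (t * r) ∩ B) := by
      intro a ha
      obtain ⟨p, hp, hd⟩ := hcov a ha
      exact mem_biUnion (Finset.mem_coe.2 hp) ⟨mem_closedBall.2 hd.le, ha.1⟩
    have hfin : μ (⋃ p ∈ s, (closedBall p (t * r) ∩ B)) ≠ ∞ :=
      measure_ne_top_of_subset (iUnion₂_subset fun p _ => inter_subset_right) hBfin
    calc μ.real A ≤ μ.real (⋃ p ∈ s, (closedBall p (t * r) ∩ B)) := measureReal_mono hsub hfin
      _ ≤ ∑ p ∈ s, μ.real (closedBall p (t * r) ∩ B) := measureReal_biUnion_finset_le _ _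
      _ ≤ s.card • (1 / (2 * N) * b) :=
        Finset.sum_le_card_nsmul _ _ _ (fun p hp => (hs hp).2.le)
      _ = s.card * (1 / (2 * N) * b) := nsmul_eq_mul _ _
      _ ≤ N * (1 / (2 * N) * b) :=
        mul_le_mul_of_nonneg_right (hAcard s hs hsep) (by positivity)
      _ = b / 2 := by field_simp
  have hHmass : b / 2 ≤ μ.real H := by
    have hsub : B ⊆ A ∪ H := by
      intro x hx
      rcases lt_or_ge (μ.real (closedBall x (t * r) ∩ B)) (1 / (2 * N) * b) with h | h
      · exact Or.inl ⟨hx, h⟩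
      · exact Or.inr ⟨hx, h⟩
    have hU : A ∪ H ⊆ B := union_subset (fun x hx => hx.1) (fun x hx => hx.1)
    have h1 : b ≤ μ.real (A ∪ H) :=
      measureReal_mono hsub (measure_ne_top_of_subset hU hBfin)
    have h2 := measureReal_union_le (μ := μ) A H
    linarith
  have hHne : H.Nonempty := by
    by_contra hcon
    rw [not_nonempty_iff_eq_empty.1 hcon] at hHmass
    rw [measureReal_empty] at hHmass
    linarith
  rcases chain H hHne n (γ * r) with ⟨x, hx⟩ | ⟨L, hLne, hLfd, hLrank, hLd⟩
  · left
    refine ⟨fun k => x k, fun k => (hx k k.2).1.1, ?_, ?_⟩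
    · intro k
      have := (hx k k.2).1.2
      rw [hμB, ← ENNReal.ofReal_mul (by positivity), ← ofReal_measureReal (hIfin _)]
      exact ENNReal.ofReal_le_ofReal this
    · intro k hk
      have := (hx k k.2).2 hk
      have e : (fun k : Fin (n + 1) => x k) '' {j : Fin (n + 1) | (j : ℕ) < (k : ℕ)} =
          x '' Iio (k : ℕ) := by
        ext z
        constructor
        · rintro ⟨j, hj, rfl⟩
          exact ⟨j, hj, rfl⟩
        · rintro ⟨j, hj, rfl⟩
          have hj' : j < (k : ℕ) := hj
          exact ⟨⟨j, by omega⟩, hj', rfl⟩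
      rw [e]
      exact this
  · right
    have hρ : 0 < 4 * γ * r := by positivity
    have hcard : ∀ s : Finset (EuclideanSpace ℝ (Fin d)), (s : Set _) ⊆ H →
        (∀ c ∈ s, ∀ e ∈ s, c ≠ e → 4 * γ * r ≤ dist c e) → (s.card : ℝ) ≤ (5 / γ) ^ (n - 1) :=
      fun s hs hsep => plane_card L hLfd n hLrank hLne x₀ r γ hr hγ hγ1 s
        (fun x hx => (hs hx).1) (fun x hx => hLd x (hs hx)) hsep
    obtain ⟨P, hPH, hPsep, hPcov⟩ := exists_net H (4 * γ * r) hρ _ hcard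
    let m : EuclideanSpace ℝ (Fin d) → ℝ := fun p => μ.real (closedBall p (4 * γ * r))
    have hm0 : ∀ p, 0 ≤ m p := fun p => measureReal_nonneg
    have hPsum : b / 2 ≤ ∑ p ∈ P, m p := by
      have hsub : H ⊆ ⋃ p ∈ P, closedBall p (4 * γ * r) := by
        intro a ha
        obtain ⟨p, hp, hd⟩ := hPcov a ha
        exact mem_biUnion (Finset.mem_coe.2 hp) (mem_closedBall.2 hd.le)
      have hfin : μ (⋃ p ∈ P, closedBall p (4 * γ * r)) ≠ ∞ :=
        (P.isCompact_biUnion fun p _ => isCompact_closedBall p _).measure_lt_top.ne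
      exact hHmass.trans ((measureReal_mono hsub hfin).trans (measureReal_biUnion_finset_le _ _))
    set τ : ℝ := γ ^ (n - 1) / (4 * 5 ^ (n - 1)) * b with hτ
    have hτp : 0 < τ := by positivity
    let G := P.filter (fun p => τ ≤ m p)
    have hGsum : b / 4 ≤ ∑ p ∈ G, m p := by
      have h1 : ∑ p ∈ P.filter (fun p => ¬ τ ≤ m p), m p ≤ b / 4 := by
        calc _ ≤ (P.filter (fun p => ¬ τ ≤ m p)).card • τ :=
              Finset.sum_le_card_nsmul _ _ _
                (fun x hx => (not_le.1 (Finset.mem_filter.1 hx).2).le)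
          _ = (P.filter (fun p => ¬ τ ≤ m p)).card * τ := nsmul_eq_mul _ _
          _ ≤ (5 / γ) ^ (n - 1) * τ := by
              refine mul_le_mul_of_nonneg_right ?_ hτp.le
              refine le_trans ?_ (hcard P hPH hPsep)
              exact_mod_cast Finset.card_le_card (Finset.filter_subset _ _)
          _ = b / 4 := by
              rw [hτ, div_pow]; field_simp
      have h2 := Finset.sum_filter_add_sum_filter_not P (fun p => τ ≤ m p) m
      change ∑ p ∈ G, m p + _ = _ at h2
      linarith
    have hGP : G ⊆ P := Finset.filter_subset _ _
    obtain ⟨S, hSG, hSsep, hSsum⟩ := greedy m (20 * (4 * γ * r)) (41 ^ d) (by positivity) hm0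
      G.card G le_rfl (by
        intro p hp T hT hTd
        have := packing_card T id p (20 * (4 * γ * r)) (4 * γ * r) (by positivity) hρ hTd
          (fun c hc e he hce => hPsep c (hGP (hT hc)) e (hGP (hT he)) hce)
        rw [finrank_euclideanSpace_fin] at this
        have e : 2 * (20 * (4 * γ * r)) / (4 * γ * r) + 1 = 41 := by field_simp; norm_num
        rw [e] at this
        exact this)
    refine ⟨(S : Set _), S.countable_toSet, fun x hx => (hPH (hGP (hSG hx))).1, ?_, ?_, ?_⟩
    · intro y hy z hz hyz
      apply closedBall_disjoint_closedBall
      have := hSsep y hy z hz hyz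
      linarith
    · rw [Finset.tsum_subtype' S (fun y => μ (closedBall y (4 * γ * r)))]
      have e : ∑ y ∈ S, μ (closedBall y (4 * γ * r)) = ENNReal.ofReal (∑ y ∈ S, m y) := by
        rw [ENNReal.ofReal_sum_of_nonneg (fun i _ => hm0 i)]
        exact Finset.sum_congr rfl (fun y _ => (ofReal_measureReal (hfinB _ _)).symm)
      rw [e, hμB, ← ENNReal.ofReal_mul (lt_min hc1p hc2p).le]
      apply ENNReal.ofReal_le_ofReal
      calc min c1 c2 * b ≤ c2 * b := mul_le_mul_of_nonneg_right (min_le_right _ _) hbp.le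
        _ = (b / 4) / 41 ^ d := by rw [hc2]; field_simp
        _ ≤ ∑ y ∈ S, m y := by
          rw [div_le_iff₀ (by positivity), mul_comm]
          exact hGsum.trans hSsum
    · intro y hy
      have hmy : τ ≤ m y := (Finset.mem_filter.1 (hSG hy)).2
      have e : μ (closedBall y (4 * γ * r)) = ENNReal.ofReal (m y) :=
        (ofReal_measureReal (hfinB _ _)).symm
      rw [e, hμB, ← ENNReal.ofReal_div_of_pos (by positivity),
        ← ENNReal.ofReal_div_of_pos (by positivity),
        ← ENNReal.ofReal_mul (div_pos (lt_min hc1p hc2p) hγ).le]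
      apply ENNReal.ofReal_le_ofReal
      calc min c1 c2 / γ * (b / r ^ n) ≤ c1 / γ * (b / r ^ n) := by
            gcongr
            exact min_le_left _ _
        _ = τ / (4 * γ * r) ^ n := by
            obtain ⟨k, rfl⟩ : ∃ k, n = k + 1 := ⟨n - 1, by omega⟩
            rw [hτ, hc1, Nat.add_sub_cancel, mul_pow, mul_pow, pow_succ γ]
            field_simp
        _ ≤ m y / (4 * γ * r) ^ n := by gcongr
end
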